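/- Let Γ be a non-elementary hyperbolic group. Then there exists a family {N_α : α ∈ ℕ^{<∞}} of normal subgroups of Γ indexed by finite sequences of natural numbers such that: (i) the N_α are pairwise distinct; (ii) if α is a prefix of β then N_α ⊆ N_β (so the quotient Q_α = Γ/N_α surjects Γ-equivariantly onto Q_β); and (iii) every quotient Γ/N_α is a non-elementary hyperbolic group. -/

import Mathlib

/-- The word length of `g` with respect to a (symmetric) generating set `S`: the least
`k` such that `g` is a product of `k` elements of `S`. -/
noncomputable def wordLength {Γ : Type*} [Group Γ] (S : Set Γ) (g : Γ) : ℕ :=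
  sInf {k | ∃ l : List Γ, (∀ x ∈ l, x ∈ S) ∧ l.length = k ∧ l.prod = g}

/-- The Gromov product `(x|y)_w = ½(d(x,w) + d(y,w) − d(x,y))` with respect to the word
metric `d(x,y) = |x⁻¹y|_S` of a generating set `S`. -/
noncomputable def wordGromovProduct {Γ : Type*} [Group Γ] (S : Set Γ) (w x y : Γ) : ℝ :=
  ((wordLength S (x⁻¹ * w) : ℝ) + (wordLength S (y⁻¹ * w) : ℝ) -
    (wordLength S (x⁻¹ * y) : ℝ)) / 2

/-- A group is hyperbolic if it has a finite symmetric generating set whose word metric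
is Gromov hyperbolic: for some `δ ≥ 0`, `(x|z)_w ≥ min((x|y)_w, (y|z)_w) − δ` for all
`x, y, z, w`. -/
def IsHyperbolicGroup (Γ : Type*) [Group Γ] : Prop :=
  ∃ S : Set Γ, S.Finite ∧ (∀ s ∈ S, s⁻¹ ∈ S) ∧ Subgroup.closure S = ⊤ ∧
    ∃ δ : ℝ, 0 ≤ δ ∧ ∀ x y z w : Γ,
      wordGromovProduct S w x z ≥
        min (wordGromovProduct S w x y) (wordGromovProduct S w y z) - δ

/-- A group is non-elementary if it is not virtually cyclic, i.e. it contains no cyclic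
subgroup of finite index. -/
def IsNonElementaryGroup (Γ : Type*) [Group Γ] : Prop :=
  ∀ g : Γ, (Subgroup.zpowers g).index = 0

/-- The quotient of `G` by the normal subgroup `N` is a non-elementary hyperbolic
group. -/
def QuotientIsNonElementaryHyperbolic {G : Type*} [Group G] (N : Subgroup G)
    (hN : N.Normal) : Prop :=
  letI := hN
  IsHyperbolicGroup (G ⧸ N) ∧ IsNonElementaryGroup (G ⧸ N)

namespace HypQ

/-- Integer valued geodesic metric. -/
structure GeoM {X : Type*} (d : X → X → ℕ) : Prop where
  self : ∀ x, d x x = 0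
  eq : ∀ x y, d x y = 0 → x = y
  symm : ∀ x y, d x y = d y x
  tri : ∀ x y z, d x z ≤ d x y + d y z
  interp : ∀ x y k, k ≤ d x y → ∃ p, d x p = k ∧ k + d p y = d x y

/-- Four point condition. -/
def Hyp {X : Type*} (d : X → X → ℕ) (δ : ℕ) : Prop :=
  ∀ x y z w, d x z + d y w ≤ max (d x y + d z w) (d y z + d x w) + δ

/-- Word metric. -/
noncomputable def wd {G : Type*} [Group G] (S : Set G) (x y : G) : ℕ := wordLength S (x⁻¹ * y)

section WordMetric
variable {G : Type*} [Group G] {S : Set G}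

lemma exists_word (hsym : ∀ s ∈ S, s⁻¹ ∈ S) (hgen : Subgroup.closure S = ⊤) (g : G) :
    ∃ l : List G, (∀ x ∈ l, x ∈ S) ∧ l.prod = g := by
  have hg : g ∈ Subgroup.closure S := by rw [hgen]; trivial
  induction hg using Subgroup.closure_induction with
  | mem x hx => exact ⟨[x], by simpa using hx, by simp⟩
  | one => exact ⟨[], by simp, by simp⟩
  | mul x y _ _ hx hy =>
    obtain ⟨l, hl, rfl⟩ := hx
    obtain ⟨m, hm, rfl⟩ := hy
    refine ⟨l ++ m, ?_, by simp⟩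
    intro z hz
    rcases List.mem_append.1 hz with h | h
    · exact hl z h
    · exact hm z h
  | inv x _ hx =>
    obtain ⟨l, hl, rfl⟩ := hx
    refine ⟨(l.map (·⁻¹)).reverse, ?_, by rw [List.prod_inv_reverse]⟩
    intro z hz
    simp only [List.mem_reverse, List.mem_map] at hz
    obtain ⟨a, ha, rfl⟩ := hz
    exact hsym a (hl a ha)

lemma wordLength_le {l : List G} (hl : ∀ x ∈ l, x ∈ S) : wordLength S l.prod ≤ l.length :=
  Nat.sInf_le ⟨l, hl, rfl, rfl⟩

lemma exists_geod (hsym : ∀ s ∈ S, s⁻¹ ∈ S) (hgen : Subgroup.closure S = ⊤) (g : G) :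
    ∃ l : List G, (∀ x ∈ l, x ∈ S) ∧ l.length = wordLength S g ∧ l.prod = g := by
  obtain ⟨l, hl, hp⟩ := exists_word hsym hgen g
  exact Nat.sInf_mem (s := {k | ∃ l : List G, (∀ x ∈ l, x ∈ S) ∧ l.length = k ∧ l.prod = g})
    ⟨l.length, l, hl, rfl, hp⟩

lemma wordLength_mul (hsym : ∀ s ∈ S, s⁻¹ ∈ S) (hgen : Subgroup.closure S = ⊤) (g h : G) :
    wordLength S (g * h) ≤ wordLength S g + wordLength S h := by
  obtain ⟨l, hl, hn, hp⟩ := exists_geod hsym hgen g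
  obtain ⟨l', hl', hn', hp'⟩ := exists_geod hsym hgen h
  have : wordLength S (l ++ l').prod ≤ (l ++ l').length := wordLength_le (by
    intro z hz
    rcases List.mem_append.1 hz with h | h
    · exact hl z h
    · exact hl' z h)
  simpa [hn, hn', hp, hp'] using this

lemma wordLength_inv_le (hsym : ∀ s ∈ S, s⁻¹ ∈ S) (hgen : Subgroup.closure S = ⊤) (g : G) :
    wordLength S g⁻¹ ≤ wordLength S g := by
  obtain ⟨l, hl, hn, hp⟩ := exists_geod hsym hgen g
  have : wordLength S ((l.map (·⁻¹)).reverse).prod ≤ ((l.map (·⁻¹)).reverse).length :=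
    wordLength_le (by
      intro z hz
      simp only [List.mem_reverse, List.mem_map] at hz
      obtain ⟨a, ha, rfl⟩ := hz
      exact hsym a (hl a ha))
  rw [← List.prod_inv_reverse, hp] at this
  simpa [hn] using this

lemma wordLength_inv (hsym : ∀ s ∈ S, s⁻¹ ∈ S) (hgen : Subgroup.closure S = ⊤) (g : G) :
    wordLength S g⁻¹ = wordLength S g := by
  apply le_antisymm (wordLength_inv_le hsym hgen g)
  simpa using wordLength_inv_le hsym hgen g⁻¹

lemma wordLength_one : wordLength S (1 : G) = 0 := by
  have := wordLength_le (S := S) (l := []) (by simp)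
  simpa using this

lemma wd_left (S : Set G) (g x y : G) : wd S (g * x) (g * y) = wd S x y := by
  simp [wd, mul_assoc]

lemma wd_geo (hsym : ∀ s ∈ S, s⁻¹ ∈ S) (hgen : Subgroup.closure S = ⊤) : GeoM (wd S) where
  self x := by simp [wd, wordLength_one]
  eq x y h := by
    obtain ⟨l, hl, hn, hp⟩ := exists_geod hsym hgen (x⁻¹ * y)
    have h0 : wordLength S (x⁻¹ * y) = 0 := h
    rw [h0, List.length_eq_zero_iff] at hn
    subst hn
    simp only [List.prod_nil] at hp
    exact (inv_mul_eq_one.1 hp.symm)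
  symm x y := by
    unfold wd
    rw [← wordLength_inv hsym hgen]; simp
  tri x y z := by
    unfold wd
    have := wordLength_mul hsym hgen (x⁻¹ * y) (y⁻¹ * z)
    simpa [mul_assoc] using this
  interp x y k hk := by
    obtain ⟨l, hl, hn, hp⟩ := exists_geod hsym hgen (x⁻¹ * y)
    have hk' : k ≤ l.length := by rw [hn]; exact hk
    have h1 : wordLength S (l.take k).prod ≤ (l.take k).length :=
      wordLength_le (fun z hz => hl z (List.mem_of_mem_take hz))
    have h2 : wordLength S (l.drop k).prod ≤ (l.drop k).length :=
      wordLength_le (fun z hz => hl z (List.mem_of_mem_drop hz))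
    have h3 : (l.take k).prod * (l.drop k).prod = x⁻¹ * y := by
      rw [List.prod_take_mul_prod_drop, hp]
    have h4 := wordLength_mul hsym hgen (l.take k).prod (l.drop k).prod
    rw [h3] at h4
    rw [List.length_take] at h1
    rw [List.length_drop] at h2
    have e1 : wd S x (x * (l.take k).prod) = wordLength S (l.take k).prod := by
      simp [wd]
    have e2 : wd S (x * (l.take k).prod) y = wordLength S (l.drop k).prod := by
      unfold wd
      congr 1
      rw [mul_inv_rev, mul_assoc, ← h3, inv_mul_cancel_left]
    have e3 : wd S x y = wordLength S (x⁻¹ * y) := rfl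
    refine ⟨x * (l.take k).prod, ?_, ?_⟩
    · rw [e1]; omega
    · rw [e2, e3]; omega

lemma wd_le_one (hsym : ∀ s ∈ S, s⁻¹ ∈ S) (hgen : Subgroup.closure S = ⊤) {x y : G}
    (h : wd S x y ≤ 1) : x = y ∨ x⁻¹ * y ∈ S := by
  obtain ⟨l, hl, hn, hp⟩ := exists_geod hsym hgen (x⁻¹ * y)
  have h' : l.length ≤ 1 := by rw [hn]; exact h
  match l, h' with
  | [], _ => left; simp only [List.prod_nil] at hp; exact (inv_mul_eq_one.1 hp.symm)
  | [a], _ => right; simp at hp; rw [← hp]; exact hl a (by simp)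

lemma wd_le_of_mem {x y : G} (h : x⁻¹ * y ∈ S) : wd S x y ≤ 1 := by
  have := wordLength_le (S := S) (l := [x⁻¹ * y]) (by simpa using h)
  simpa [wd] using this

lemma ball_finite (hfin : S.Finite) (hsym : ∀ s ∈ S, s⁻¹ ∈ S) (hgen : Subgroup.closure S = ⊤)
    (n : ℕ) : {g : G | wd S 1 g ≤ n}.Finite := by
  induction n with
  | zero =>
    refine (Set.finite_singleton (1 : G)).subset ?_
    intro g hg
    exact ((wd_geo hsym hgen).eq 1 g (Nat.le_zero.1 hg)).symm
  | succ n ih =>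
    refine (ih.union (Set.Finite.mul ih hfin)).subset ?_
    intro g hg
    by_cases h : wd S 1 g ≤ n
    · left; exact h
    · right
      have hg' : wd S 1 g ≤ n + 1 := hg
      obtain ⟨p, hp1, hp2⟩ := (wd_geo hsym hgen).interp 1 g n (by omega)
      have h1 : wd S p g ≤ 1 := by omega
      have h0 : wd S p g ≠ 0 := by omega
      rcases wd_le_one hsym hgen h1 with h | h
      · subst h; exact absurd ((wd_geo hsym hgen).self p) h0
      · exact ⟨p, hp1.le, p⁻¹ * g, h, by simp⟩

lemma hyp_of_gromov {δ : ℝ} (hsym : ∀ s ∈ S, s⁻¹ ∈ S) (hgen : Subgroup.closure S = ⊤)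
    (h : ∀ x y z w : G, wordGromovProduct S w x z ≥
        min (wordGromovProduct S w x y) (wordGromovProduct S w y z) - δ) :
    ∃ δ' : ℕ, Hyp (wd S) δ' := by
  obtain ⟨n, hn⟩ := exists_nat_ge (2 * δ)
  refine ⟨n, fun x y z w => ?_⟩
  have := h x y z w
  simp only [wordGromovProduct] at this
  have s := (wd_geo hsym hgen).symm w z
  unfold wd at s
  have key : ((wd S x z + wd S y w : ℕ) : ℝ) ≤
      ((max (wd S x y + wd S z w) (wd S y z + wd S x w) + n : ℕ) : ℝ) := by
    push_cast
    unfold wd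
    rcases le_total (((wordLength S (x⁻¹ * w) : ℝ) + (wordLength S (y⁻¹ * w) : ℝ) -
      (wordLength S (x⁻¹ * y) : ℝ)) / 2) (((wordLength S (y⁻¹ * w) : ℝ) +
      (wordLength S (z⁻¹ * w) : ℝ) - (wordLength S (y⁻¹ * z) : ℝ)) / 2) with h1 | h1
    · rw [min_eq_left h1] at this
      have := le_max_left ((wordLength S (x⁻¹ * y) : ℝ) + wordLength S (z⁻¹ * w))
        ((wordLength S (y⁻¹ * z) : ℝ) + wordLength S (x⁻¹ * w))
      linarith
    · rw [min_eq_right h1] at this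
      have := le_max_right ((wordLength S (x⁻¹ * y) : ℝ) + wordLength S (z⁻¹ * w))
        ((wordLength S (y⁻¹ * z) : ℝ) + wordLength S (x⁻¹ * w))
      linarith
  exact_mod_cast key

lemma gromov_of_hyp {δ : ℕ} (h : Hyp (wd S) δ) :
    ∀ x y z w : G, wordGromovProduct S w x z ≥
        min (wordGromovProduct S w x y) (wordGromovProduct S w y z) - (δ : ℝ) := by
  intro x y z w
  have h1 := h x y z w
  have h2 : ((wd S x z + wd S y w : ℕ) : ℝ) ≤
      ((max (wd S x y + wd S z w) (wd S y z + wd S x w) + δ : ℕ) : ℝ) := by exact_mod_cast h1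
  push_cast at h2
  unfold wd at h2
  simp only [wordGromovProduct, ge_iff_le]
  have hδ : (0 : ℝ) ≤ δ := Nat.cast_nonneg _
  rcases max_cases ((wordLength S (x⁻¹ * y) : ℝ) + wordLength S (z⁻¹ * w))
        ((wordLength S (y⁻¹ * z) : ℝ) + wordLength S (x⁻¹ * w)) with h3 | h3
  · have := min_le_left (((wordLength S (x⁻¹ * w) : ℝ) + (wordLength S (y⁻¹ * w) : ℝ) -
      (wordLength S (x⁻¹ * y) : ℝ)) / 2) (((wordLength S (y⁻¹ * w) : ℝ) +
      (wordLength S (z⁻¹ * w) : ℝ) - (wordLength S (y⁻¹ * z) : ℝ)) / 2)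
    linarith
  · have := min_le_right (((wordLength S (x⁻¹ * w) : ℝ) + (wordLength S (y⁻¹ * w) : ℝ) -
      (wordLength S (x⁻¹ * y) : ℝ)) / 2) (((wordLength S (y⁻¹ * w) : ℝ) +
      (wordLength S (z⁻¹ * w) : ℝ) - (wordLength S (y⁻¹ * z) : ℝ)) / 2)
    linarith

end WordMetric
end HypQ

namespace HypQ

/-- Quasiconvex set. -/
def QC {X : Type*} (d : X → X → ℕ) (Y : Set X) (κ : ℕ) : Prop :=
  ∀ y ∈ Y, ∀ y' ∈ Y, ∀ q, d y q + d q y' = d y y' → ∃ v ∈ Y, d q v ≤ κ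

/-- `p` is a nearest point of `Y` to `x`. -/
def Near {X : Type*} (d : X → X → ℕ) (Y : Set X) (x p : X) : Prop :=
  p ∈ Y ∧ ∀ y ∈ Y, d x p ≤ d x y

section HypBasics
variable {X : Type*} {d : X → X → ℕ} {δ : ℕ}

lemma exists_near (d : X → X → ℕ) {Y : Set X} (hY : Y.Nonempty) (x : X) : ∃ p, Near d Y x p := by
  have hne : (d x '' Y).Nonempty := hY.image _
  obtain ⟨p, hp, he⟩ := Nat.sInf_mem hne
  refine ⟨p, hp, fun y hy => ?_⟩
  rw [he]
  exact Nat.sInf_le ⟨y, hy, rfl⟩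

lemma fellow (hg : GeoM d) (hh : Hyp d δ) {x y p q : X} {α β γ : ℕ}
    (hp : d x p + d p y ≤ d x y + α) (hq : d x q + d q y ≤ d x y + β)
    (h1 : d x p ≤ d x q + γ) (h2 : d x q ≤ d x p + γ) : d p q ≤ α + β + γ + δ := by
  have h := hh p x q y
  have e1 := hg.symm p x
  have e2 := hg.symm q x
  omega

lemma thin (hg : GeoM d) (hh : Hyp d δ) {x y p : X} (z : X) (hp : d x p + d p y = d x y) :
    ∃ q, (d x q + d q z = d x z ∨ d z q + d q y = d z y) ∧ d p q ≤ 2 * δ + 1 := by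
  by_cases hc : 2 * d x p ≤ d x y + d x z - d y z
  · have t := hg.tri x y z
    have t' := hg.tri x z y
    have t'' := hg.tri y x z
    have sy := hg.symm z y
    have sx := hg.symm x y
    obtain ⟨q, hq1, hq2⟩ := hg.interp x z (d x p) (by omega)
    refine ⟨q, Or.inl (by omega), ?_⟩
    have a := hh p y q x
    have b := hh y z q x
    have := hg.symm y x
    have := hg.symm z x
    have := hg.symm q x
    have := hg.symm p x
    have := hg.symm z q
    have := hg.symm y q
    omega
  · have t := hg.tri x y z
    have t' := hg.tri x z y
    have t'' := hg.tri y x z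
    have sy := hg.symm z y
    have sx := hg.symm x y
    have sz := hg.symm x z
    have sp := hg.symm p y
    obtain ⟨q, hq1, hq2⟩ := hg.interp y z (d p y) (by omega)
    have sq := hg.symm q y
    have sqz := hg.symm q z
    refine ⟨q, Or.inr (by omega), ?_⟩
    have a := hh p x q y
    have b := hh x z q y
    have := hg.symm x p
    have := hg.symm x q
    omega

lemma near_proj (hg : GeoM d) (hh : Hyp d δ) {Y : Set X} {κ : ℕ} (hY : QC d Y κ) {x p y : X}
    (hp : Near d Y x p) (hy : y ∈ Y) : d x p + d p y ≤ d x y + (2 * κ + 2 * δ + 1) := by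
  by_cases hk : κ + δ + 1 ≤ d p y
  · obtain ⟨q, hq1, hq2⟩ := hg.interp p y _ hk
    obtain ⟨v, hv, hqv⟩ := hY p hp.1 y hy q (by omega)
    have h1 := hp.2 v hv
    have h2 := hg.tri x q v
    have h3 := hh x p q y
    omega
  · have := hp.2 y hy
    omega

lemma near_two (hg : GeoM d) (hh : Hyp d δ) {Y : Set X} {κ : ℕ} (hY : QC d Y κ) {x z p q : X}
    (hp : Near d Y x p) (hq : Near d Y z q) :
    d p q ≤ 2 * κ + 3 * δ + 1 ∨
      d x p + d p q + d q z ≤ d x z + (4 * κ + 5 * δ + 2) := by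
  have h1 := near_proj hg hh hY hp hq.1
  have h2 := near_proj hg hh hY hq hp.1
  have h3 := hh x p q z
  have := hg.symm z p
  have := hg.symm q p
  have := hg.symm q z
  omega

lemma near_lip (hg : GeoM d) (hh : Hyp d δ) {Y : Set X} {κ : ℕ} (hY : QC d Y κ) {x z p q : X}
    (hp : Near d Y x p) (hq : Near d Y z q) : d p q ≤ d x z + (4 * κ + 5 * δ + 2) := by
  rcases near_two hg hh hY hp hq with h | h <;> omega

lemma near_pass (hg : GeoM d) (hh : Hyp d δ) {Y : Set X} {κ : ℕ} (hY : QC d Y κ) {x z p q : X}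
    (hp : Near d Y x p) (hq : Near d Y z q) (hpq : 2 * κ + 3 * δ + 1 < d p q) :
    ∃ u, d x u + d u z = d x z ∧ d u p ≤ 8 * κ + 11 * δ + 4 := by
  rcases near_two hg hh hY hp hq with h | h
  · omega
  have t1 := hg.tri p q z
  have t2 := hg.tri x p z
  by_cases hk : d x p ≤ d x z
  · obtain ⟨u, hu1, hu2⟩ := hg.interp x z _ hk
    refine ⟨u, by omega, ?_⟩
    have := fellow hg hh (x := x) (y := z) (p := u) (q := p) (α := 0) (β := 4 * κ + 5 * δ + 2)
      (γ := 0) (by omega) (by omega) (by omega) (by omega)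
    omega
  · refine ⟨z, by have := hg.self z; omega, ?_⟩
    have := hg.symm z p
    omega

end HypBasics
end HypQ

namespace HypQ

section Guess
variable {X : Type*} {d e : X → X → ℕ} {δ h : ℕ}

lemma guess_path (hg : GeoM d) (hh : Hyp d δ) (he : GeoM e) (hle : ∀ x y, e x y ≤ d x y)
    (hI : ∀ x y p, e x y ≤ 1 → d x p + d p y = d x y → e x p ≤ h) (f : ℕ → X) (k : ℕ) :
    ∀ a b : ℕ, a ≤ b → b ≤ a + 2 ^ k → (∀ i, a ≤ i → i < b → e (f i) (f (i + 1)) ≤ 1) →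
    ∀ p, d (f a) p + d p (f b) = d (f a) (f b) →
      ∃ i, a ≤ i ∧ i ≤ b ∧ e p (f i) ≤ h + k * (2 * δ + 1) := by
  induction k with
  | zero =>
    intro a b hab hb hf p hp
    refine ⟨a, le_rfl, hab, ?_⟩
    have h1 : e (f a) (f b) ≤ 1 := by
      rcases Nat.eq_or_lt_of_le hab with h | h
      · subst h; rw [he.self]; omega
      · have : b = a + 1 := by simp at hb; omega
        subst this; exact hf a le_rfl (by omega)
    have := hI _ _ p h1 hp
    rw [he.symm]; simpa using this
  | succ k ih =>
    intro a b hab hb hf p hp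
    have h2 : 2 ^ (k + 1) = 2 ^ k + 2 ^ k := by ring
    have hpos : 0 < 2 ^ k := by positivity
    obtain ⟨c, hac, hcb, h3, h4⟩ : ∃ c, a ≤ c ∧ c ≤ b ∧ c ≤ a + 2 ^ k ∧ b ≤ c + 2 ^ k := by
      by_cases hc : a + 2 ^ k ≤ b
      · exact ⟨a + 2 ^ k, by omega, hc, by omega, by omega⟩
      · exact ⟨b, hab, le_rfl, by omega, by omega⟩
    obtain ⟨q, hq, hpq⟩ := thin hg hh (f c) hp
    have e1 := hle p q
    have e2 : h + (k + 1) * (2 * δ + 1) = h + k * (2 * δ + 1) + (2 * δ + 1) := by ring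
    rcases hq with hq | hq
    · obtain ⟨i, hi1, hi2, hi3⟩ := ih a c hac h3 (fun i h1 h2 => hf i h1 (by omega)) q hq
      refine ⟨i, hi1, by omega, ?_⟩
      have := he.tri p q (f i)
      omega
    · obtain ⟨i, hi1, hi2, hi3⟩ := ih c b hcb h4 (fun i h1 h2 => hf i (by omega) h2) q hq
      refine ⟨i, by omega, hi2, ?_⟩
      have := he.tri p q (f i)
      omega

/-- `f` restricted to `[0,m]` is geodesic. -/
def Geod (e : X → X → ℕ) (f : ℕ → X) (m : ℕ) : Prop :=
  ∀ i j, i ≤ j → j ≤ m → i + e (f i) (f j) = j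

lemma geod_extend (he : GeoM e) (n : ℕ) : ∀ (f : ℕ → X) (k : ℕ), Geod e f k → ∀ y,
    e (f 0) y = k + n → e (f k) y = n →
    ∃ f', Geod e f' (k + n) ∧ (∀ i ≤ k, f' i = f i) ∧ f' (k + n) = y := by
  induction n with
  | zero =>
    intro f k hf y _ h2
    exact ⟨f, hf, fun _ _ => rfl, he.eq _ _ h2⟩
  | succ n ih =>
    intro f k hf y h1 h2
    obtain ⟨v, hv1, hv2⟩ := he.interp (f k) y n (by omega)
    have h0k := hf 0 k (by omega) le_rfl
    have t1 := he.tri (f 0) (f k) v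
    have t2 := he.tri (f 0) v y
    obtain ⟨g, hg1, hg2, hg3⟩ := ih f k hf v (by omega) hv1
    classical
    refine ⟨fun i => if i ≤ k + n then g i else y, ?_, ?_, ?_⟩
    · intro i j hij hj
      by_cases hjn : j ≤ k + n
      · have hin : i ≤ k + n := by omega
        simp only [hjn, hin, if_true]
        exact hg1 i j hij hjn
      · have hj' : j = k + n + 1 := by omega
        by_cases hin : i ≤ k + n
        · simp only [hjn, hin, if_true, if_false]
          have a1 := hg1 i (k + n) hin le_rfl
          have a2 := hg1 0 i (by omega) hin
          rw [hg3] at a1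
          rw [hg2 0 (by omega)] at a2
          have t3 := he.tri (g i) v y
          have t4 := he.tri (f 0) (g i) y
          omega
        · simp only [hjn, hin, if_false]
          rw [he.self]; omega
    · intro i hi
      have hin : i ≤ k + n := by omega
      simp only [hin, if_true]
      exact hg2 i hi
    · have : ¬ (k + (n + 1) ≤ k + n) := by omega
      simp only [this, if_false]

lemma exists_geodesic (he : GeoM e) (x y v : X) (hv : e x v + e v y = e x y) :
    ∃ f, Geod e f (e x y) ∧ f 0 = x ∧ f (e x v) = v ∧ f (e x y) = y := by
  obtain ⟨f, hf1, hf2, hf3⟩ := geod_extend he (e x v) (fun _ => x) 0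
    (by intro i j hij hj; rw [he.self]; omega) v (by simp) rfl
  rw [Nat.zero_add] at hf1 hf3
  have hf0 : f 0 = x := hf2 0 le_rfl
  obtain ⟨g, hg1, hg2, hg3⟩ := geod_extend he (e v y) f (e x v) hf1 y (by rw [hf0]; omega)
    (by rw [hf3])
  rw [hv] at hg1 hg3
  exact ⟨g, hg1, by rw [hg2 0 (by omega), hf0], by rw [hg2 _ le_rfl, hf3], hg3⟩

lemma ivt_d (hg : GeoM d) (he : GeoM e) (hle : ∀ x y, e x y ≤ d x y) (u x : X) (T : ℕ)
    (hT : T ≤ e u x) : ∃ v, d u v + d v x = d u x ∧ e u v = T := by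
  have hex : ∃ n, ∃ v, d u v + d v x = d u x ∧ T ≤ e u v ∧ d u v = n :=
    ⟨d u x, x, by rw [hg.self]; omega, hT, rfl⟩
  classical
  obtain ⟨v, hv1, hv2, hv3⟩ := Nat.find_spec hex
  have hmin := fun m => Nat.find_min hex (m := m)
  refine ⟨v, hv1, ?_⟩
  by_cases h0 : d u v = 0
  · have := hle u v; omega
  · obtain ⟨p, hp1, hp2⟩ := hg.interp u v (d u v - 1) (by omega)
    have t1 := hg.tri u p x
    have t2 := hg.tri p v x
    have hlt : e u p < T := by
      by_contra hcon
      exact hmin (d u p) (by omega) ⟨p, by omega, by omega, rfl⟩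
    have := he.tri u p v
    have := hle p v
    omega

lemma log_bound (h σ : ℕ) : ∃ r, ∀ t : ℕ, (∀ k, 6 * t ≤ 2 ^ k → t ≤ h + (k + 2) * σ) → t ≤ r := by
  have hK : ∃ K, ∀ k ≥ K, 12 * (h + (k + 2) * σ) < 2 ^ k := by
    have h1 : Filter.Tendsto (fun n : ℕ => ((n : ℝ) ^ 1) / (2 : ℝ) ^ n) Filter.atTop (nhds 0) :=
      tendsto_pow_const_div_const_pow_of_one_lt 1 (by norm_num)
    have h0 : Filter.Tendsto (fun n : ℕ => ((n : ℝ) ^ 0) / (2 : ℝ) ^ n) Filter.atTop (nhds 0) :=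
      tendsto_pow_const_div_const_pow_of_one_lt 0 (by norm_num)
    have h2 := (h1.const_mul (12 * (σ : ℝ))).add (h0.const_mul (12 * ((h : ℝ) + 2 * σ)))
    simp only [mul_zero, add_zero] at h2
    have h3 := h2.eventually (gt_mem_nhds (show (0 : ℝ) < 1 by norm_num))
    obtain ⟨K, hK⟩ := Filter.eventually_atTop.1 h3
    refine ⟨K, fun k hk => ?_⟩
    have h4 := hK k hk
    have hp : (0 : ℝ) < 2 ^ k := by positivity
    have h5 : (12 * (σ : ℝ)) * (k : ℝ) + 12 * ((h : ℝ) + 2 * σ) < 2 ^ k := by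
      have h6 : ((12 * (σ : ℝ)) * (k : ℝ) + 12 * ((h : ℝ) + 2 * σ)) / 2 ^ k < 1 := by
        calc _ = _ := by rw [add_div, pow_one, pow_zero]; ring
          _ < 1 := h4
      rwa [div_lt_one hp] at h6
    have h7 : ((12 * (h + (k + 2) * σ) : ℕ) : ℝ) < ((2 ^ k : ℕ) : ℝ) := by
      push_cast; linarith
    exact_mod_cast h7
  obtain ⟨K, hK⟩ := hK
  refine ⟨2 ^ K, fun t ht => ?_⟩
  by_contra hcon
  push Not at hcon
  have hK0 : 0 < 2 ^ K := by positivity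
  have ht0 : 6 * t ≠ 0 := by omega
  have a1 := Nat.lt_pow_succ_log_self (b := 2) (by norm_num) (6 * t)
  have a2 := Nat.pow_log_le_self 2 ht0
  set k := Nat.log 2 (6 * t)
  have a3 := ht (k + 1) a1.le
  have hkK : K ≤ k + 1 := by
    by_contra hc
    have : 2 ^ (k + 1) ≤ 2 ^ K := Nat.pow_le_pow_right (by norm_num) (by omega)
    simp only [Nat.succ_eq_add_one] at a1
    omega
  have a4 := hK (k + 1) hkK
  rw [pow_succ] at a4
  omega

lemma guess_sub (hg : GeoM d) (hh : Hyp d δ) (he : GeoM e) (hle : ∀ x y, e x y ≤ d x y)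
    (hI : ∀ x y p, e x y ≤ 1 → d x p + d p y = d x y → e x p ≤ h) (x y p : X) (k : ℕ)
    (hk : e x y ≤ 2 ^ k) (hp : d x p + d p y = d x y) :
    e p x ≤ h + k * (2 * δ + 1) + e x y := by
  obtain ⟨f, hf, h0, _, h1⟩ := exists_geodesic he x y x (by rw [he.self]; omega)
  obtain ⟨i, hi1, hi2, hi3⟩ := guess_path hg hh he hle hI f k 0 (e x y) (by omega) (by omega)
    (fun i _ hi => by have := hf i (i + 1) (by omega) hi; omega) p (by rw [h0, h1]; exact hp)
  have a := hf 0 i (by omega) hi2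
  rw [h0] at a
  have := he.tri p (f i) x
  have := he.symm (f i) x
  omega

lemma guess_A (hg : GeoM d) (hh : Hyp d δ) (he : GeoM e) (hle : ∀ x y, e x y ≤ d x y)
    (hI : ∀ x y p, e x y ≤ 1 → d x p + d p y = d x y → e x p ≤ h) :
    ∃ r, ∀ (f : ℕ → X) (m : ℕ), Geod e f m → ∀ u, d (f 0) u + d u (f m) = d (f 0) (f m) →
      ∃ i, i ≤ m ∧ e u (f i) ≤ r := by
  obtain ⟨r, hr⟩ := log_bound h (2 * δ + 1)
  refine ⟨r, fun f m hf => ?_⟩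
  have hpos : ∀ k, 0 < 2 ^ k := fun k => by positivity
  -- local application of the path lemma to a piece of the geodesic
  have piece : ∀ i j k, i ≤ m → j ≤ m → e (f i) (f j) ≤ 2 ^ k → ∀ q,
      d (f i) q + d q (f j) = d (f i) (f j) →
      ∃ l, l ≤ m ∧ e q (f l) ≤ h + k * (2 * δ + 1) := by
    intro i j k hi hj hk q hq
    rcases le_total i j with hij | hij
    · have a := hf i j hij hj
      obtain ⟨l, _, hl2, hl3⟩ := guess_path hg hh he hle hI f k i j hij (by omega)
        (fun l _ hl => by have := hf l (l + 1) (by omega) (by omega); omega) q hq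
      exact ⟨l, by omega, hl3⟩
    · have a := hf j i hij hi
      have := he.symm (f i) (f j)
      have := hg.symm (f i) (f j)
      have := hg.symm (f i) q
      have := hg.symm q (f j)
      obtain ⟨l, _, hl2, hl3⟩ := guess_path hg hh he hle hI f k j i hij (by omega)
        (fun l _ hl => by have := hf l (l + 1) (by omega) (by omega); omega) q (by omega)
      exact ⟨l, by omega, hl3⟩
  -- crude bound
  have crude : ∃ B, ∀ u, d (f 0) u + d u (f m) = d (f 0) (f m) → ∃ i, i ≤ m ∧ e u (f i) ≤ B := by
    refine ⟨h + m * (2 * δ + 1), fun u hu => ?_⟩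
    have a := hf 0 m (by omega) le_rfl
    have : m < 2 ^ m := Nat.lt_two_pow_self
    exact piece 0 m m (by omega) le_rfl (by omega) u hu
  classical
  set t := Nat.find crude with ht
  have hspec := Nat.find_spec crude
  rw [← ht] at hspec
  suffices htr : t ≤ r by
    intro u hu
    obtain ⟨i, hi, hi'⟩ := hspec u hu
    exact ⟨i, hi, by omega⟩
  by_cases ht0 : t = 0
  · omega
  obtain ⟨u0, hu0, hu0'⟩ : ∃ u, (d (f 0) u + d u (f m) = d (f 0) (f m)) ∧
      ∀ i, i ≤ m → t ≤ e u (f i) := by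
    have := Nat.find_min crude (m := t - 1) (by omega)
    push Not at this
    obtain ⟨u, hu, hu'⟩ := this
    exact ⟨u, hu, fun i hi => by have := hu' i hi; omega⟩
  apply hr
  intro k hk
  -- choose cut points
  have cut : ∀ b, b ≤ m → (b = 0 ∨ b = m) → ∃ v i, d u0 v + d v (f b) = d u0 (f b) ∧ i ≤ m ∧
      e u0 v ≤ 2 * t ∧ e v (f i) ≤ t ∧ (e u0 v = 2 * t ∨ v = f i) := by
    intro b hb hb'
    by_cases hc : 2 * t ≤ e u0 (f b)
    · obtain ⟨v, hv1, hv2⟩ := ivt_d hg he hle u0 (f b) (2 * t) hc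
      have hvI : d (f 0) v + d v (f m) = d (f 0) (f m) := by
        have := hg.symm (f 0) u0
        have := hg.symm (f 0) v
        have t1 := hg.tri (f 0) v (f m)
        rcases hb' with rfl | rfl
        · have := hg.tri v u0 (f m)
          have := hg.symm v u0
          omega
        · have := hg.tri v u0 (f 0)
          have := hg.symm v u0
          omega
      obtain ⟨i, hi1, hi2⟩ := hspec v hvI
      exact ⟨v, i, hv1, hi1, by omega, hi2, Or.inl hv2⟩
    · exact ⟨f b, b, by rw [hg.self]; omega, hb, by omega, by rw [he.self]; omega, Or.inr rfl⟩
  obtain ⟨v, i, hv1, hi, hv2, hv3, hv4⟩ := cut 0 (by omega) (Or.inl rfl)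
  obtain ⟨v', i', hv1', hi', hv2', hv3', hv4'⟩ := cut m le_rfl (Or.inr rfl)
  have hbt : d v u0 + d u0 v' = d v v' := by
    have := hg.symm (f 0) u0
    have := hg.symm v u0
    have := hg.symm v (f 0)
    have := hg.tri (f 0) v (f m)
    have := hg.tri v v' (f m)
    have := hg.tri v u0 v'
    omega
  -- side estimate
  have side : ∀ v i q, i ≤ m → e v (f i) ≤ t → (e u0 v = 2 * t ∨ v = f i) →
      d v q + d q (f i) = d v (f i) → e u0 q ≤ 2 * (2 * δ + 1) →
      t ≤ h + (k + 2) * (2 * δ + 1) := by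
    intro v i q hi hv3 hv4 hq huq
    have e2 : h + (k + 2) * (2 * δ + 1) = h + k * (2 * δ + 1) + 2 * (2 * δ + 1) := by ring
    rcases hv4 with hv4 | hv4
    · have a := guess_sub hg hh he hle hI v (f i) q k (by omega) hq
      have := he.tri u0 q v
      omega
    · subst hv4
      have : d (f i) q = 0 := by have := hg.self (f i); omega
      have := hg.eq _ _ this
      subst this
      have := hu0' i hi
      omega
  obtain ⟨q, hq, hq'⟩ := thin hg hh (f i) hbt
  have l1 := hle u0 q
  rcases hq with hq | hq
  · exact side v i q hi hv3 hv4 hq (by omega)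
  · obtain ⟨q2, hq2, hq2'⟩ := thin hg hh (f i') hq
    have l2 := hle q q2
    have l3 := he.tri u0 q q2
    rcases hq2 with hq2 | hq2
    · have t1 := he.tri (f i) v (f i')
      have t2 := he.tri v u0 (f i')
      have t3 := he.tri u0 v' (f i')
      have := he.symm (f i) v
      have := he.symm v u0
      obtain ⟨l, hl, hl'⟩ := piece i i' k hi hi' (by omega) q2 hq2
      have := he.tri u0 q2 (f l)
      have := hu0' l hl
      have e2 : h + (k + 2) * (2 * δ + 1) = h + k * (2 * δ + 1) + 2 * (2 * δ + 1) := by ring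
      omega
    · refine side v' i' q2 hi' hv3' hv4' ?_ (by omega)
      have := hg.symm v' q2
      have := hg.symm q2 (f i')
      have := hg.symm (f i') v'
      omega

lemma guess_B (hg : GeoM d) (he : GeoM e) (hle : ∀ x y, e x y ≤ d x y) {r : ℕ}
    (hr : ∀ (f : ℕ → X) (m : ℕ), Geod e f m → ∀ u, d (f 0) u + d u (f m) = d (f 0) (f m) →
      ∃ i, i ≤ m ∧ e u (f i) ≤ r) (f : ℕ → X) (m : ℕ) (hf : Geod e f m) (i : ℕ) (hi : i ≤ m) :
    ∃ u, d (f 0) u + d u (f m) = d (f 0) (f m) ∧ e (f i) u ≤ 3 * r + 1 := by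
  have hex : ∃ n, ∃ u j, d (f 0) u + d u (f m) = d (f 0) (f m) ∧ i ≤ j ∧ j ≤ m ∧
      e u (f j) ≤ r ∧ d (f 0) u = n :=
    ⟨d (f 0) (f m), f m, m, by rw [hg.self]; omega, hi, le_rfl, by rw [he.self]; omega, rfl⟩
  classical
  obtain ⟨u, j, hu, hij, hjm, huj, hn⟩ := Nat.find_spec hex
  have hmin := fun m => Nat.find_min hex (m := m)
  refine ⟨u, hu, ?_⟩
  have a := hf i j hij hjm
  have s1 := he.symm (f j) u
  have t0 := he.tri (f i) (f j) u
  by_cases h0 : d (f 0) u = 0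
  · have := hg.eq _ _ h0
    subst this
    have := hf 0 j (by omega) hjm
    omega
  · obtain ⟨v, hv1, hv2⟩ := hg.interp (f 0) u (d (f 0) u - 1) (by omega)
    have t1 := hg.tri (f 0) v (f m)
    have t2 := hg.tri v u (f m)
    obtain ⟨j', hj', hvj⟩ := hr f m hf v (by omega)
    have hlt : j' < i := by
      by_contra hcon
      exact hmin (d (f 0) v) (by omega) ⟨v, j', by omega, by omega, hj', hvj, rfl⟩
    have b := hf j' j (by omega) hjm
    have := he.tri (f j') v (f j)
    have := he.tri v u (f j)
    have := hle v u
    have := he.symm (f j') v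
    omega

lemma guess_AB (hg : GeoM d) (hh : Hyp d δ) (he : GeoM e) (hle : ∀ x y, e x y ≤ d x y)
    (hI : ∀ x y p, e x y ≤ 1 → d x p + d p y = d x y → e x p ≤ h) :
    ∃ r, (∀ (f : ℕ → X) (m : ℕ), Geod e f m → ∀ u, d (f 0) u + d u (f m) = d (f 0) (f m) →
      ∃ i, i ≤ m ∧ e u (f i) ≤ r) ∧
      (∀ x y v, e x v + e v y = e x y → ∃ u, d x u + d u y = d x y ∧ e v u ≤ 3 * r + 1) ∧
      (∀ x y u, d x u + d u y = d x y → ∃ v, e x v + e v y = e x y ∧ e u v ≤ r) := by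
  obtain ⟨r, hr⟩ := guess_A hg hh he hle hI
  refine ⟨r, hr, ?_, ?_⟩
  · intro x y v hv
    obtain ⟨f, hf, h0, h1, h2⟩ := exists_geodesic he x y v hv
    have := guess_B hg he hle hr f _ hf (e x v) (by omega)
    rw [h0, h1, h2] at this
    exact this
  · intro x y u hu
    obtain ⟨f, hf, h0, h1, h2⟩ := exists_geodesic he x y x (by rw [he.self]; omega)
    obtain ⟨i, hi, hi'⟩ := hr f _ hf u (by rw [h0, h2]; exact hu)
    refine ⟨f i, ?_, hi'⟩
    have a := hf 0 i (by omega) hi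
    have b := hf i _ hi le_rfl
    rw [h0] at a
    rw [h2] at b
    omega

lemma hyp_of_slim (he : GeoM e) {s : ℕ}
    (hs : ∀ x y z v, e x v + e v y = e x y →
      ∃ q, (e x q + e q z = e x z ∨ e z q + e q y = e z y) ∧ e v q ≤ s) :
    Hyp e (6 * s + 2) := by
  intro x y z w
  obtain ⟨p, hp, hpw⟩ : ∃ p, e x p + e p z = e x z ∧
      2 * e w p + e x z ≤ e w x + e w z + (4 * s + 2) := by
    have hex : ∃ n, ∃ v q, e x v + e v z = e x z ∧ e w q + e q z = e w z ∧ e v q ≤ s ∧ e x v = n :=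
      ⟨_, z, z, by rw [he.self]; omega, by rw [he.self]; omega, by rw [he.self]; omega, rfl⟩
    classical
    obtain ⟨v', q', hv', hq', hvq', hn⟩ := Nat.find_spec hex
    have hmin := fun m => Nat.find_min hex (m := m)
    have := he.tri w q' v'
    have := he.symm q' v'
    have := he.symm w x
    have := he.tri v' q' z
    by_cases h0 : e x v' = 0
    · have := he.eq _ _ h0
      subst this
      exact ⟨x, hv', by omega⟩
    · obtain ⟨v, hv1, hv2⟩ := he.interp x v' (e x v' - 1) (by omega)
      have t1 := he.tri x v z
      have t2 := he.tri v v' z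
      obtain ⟨q, hq, hvq⟩ := hs x z w v (by omega)
      rcases hq with hq | hq
      · refine ⟨v, by omega, ?_⟩
        have := he.tri x q v
        have := he.tri w q v
        have := he.symm q v
        have := he.symm w q
        have := he.tri w v' v
        have := he.symm v' v
        omega
      · exact absurd ⟨v, q, by omega, hq, hvq, rfl⟩ (hmin (e x v) (by omega))
  obtain ⟨q, hq, hpq⟩ := hs x z y p hp
  have := he.tri w p q
  have := he.symm w q
  have := he.symm w x
  have := he.symm w z
  rcases hq with hq | hq
  · have := he.tri x q w
    have := he.tri y q w
    have := he.symm q y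
    omega
  · have := he.tri z q w
    have := he.tri y q w
    have := he.symm q z
    omega

lemma guess_hyp (hg : GeoM d) (hh : Hyp d δ) (he : GeoM e) (hle : ∀ x y, e x y ≤ d x y)
    (hI : ∀ x y p, e x y ≤ 1 → d x p + d p y = d x y → e x p ≤ h) :
    ∃ r δ', (∀ x y u, d x u + d u y = d x y → ∃ v, e x v + e v y = e x y ∧ e u v ≤ r) ∧
      (∀ (f : ℕ → X) (m : ℕ), Geod e f m → ∀ u, d (f 0) u + d u (f m) = d (f 0) (f m) →
      ∃ i, i ≤ m ∧ e u (f i) ≤ r) ∧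
      Hyp e δ' := by
  obtain ⟨r, h1, h2, h3⟩ := guess_AB hg hh he hle hI
  refine ⟨r, _, h3, h1, hyp_of_slim he (s := (3 * r + 1) + (2 * δ + 1) + r) ?_⟩
  intro x y z v hv
  obtain ⟨u, hu, hvu⟩ := h2 x y v hv
  obtain ⟨q, hq, huq⟩ := thin hg hh z hu
  have l1 := hle u q
  have l2 := he.tri v u q
  rcases hq with hq | hq
  · obtain ⟨q', hq', hqq⟩ := h3 _ _ q hq
    have := he.tri v q q'
    exact ⟨q', Or.inl hq', by omega⟩
  · obtain ⟨q', hq', hqq⟩ := h3 _ _ q hq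
    have := he.tri v q q'
    exact ⟨q', Or.inr hq', by omega⟩

end Guess
end HypQ

namespace HypQ

/-- Strong projection axioms. -/
structure ProjSys (G : Type*) {P : Type*} [Group G] [MulAction G P] (D : P → P → P → ℕ)
    (ρ : P → P → ℕ) (θ : ℕ) : Prop where
  symm : ∀ Y X Z, D Y X Z = D Y Z X
  tri : ∀ Y X Z W, X ≠ Y → Z ≠ Y → W ≠ Y → D Y X Z ≤ D Y X W + D Y W Z
  diag : ∀ Y X, X ≠ Y → D Y X X ≤ θ
  ex : ∀ Y X Z, X ≠ Y → Z ≠ Y → X ≠ Z → θ < D Y X Z → ∀ W, W ≠ Z → D Z X W = D Z Y W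
  rank : ∀ Y X Z, X ≠ Y → Z ≠ Y → θ < D Y X Z → ρ X Y < ρ X Z ∧ ρ Y Z < ρ X Z
  equiv : ∀ (g : G) Y X Z, D (g • Y) (g • X) (g • Z) = D Y X Z

/-- Rotation family. -/
structure RotFam {G : Type*} {P : Type*} [Group G] [MulAction G P] (D : P → P → P → ℕ)
    (N : P → Subgroup G) (L : ℕ) : Prop where
  conj : ∀ (g : G) Y h, h ∈ N Y → g * h * g⁻¹ ∈ N (g • Y)
  fix : ∀ Y h, h ∈ N Y → h • Y = Y
  spin : ∀ Y h X, h ∈ N Y → h ≠ 1 → X ≠ Y → L ≤ D Y X (h • X)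

set_option linter.unusedSectionVars false

section Windmill
variable {G : Type*} {P : Type*} [Group G] [MulAction G P] {D : P → P → P → ℕ}
  {ρ : P → P → ℕ} {θ L : ℕ} {N : P → Subgroup G}

/-- Adjacency in the projection graph. -/
def PAdj (D : P → P → P → ℕ) (θ : ℕ) (X Z : P) : Prop :=
  ∀ V, V ≠ X → V ≠ Z → D V X Z ≤ 2 * θ

/-- The group generated by rotations around `W`. -/
def rotGrp (N : P → Subgroup G) (W : Set P) : Subgroup G := Subgroup.closure {g | ∃ Y ∈ W, g ∈ N Y}

/-- Inductive windmill condition. -/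
structure Good (D : P → P → P → ℕ) (θ : ℕ) (N : P → Subgroup G) (M : ℕ) (X0 : P) (W : Set P) :
    Prop where
  inv : ∀ g ∈ rotGrp N W, ∀ X ∈ W, g • X ∈ W
  bdd : ∀ Y, Y ∉ W → ∀ X ∈ W, ∀ X' ∈ W, D Y X X' ≤ 9 * θ
  const : ∀ Y, Y ∉ W → (∀ X ∈ W, ¬ PAdj D θ X Y) → ∀ X ∈ W, ∀ X' ∈ W, ∀ Z, Z ≠ Y →
    D Y X Z = D Y X' Z
  mem : X0 ∈ W
  gl : ∀ n ∈ rotGrp N W, n ∈ N X0 ∨ ∃ T, T ≠ X0 ∧ T ≠ n • X0 ∧ M ≤ D T X0 (n • X0)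

lemma PAdj.symm (hP : ProjSys G D ρ θ) {X Z : P} (h : PAdj D θ X Z) : PAdj D θ Z X := by
  intro V h1 h2
  rw [hP.symm]; exact h V h2 h1

lemma D_equiv (hP : ProjSys G D ρ θ) (g : G) (Y X Z : P) :
    D Y (g • X) Z = D (g⁻¹ • Y) X (g⁻¹ • Z) := by
  rw [← hP.equiv g⁻¹ Y (g • X) Z]; simp

lemma PAdj.smul (hP : ProjSys G D ρ θ) (g : G) {X Z : P} (h : PAdj D θ X Z) :
    PAdj D θ (g • X) (g • Z) := by
  intro V h1 h2
  rw [D_equiv hP]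
  have := h (g⁻¹ • V) (fun h => h1 (by rw [← h]; simp)) (fun h => h2 (by rw [← h]; simp))
  simpa using this

/-- The new vertices. -/
def newV (D : P → P → P → ℕ) (θ : ℕ) (W : Set P) : Set P := {Y | Y ∉ W ∧ ∃ X ∈ W, PAdj D θ X Y}

/-- Normal forms. -/
inductive NF (N : P → Subgroup G) (H : Subgroup G) (V : Set P) : Option P → G → Prop
  | nil (a : G) : a ∈ H → NF N H V none a
  | cons (T : P) (b : G) (o : Option P) (n : G) : T ∈ V → b ∈ N T → b ≠ 1 → NF N H V o n →
      o ≠ some T → NF N H V (some T) (b * n)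

lemma NF.smulH (hR : RotFam D N L) {H : Subgroup G} {V : Set P} (hV : ∀ g ∈ H, ∀ T ∈ V, g • T ∈ V)
    {a : G} (ha : a ∈ H) {o : Option P} {n : G} (h : NF N H V o n) :
    NF N H V (o.map (a • ·)) (a * n) := by
  induction h with
  | nil c hc => exact NF.nil _ (H.mul_mem ha hc)
  | cons T b o n hT hb hb1 _ ho ih =>
    have e : a * (b * n) = (a * b * a⁻¹) * (a * n) := by group
    rw [e]
    refine NF.cons (a • T) _ (o.map (a • ·)) _ (hV a ha T hT) (hR.conj a T b hb) ?_ ih ?_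
    · intro h
      apply hb1
      have : a * b = a := by simpa [mul_inv_eq_one] using h
      simpa using this
    · intro h
      apply ho
      cases o with
      | none => simp at h
      | some S => simp at h; rw [h]

lemma NF.smulN {H : Subgroup G} {V : Set P} {T : P} (hT : T ∈ V) {b : G} (hb : b ∈ N T)
    {o : Option P} {n : G} (h : NF N H V o n) : ∃ o', NF N H V o' (b * n) := by
  by_cases hb1 : b = 1
  · subst hb1; exact ⟨o, by simpa using h⟩
  by_cases ho : o = some T
  · cases h with
    | nil a ha => simp at ho
    | cons T' c o' n' hT' hc hc1 hn' ho' =>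
      simp only [Option.some.injEq] at ho
      subst ho
      by_cases hbc : b * c = 1
      · exact ⟨o', by rw [← mul_assoc, hbc, one_mul]; exact hn'⟩
      · exact ⟨some T', by
          rw [← mul_assoc]; exact NF.cons T' _ o' n' hT' ((N T').mul_mem hb hc) hbc hn' ho'⟩
  · exact ⟨some T, NF.cons T b o n hT hb hb1 h ho⟩

lemma rotGrp_mono (N : P → Subgroup G) {W W' : Set P} (h : W ⊆ W') :
    rotGrp N W ≤ rotGrp N W' :=
  Subgroup.closure_mono (fun _ ⟨Y, hY, hg⟩ => ⟨Y, h hY, hg⟩)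

lemma NF.exists {W V : Set P} (hR : RotFam D N L)
    (hV : ∀ g ∈ rotGrp N W, ∀ T ∈ V, g • T ∈ V) {n : G} (hn : n ∈ rotGrp N (W ∪ V)) :
    ∃ o, NF N (rotGrp N W) V o n := by
  have key : ∀ g ∈ rotGrp N (W ∪ V), ∀ o m, NF N (rotGrp N W) V o m →
      ∃ o', NF N (rotGrp N W) V o' (g * m) := by
    intro g hg
    refine Subgroup.closure_induction'' (p := fun g _ => ∀ o m, NF N (rotGrp N W) V o m →
      ∃ o', NF N (rotGrp N W) V o' (g * m)) ?_ ?_ ?_ ?_ hg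
    · rintro x ⟨Y, hY, hx⟩ o m hm
      rcases hY with hY | hY
      · exact ⟨_, hm.smulH hR hV (Subgroup.subset_closure ⟨Y, hY, hx⟩)⟩
      · exact hm.smulN hY hx
    · rintro x ⟨Y, hY, hx⟩ o m hm
      have hx := (N Y).inv_mem hx
      rcases hY with hY | hY
      · exact ⟨_, hm.smulH hR hV (Subgroup.subset_closure ⟨Y, hY, hx⟩)⟩
      · exact hm.smulN hY hx
    · intro o m hm
      exact ⟨o, by simpa using hm⟩
    · intro x y _ _ hx hy o m hm
      obtain ⟨o1, h1⟩ := hy o m hm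
      obtain ⟨o2, h2⟩ := hx o1 _ h1
      exact ⟨o2, by rw [mul_assoc]; exact h2⟩
  obtain ⟨o, ho⟩ := key n hn none 1 (NF.nil 1 (Subgroup.one_mem _))
  exact ⟨o, by simpa using ho⟩

lemma newV_inv (hP : ProjSys G D ρ θ) {W : Set P}
    (hW : ∀ g ∈ rotGrp N W, ∀ X ∈ W, g • X ∈ W) :
    ∀ g ∈ rotGrp N W, ∀ T ∈ newV D θ W, g • T ∈ newV D θ W := by
  rintro g hg T ⟨hT, X, hX, hXT⟩
  refine ⟨fun h => hT ?_, g • X, hW g hg X hX, hXT.smul hP g⟩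
  have := hW g⁻¹ (Subgroup.inv_mem _ hg) _ h
  simpa using this

/-- Uniform bound for projections of old and new vertices on a new vertex. -/
lemma claim0 (hP : ProjSys G D ρ θ) {M : ℕ} {X0 : P} {W : Set P} (hG : Good D θ N M X0 W)
    {Y X X' : P} (hY : Y ∉ W) (hX : X ∈ W ∪ newV D θ W) (hX' : X' ∈ W ∪ newV D θ W)
    (h1 : X ≠ Y) (h2 : X' ≠ Y) : D Y X X' ≤ 13 * θ := by
  have red : ∀ X ∈ W ∪ newV D θ W, X ≠ Y → ∃ U ∈ W, D Y X U ≤ 2 * θ := by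
    intro X hX hXY
    rcases hX with hX | ⟨hXW, U, hU, hUX⟩
    · exact ⟨X, hX, by have := hP.diag Y X hXY; omega⟩
    · refine ⟨U, hU, ?_⟩
      rw [hP.symm]
      exact hUX Y (fun h => hY (h ▸ hU)) hXY.symm
  obtain ⟨U, hU, hXU⟩ := red X hX h1
  obtain ⟨U', hU', hXU'⟩ := red X' hX' h2
  have hUY : U ≠ Y := fun h => hY (h ▸ hU)
  have hUY' : U' ≠ Y := fun h => hY (h ▸ hU')
  have t1 := hP.tri Y X X' U h1 h2 hUY
  have t2 := hP.tri Y U X' U' hUY h2 hUY'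
  have t3 := hG.bdd Y hY U hU U' hU'
  rw [hP.symm Y X' U'] at hXU'
  omega

lemma claimA (hP : ProjSys G D ρ θ) (hR : RotFam D N L) {M : ℕ} (hM : 13 * θ + M ≤ L)
    (hM2 : 2 * θ < M) {X0 : P} {W : Set P} (hG : Good D θ N M X0 W) {o : Option P} {n : G}
    (h : NF N (rotGrp N W) (newV D θ W) o n) :
    ∀ Y1, o = some Y1 → ∀ X' ∈ W, n • X' ≠ Y1 ∧
      ∀ X ∈ W ∪ newV D θ W, X ≠ Y1 → M ≤ D Y1 X (n • X') := by
  induction h with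
  | nil a ha => intro Y1 h; simp at h
  | cons T b o n hT hb hb1 hn ho ih =>
    intro Y1 hY1 X' hX'
    simp only [Option.some.injEq] at hY1
    subst hY1
    -- the key bound before rotating
    have key : n • X' ≠ T ∧ ∀ X ∈ W ∪ newV D θ W, X ≠ T → D T X (n • X') ≤ 13 * θ := by
      cases hn with
      | nil a ha =>
        have hm := hG.inv _ ha X' hX'
        have hne : n • X' ≠ T := fun h => hT.1 (h ▸ hm)
        exact ⟨hne, fun X hX hXT => claim0 hP hG hT.1 hX (Or.inl hm) hXT hne⟩
      | cons T2 b2 o2 n2 hT2 hb2 hb21 hn2 ho2 =>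
        have hT2T : T2 ≠ T := fun h => ho (by rw [h])
        obtain ⟨i1, i2⟩ := ih T2 rfl X' hX'
        have i3 := i2 T (Or.inr hT) hT2T.symm
        have hne : (b2 * n2) • X' ≠ T := by
          intro h
          rw [h] at i3
          have := hP.diag T2 T hT2T.symm
          omega
        refine ⟨hne, fun X hX hXT => ?_⟩
        have e := hP.ex T2 ((b2 * n2) • X') T i1 hT2T.symm hne (by rw [hP.symm]; omega) X hXT
        rw [hP.symm, e]
        exact claim0 hP hG hT.1 (Or.inr hT2) hX hT2T hXT
    have hbT := hR.fix T b hb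
    have hne : (b * n) • X' ≠ T := by
      intro h
      apply key.1
      rw [mul_smul] at h
      have h2 : b • (n • X') = b • T := by rw [h, hbT]
      exact smul_left_cancel b h2
    refine ⟨hne, fun X hX hXT => ?_⟩
    have s := hR.spin T b X hb hb1 hXT
    have hbX : b • X ≠ T := by
      intro h
      apply hXT
      have h2 : b • X = b • T := by rw [h, hbT]
      exact smul_left_cancel b h2
    have t := hP.tri T X (b • X) ((b * n) • X') hXT hbX hne
    have e : D T ((b * n) • X') (b • X) = D T (n • X') X := by
      have := hP.equiv b T (n • X') X
      rw [hbT, ← mul_smul] at this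
      exact this
    rw [e, hP.symm T (n • X') X] at t
    have := key.2 X hX hXT
    omega

lemma claimB (hP : ProjSys G D ρ θ) (hR : RotFam D N L) {M : ℕ} (hM : 13 * θ + M ≤ L)
    (hM2 : 2 * θ < M) {X0 : P} {W : Set P} (hG : Good D θ N M X0 W) {W' : Set P}
    (hW' : W ∪ newV D θ W ⊆ W')
    (hinv : ∀ g ∈ rotGrp N (W ∪ newV D θ W), ∀ X ∈ W', g • X ∈ W') {o : Option P} {n : G}
    (h : NF N (rotGrp N W) (newV D θ W) o n) :
    n ∈ rotGrp N (W ∪ newV D θ W) ∧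
    ∀ Y, Y ∉ W' → ∀ X ∈ W ∪ newV D θ W, ∀ X' ∈ W, D Y X (n • X') ≤ 5 * θ := by
  have old : ∀ Y, Y ∉ W' → ∀ U ∈ W, ∀ U' ∈ W, D Y U U' ≤ θ := by
    intro Y hY U hU U' hU'
    have hYW : Y ∉ W := fun h => hY (hW' (Or.inl h))
    have hUY : U' ≠ Y := fun h => hYW (h ▸ hU')
    rw [hG.const Y hYW ?_ U hU U' hU' U' hUY]
    · exact hP.diag Y U' hUY
    · intro X hX hXY
      exact hY (hW' (Or.inr ⟨hYW, X, hX, hXY⟩))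
  have red : ∀ Y, Y ∉ W' → ∀ X ∈ W ∪ newV D θ W, ∀ U' ∈ W, D Y X U' ≤ 3 * θ := by
    intro Y hY X hX U' hU'
    have hXY : X ≠ Y := fun h => hY (hW' (h ▸ hX))
    have hUY : U' ≠ Y := fun h => hY (hW' (Or.inl (h ▸ hU')))
    rcases hX with hX | ⟨hXW, U, hU, hUX⟩
    · have := old Y hY X hX U' hU'; omega
    · have hUY' : U ≠ Y := fun h => hY (hW' (Or.inl (h ▸ hU)))
      have t := hP.tri Y X U' U hXY hUY hUY'
      have := hUX Y hUY'.symm hXY.symm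
      rw [hP.symm] at this
      have := old Y hY U hU U' hU'
      omega
  have red2 : ∀ Y, Y ∉ W' → ∀ X ∈ W ∪ newV D θ W, ∀ X' ∈ W ∪ newV D θ W, D Y X X' ≤ 5 * θ := by
    intro Y hY X hX X' hX'
    have hXY : X ≠ Y := fun h => hY (hW' (h ▸ hX))
    have hXY' : X' ≠ Y := fun h => hY (hW' (h ▸ hX'))
    rcases hX' with hX' | ⟨hXW, U, hU, hUX⟩
    · have := red Y hY X hX X' hX'; omega
    · have hUY' : U ≠ Y := fun h => hY (hW' (Or.inl (h ▸ hU)))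
      have t := hP.tri Y X X' U hXY hXY' hUY'
      have := hUX Y hUY'.symm hXY'.symm
      have := red Y hY X hX U hU
      omega
  induction h with
  | nil a ha =>
    refine ⟨rotGrp_mono N Set.subset_union_left ha, ?_⟩
    intro Y hY X hX X' hX'
    exact red2 Y hY X hX _ (Or.inl (hG.inv a ha X' hX'))
  | cons T b o n hT hb hb1 hn ho ih =>
    have hbm : b ∈ rotGrp N (W ∪ newV D θ W) := Subgroup.subset_closure ⟨T, Or.inr hT, hb⟩
    refine ⟨Subgroup.mul_mem _ hbm ih.1, ?_⟩
    intro Y hY X hX X' hX'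
    have hbT := hR.fix T b hb
    have hA := claimA hP hR hM hM2 hG (NF.cons T b o n hT hb hb1 hn ho) T rfl X' hX'
    have hXY : X ≠ Y := fun h => hY (hW' (h ▸ hX))
    have hTY : T ≠ Y := fun h => hY (hW' (Or.inr (h ▸ hT)))
    have hnY : (b * n) • X' ≠ Y := by
      intro h
      exact hY (h ▸ hinv _ (Subgroup.mul_mem _ hbm ih.1) X' (hW' (Or.inl hX')))
    have step : D Y T ((b * n) • X') ≤ 5 * θ := by
      have hY' : b⁻¹ • Y ∉ W' := by
        intro h
        apply hY
        have := hinv b hbm _ h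
        simpa using this
      have := ih.2 (b⁻¹ • Y) hY' T (Or.inr hT) X' hX'
      have e := hP.equiv b (b⁻¹ • Y) T (n • X')
      rw [hbT, smul_inv_smul, ← mul_smul] at e
      rw [e]
      exact this
    by_cases hXT : X = T
    · rw [hXT]; exact step
    have hM' := hA.2 X hX hXT
    have t := hP.tri T X ((b * n) • X') Y hXT hA.1 hTY.symm
    by_cases hc : θ < D T X Y
    · rw [hP.ex T X Y hXT hTY.symm hXY hc _ hnY]
      exact step
    · have hc' : θ < D T ((b * n) • X') Y := by rw [hP.symm]; omega
      rw [hP.symm, hP.ex T _ Y hA.1 hTY.symm hnY hc' X hXY]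
      exact red2 Y hY T (Or.inr hT) X hX

lemma lemmaA (hP : ProjSys G D ρ θ) {W : Set P} {X T Y : P} (hX : X ∈ W)
    (hXT : PAdj D θ X T) (hT : T ∉ W)
    (hY : Y ∉ W ∪ newV D θ W) (hna : ∀ U ∈ W ∪ newV D θ W, ¬ PAdj D θ U Y) :
    ∀ Z, Z ≠ Y → D Y X Z = D Y T Z := by
  have hTm : T ∈ W ∪ newV D θ W := Or.inr ⟨hT, X, hX, hXT⟩
  have hTX : T ≠ X := fun h => hT (h ▸ hX)
  have hTY : T ≠ Y := fun h => hY (h ▸ hTm)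
  have adjX : ∀ U, U ≠ X → U ≠ T → θ < D U X T → PAdj D θ X U := by
    intro U hUX hUT hU V hVX hVU
    by_cases hVT : V = T
    · subst hVT
      rw [hP.ex U X V hUX.symm hUT.symm hTX.symm hU U hUT]
      have := hP.diag V U hUT
      omega
    · by_contra hcon
      push Not at hcon
      have e1 := hP.ex V X U hVX.symm hVU.symm hUX.symm (by omega) T hUT.symm
      have e2 := hP.ex U T V hUT.symm hVU (fun h => hVT h.symm)
        (by rw [hP.symm, ← e1]; exact hU) X hVX.symm
      have e3 := hXT V hVX hVT
      rw [hP.symm V X T, e2, hP.symm] at e3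
      omega
  have main : ∀ k, ∀ U, ρ U Y = k → (U = X ∨ (U ≠ X ∧ U ≠ T ∧ θ < D U X T)) →
      ∀ Z, Z ≠ Y → D Y U Z = D Y T Z := by
    intro k
    induction k using Nat.strong_induction_on with
    | _ k ih =>
      intro U hk hU Z hZ
      have hUm : U ∈ W ∪ newV D θ W := by
        rcases hU with rfl | ⟨h1, h2, h3⟩
        · exact Or.inl hX
        · by_cases hUW : U ∈ W
          · exact Or.inl hUW
          · exact Or.inr ⟨hUW, X, hX, adjX U h1 h2 h3⟩
      have hUT : U ≠ T := by
        rcases hU with rfl | ⟨h1, h2, h3⟩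
        · exact hTX.symm
        · exact h2
      have hUY : U ≠ Y := fun h => hY (h ▸ hUm)
      have := hna U hUm
      unfold PAdj at this
      push Not at this
      obtain ⟨V, hVU, hVY, hV⟩ := this
      have e1 := hP.ex V U Y hVU.symm hVY.symm hUY (by omega) Z hZ
      have hr := (hP.rank V U Y hVU.symm hVY.symm (by omega)).2
      by_cases hVT : V = T
      · rw [e1, hVT]
      by_cases hc : θ < D V T Y
      · have e2 := hP.ex V T Y (fun h => hVT h.symm) hVY.symm hTY hc Z hZ
        rw [e1, e2]
      · have t := hP.tri V U Y T hVU.symm hVY.symm (fun h => hVT h.symm)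
        have hVUT : θ < D V U T := by omega
        rw [e1]
        refine ih _ (by omega) V rfl ?_ Z hZ
        by_cases hVX : V = X
        · exact Or.inl hVX
        · refine Or.inr ⟨hVX, hVT, ?_⟩
          rcases hU with rfl | ⟨h1, h2, h3⟩
          · exact hVUT
          · have e2 := hP.ex V T U (fun h => hVT h.symm) hVU.symm hUT.symm
              (by rw [hP.symm]; exact hVUT) X h1.symm
            have e3 := hP.ex U X V h1.symm hVU (fun h => hVX h.symm)
              (by rw [hP.symm, ← e2, hP.symm]; exact h3) T (fun h => hVT h.symm)
            rw [e3]; exact hVUT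
  exact main _ X rfl (Or.inl rfl)

lemma good_step (hP : ProjSys G D ρ θ) (hR : RotFam D N L) {M : ℕ} (hM : 13 * θ + M ≤ L)
    (hM2 : 2 * θ < M) {X0 : P} {W : Set P} (hG : Good D θ N M X0 W) :
    ∃ W', W ∪ newV D θ W ⊆ W' ∧ Good D θ N M X0 W' := by
  set B := W ∪ newV D θ W with hB
  set H' := rotGrp N B with hH'
  have hVinv := newV_inv hP hG.inv
  let W' : Set P := {Z | ∃ g ∈ H', ∃ U ∈ B, Z = g • U}
  have hBW : B ⊆ W' := fun U hU => ⟨1, H'.one_mem, U, hU, by simp⟩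
  have hinv : ∀ g ∈ H', ∀ X ∈ W', g • X ∈ W' := by
    rintro g hg X ⟨g', hg', U, hU, rfl⟩
    exact ⟨g * g', H'.mul_mem hg hg', U, hU, by rw [mul_smul]⟩
  have hrot : ∀ Z ∈ W', N Z ≤ H' := by
    rintro Z ⟨g, hg, U, hU, rfl⟩ h hh
    have := hR.conj g⁻¹ (g • U) h hh
    simp only [inv_smul_smul, inv_inv] at this
    have h2 : g⁻¹ * h * g ∈ H' := Subgroup.subset_closure ⟨U, hU, this⟩
    have h3 := H'.mul_mem (H'.mul_mem hg h2) (H'.inv_mem hg)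
    have e : g * (g⁻¹ * h * g) * g⁻¹ = h := by group
    rwa [e] at h3
  have hgrp : rotGrp N W' = H' := by
    apply le_antisymm
    · exact (Subgroup.closure_le _).2 (fun g ⟨Y, hY, hg⟩ => hrot Y hY hg)
    · exact Subgroup.closure_mono (fun g ⟨Y, hY, hg⟩ => ⟨Y, hBW hY, hg⟩)
  have hYinv : ∀ g ∈ H', ∀ Y, Y ∉ W' → g • Y ∉ W' := by
    intro g hg Y hY h
    apply hY
    have := hinv g⁻¹ (H'.inv_mem hg) _ h
    simpa using this
  refine ⟨W', hBW, ?_⟩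
  constructor
  · rw [hgrp]; exact hinv
  · -- bounded
    have bd1 : ∀ Y, Y ∉ W' → ∀ X ∈ B, ∀ n ∈ H', ∀ U ∈ B, D Y X (n • U) ≤ 7 * θ := by
      intro Y hY X hX n hn U hU
      obtain ⟨o, ho⟩ := NF.exists hR hVinv hn
      have hb := (claimB hP hR hM hM2 hG hBW hinv ho).2 Y hY X hX
      rcases hU with hU | ⟨hUW, U', hU', hUU⟩
      · have := hb U hU; omega
      · have h1 := hb U' hU'
        have hnU : n • U ≠ Y := fun h => hY (h ▸ ⟨n, hn, U, Or.inr ⟨hUW, U', hU', hUU⟩, rfl⟩)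
        have hnU' : n • U' ≠ Y := fun h => hY (h ▸ ⟨n, hn, U', Or.inl hU', rfl⟩)
        have hXY : X ≠ Y := fun h => hY (h ▸ hBW hX)
        have t := hP.tri Y X (n • U) (n • U') hXY hnU hnU'
        have := hUU.smul hP n Y hnU'.symm hnU.symm
        omega
    rintro Y hY X ⟨n, hn, U, hU, rfl⟩ X' ⟨n', hn', U', hU', rfl⟩
    rw [D_equiv hP, ← mul_smul]
    have := bd1 (n⁻¹ • Y) (hYinv _ (H'.inv_mem hn) Y hY) U hU (n⁻¹ * n')
      (H'.mul_mem (H'.inv_mem hn) hn') U' hU'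
    omega
  · -- constant
    have base : ∀ Y, Y ∉ W' → (∀ X ∈ W', ¬ PAdj D θ X Y) → ∀ U ∈ B, ∀ U' ∈ B, ∀ Z, Z ≠ Y →
        D Y U Z = D Y U' Z := by
      intro Y hY hna
      have hYB : Y ∉ B := fun h => hY (hBW h)
      have hYW : Y ∉ W := fun h => hYB (Or.inl h)
      have red : ∀ U ∈ B, ∀ Z, Z ≠ Y → D Y U Z = D Y X0 Z := by
        intro U hU Z hZ
        have oldc := hG.const Y hYW (fun X hX => hna X (hBW (Or.inl hX)))
        rcases hU with hU | ⟨hUW, X, hX, hXU⟩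
        · exact oldc U hU X0 hG.mem Z hZ
        · rw [← lemmaA hP hX hXU hUW hYB (fun X hX => hna X (hBW hX)) Z hZ]
          exact oldc X hX X0 hG.mem Z hZ
      intro U hU U' hU' Z hZ
      rw [red U hU Z hZ, red U' hU' Z hZ]
    have hnainv : ∀ g ∈ H', ∀ Y, (∀ X ∈ W', ¬ PAdj D θ X Y) → ∀ X ∈ W', ¬ PAdj D θ X (g • Y) := by
      intro g hg Y hna X hX hXY
      apply hna (g⁻¹ • X) (hinv _ (H'.inv_mem hg) X hX)
      have := hXY.smul hP g⁻¹
      simpa using this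
    have key : ∀ n ∈ H', ∀ Y, Y ∉ W' → (∀ X ∈ W', ¬ PAdj D θ X Y) → ∀ U ∈ B, ∀ U' ∈ B, ∀ Z,
        Z ≠ Y → D Y (n • U) Z = D Y U' Z := by
      intro n hn
      refine Subgroup.closure_induction (p := fun n _ => ∀ Y, Y ∉ W' →
        (∀ X ∈ W', ¬ PAdj D θ X Y) → ∀ U ∈ B, ∀ U' ∈ B, ∀ Z, Z ≠ Y →
        D Y (n • U) Z = D Y U' Z) ?_ ?_ ?_ ?_ hn
      · rintro b ⟨T, hT, hb⟩ Y hY hna U hU U' hU' Z hZ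
        have hbm : b⁻¹ ∈ H' := H'.inv_mem (Subgroup.subset_closure ⟨T, hT, hb⟩)
        have hZ' : b⁻¹ • Z ≠ b⁻¹ • Y := fun h => hZ (smul_left_cancel _ h)
        rw [D_equiv hP, base (b⁻¹ • Y) (hYinv _ hbm Y hY) (hnainv _ hbm Y hna) U hU T hT _ hZ',
          ← D_equiv hP, hR.fix T b hb]
        exact base Y hY hna T hT U' hU' Z hZ
      · intro Y hY hna U hU U' hU' Z hZ
        rw [one_smul]
        exact base Y hY hna U hU U' hU' Z hZ
      · intro x y hx hy ihx ihy Y hY hna U hU U' hU' Z hZ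
        have hxm : x⁻¹ ∈ H' := H'.inv_mem hx
        have hZ' : x⁻¹ • Z ≠ x⁻¹ • Y := fun h => hZ (smul_left_cancel _ h)
        rw [mul_smul, D_equiv hP, ihy (x⁻¹ • Y) (hYinv _ hxm Y hY) (hnainv _ hxm Y hna) U hU U hU _
          hZ', ← D_equiv hP]
        exact ihx Y hY hna U hU U' hU' Z hZ
      · intro x hx ihx Y hY hna U hU U' hU' Z hZ
        have hxm : x ∈ H' := hx
        have hZ' : x • Z ≠ x • Y := fun h => hZ (smul_left_cancel _ h)
        rw [D_equiv hP, inv_inv, ← ihx (x • Y) (hYinv _ hxm Y hY) (hnainv _ hxm Y hna) U' hU' U hU _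
          hZ', hP.equiv]
    rintro Y hY hna X ⟨n, hn, U, hU, rfl⟩ X' ⟨n', hn', U', hU', rfl⟩ Z hZ
    rw [key n hn Y hY hna U hU U hU Z hZ, key n' hn' Y hY hna U' hU' U hU Z hZ]
  · exact hBW (Or.inl hG.mem)
  · rw [hgrp]
    intro n hn
    obtain ⟨o, ho⟩ := NF.exists hR hVinv hn
    cases o with
    | none =>
      cases ho with
      | nil a ha => exact hG.gl n ha
    | some T =>
      right
      have hTW : T ∉ W := by
        cases ho with
        | cons T b o n hT => exact hT.1
      have hA := claimA hP hR hM hM2 hG ho T rfl X0 hG.mem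
      have hne : X0 ≠ T := fun h => hTW (h ▸ hG.mem)
      exact ⟨T, hne.symm, hA.1.symm, hA.2 X0 (Or.inl hG.mem) hne⟩

lemma good_base (hP : ProjSys G D ρ θ) (hR : RotFam D N L) (M : ℕ) (X0 : P) :
    Good D θ N M X0 {X0} := by
  have hgrp : rotGrp N {X0} = N X0 := by
    apply le_antisymm
    · exact (Subgroup.closure_le _).2 (fun g ⟨Y, hY, hg⟩ => by
        rw [Set.mem_singleton_iff] at hY; subst hY; exact hg)
    · exact fun g hg => Subgroup.subset_closure ⟨X0, rfl, hg⟩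
  constructor
  · intro g hg X hX
    rw [hgrp] at hg
    rw [Set.mem_singleton_iff] at hX ⊢
    rw [hX]; exact hR.fix X0 g hg
  · rintro Y hY X rfl X' rfl
    have := hP.diag Y X' (fun h => hY (h ▸ rfl))
    omega
  · rintro Y hY _ X rfl X' rfl Z _; rfl
  · rfl
  · intro n hn
    rw [hgrp] at hn
    exact Or.inl hn

theorem windmill (hP : ProjSys G D ρ θ) (hR : RotFam D N L) {M : ℕ} (hM : 13 * θ + M ≤ L)
    (hM2 : 2 * θ < M) (X0 : P) {n : G} (hn : n ∈ rotGrp N Set.univ) :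
    n ∈ N X0 ∨ ∃ T, T ≠ X0 ∧ T ≠ n • X0 ∧ M ≤ D T X0 (n • X0) := by
  classical
  let St := {W : Set P // Good D θ N M X0 W}
  let nxt : St → St := fun W => ⟨_, (good_step hP hR hM hM2 W.2).choose_spec.2⟩
  have hnxt : ∀ W : St, W.1 ∪ newV D θ W.1 ⊆ (nxt W).1 := fun W =>
    (good_step hP hR hM hM2 W.2).choose_spec.1
  let Ws : ℕ → St := fun k => Nat.rec ⟨{X0}, good_base hP hR M X0⟩ (fun _ W => nxt W) k
  have hWs : ∀ k, (Ws k).1 ∪ newV D θ (Ws k).1 ⊆ (Ws (k + 1)).1 := fun k => hnxt (Ws k)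
  have hmono : Monotone (fun k => (Ws k).1) :=
    monotone_nat_of_le_succ (fun k => Set.subset_union_left.trans (hWs k))
  have hadj : ∀ X Z, PAdj D θ X Z → (∃ k, X ∈ (Ws k).1) → ∃ k, Z ∈ (Ws k).1 := by
    rintro X Z hXZ ⟨k, hk⟩
    by_cases hZ : Z ∈ (Ws k).1
    · exact ⟨k, hZ⟩
    · exact ⟨k + 1, hWs k (Or.inr ⟨hZ, X, hk, hXZ⟩)⟩
  have hconn : ∀ m, ∀ X Z, ρ X Z = m → (∃ k, X ∈ (Ws k).1) → ∃ k, Z ∈ (Ws k).1 := by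
    intro m
    induction m using Nat.strong_induction_on with
    | _ m ih =>
      intro X Z hm hX
      by_cases hXZ : PAdj D θ X Z
      · exact hadj X Z hXZ hX
      · unfold PAdj at hXZ
        push Not at hXZ
        obtain ⟨V, h1, h2, h3⟩ := hXZ
        obtain ⟨r1, r2⟩ := hP.rank V X Z h1.symm h2.symm (by omega)
        exact ih _ (by omega) V Z rfl (ih _ (by omega) X V rfl hX)
  have hall : ∀ Z, ∃ k, Z ∈ (Ws k).1 := fun Z => hconn _ X0 Z rfl ⟨0, rfl⟩
  have hmem : ∃ k, n ∈ rotGrp N (Ws k).1 := by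
    have hm : Monotone (fun k => rotGrp N (Ws k).1) := by
      intro i j hij
      exact Subgroup.closure_mono (fun g ⟨Y, hY, hg⟩ => ⟨Y, hmono hij hY, hg⟩)
    refine Subgroup.closure_induction (p := fun n _ => ∃ k, n ∈ rotGrp N (Ws k).1)
      ?_ ?_ ?_ ?_ hn
    · rintro x ⟨Y, _, hx⟩
      obtain ⟨k, hk⟩ := hall Y
      exact ⟨k, Subgroup.subset_closure ⟨Y, hk, hx⟩⟩
    · exact ⟨0, Subgroup.one_mem _⟩
    · rintro x y _ _ ⟨i, hi⟩ ⟨j, hj⟩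
      exact ⟨max i j, Subgroup.mul_mem _ (hm (le_max_left i j) hi) (hm (le_max_right i j) hj)⟩
    · rintro x _ ⟨i, hi⟩
      exact ⟨i, Subgroup.inv_mem _ hi⟩
  obtain ⟨k, hk⟩ := hmem
  exact (Ws k).2.gl n hk

end Windmill
end HypQ

namespace HypQ
section AltWords
variable {G : Type*} {P : Type*} [Group G] [MulAction G P] {D : P → P → P → ℕ}
  {ρ : P → P → ℕ} {θ : ℕ}

/-- Alternating words ending in a letter of index `true`. -/
inductive Alt (A : Bool → Set G) : Bool → G → Prop
  | one (b : G) : b ∈ A true → Alt A true b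
  | cons (i : Bool) (b u : G) : b ∈ A i → Alt A (!i) u → Alt A i (b * u)

lemma alt_bounds (hP : ProjSys G D ρ θ) {A : Bool → Set G} {T : Bool → P} {B : ℕ}
    (hT : T false ≠ T true) (hfix : ∀ i, ∀ b ∈ A i, b • T i = T i)
    (hspin : ∀ i, ∀ b ∈ A i, 2 * θ < D (T i) (T (!i)) (b • T (!i)))
    (hB : ∀ i, ∀ b ∈ A i, D (T i) (T (!i)) (b • T (!i)) ≤ B)
    (hB0 : ∀ Y, Y ≠ T false → Y ≠ T true → D Y (T false) (T true) ≤ B)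
    {i : Bool} {u : G} (hu : Alt A i u) :
    u • T false ≠ T i ∧ 2 * θ < D (T i) (T (!i)) (u • T false) ∧
    ∀ Y, Y ≠ T (!i) → Y ≠ u • T false → D Y (T (!i)) (u • T false) ≤ B := by
  have hTn : ∀ i, T (!i) ≠ T i := by
    intro i; cases i
    · exact hT.symm
    · exact hT
  have hB0' : ∀ i Y, Y ≠ T i → Y ≠ T (!i) → D Y (T i) (T (!i)) ≤ B := by
    intro i Y h1 h2
    cases i
    · exact hB0 Y h1 h2
    · rw [hP.symm]; exact hB0 Y h2 h1
  -- one rotation step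
  have step : ∀ i, ∀ b ∈ A i, ∀ v : P, v ≠ T i →
      (∀ W, W ≠ T i → D (T i) v W = D (T i) (T (!i)) W) →
      (∀ Y, Y ≠ T i → Y ≠ v → D Y (T i) v ≤ B) →
      b • v ≠ T i ∧ 2 * θ < D (T i) (T (!i)) (b • v) ∧
      ∀ Y, Y ≠ T (!i) → Y ≠ b • v → D Y (T (!i)) (b • v) ≤ B := by
    intro i b hb v hv hex hbd
    have hbT := hfix i b hb
    have hbT' : b⁻¹ • T i = T i := by rw [inv_smul_eq_iff]; exact hbT.symm
    have hne : b • v ≠ T i := by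
      intro h
      apply hv
      have h2 : b • v = b • T i := by rw [h, hbT]
      exact smul_left_cancel b h2
    have e : D (T i) (T (!i)) (b • v) = D (T i) (T (!i)) (b • T (!i)) := by
      rw [hP.symm, D_equiv hP, hbT', hex, ← hbT', ← D_equiv hP, hbT', hP.symm]
      rw [← hbT']
      intro h
      exact hTn i (smul_left_cancel _ h)
    have s := hspin i b hb
    refine ⟨hne, by rw [e]; exact s, ?_⟩
    intro Y hY1 hY2
    by_cases hYT : Y = T i
    · rw [hYT, e]; exact hB i b hb
    have t := hP.tri (T i) (T (!i)) (b • v) Y (hTn i) hne hYT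
    by_cases hc : θ < D (T i) (T (!i)) Y
    · rw [hP.ex (T i) (T (!i)) Y (hTn i) hYT hY1.symm hc _ hY2.symm, hP.symm, D_equiv hP, hbT',
        hP.symm]
      apply hbd
      · intro h; apply hYT; rw [inv_smul_eq_iff, hbT] at h; exact h
      · intro h; apply hY2; rw [inv_smul_eq_iff] at h; exact h
    · have hc' : θ < D (T i) (b • v) Y := by rw [hP.symm]; omega
      rw [hP.symm, hP.ex (T i) (b • v) Y hne hYT hY2.symm hc' _ hY1.symm]
      exact hB0' i Y hYT hY1
  induction hu with
  | one b hb =>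
    exact step true b hb (T false) hT (fun W _ => rfl) (fun Y h1 h2 => hB0' true Y h1 h2)
  | cons i b u hb _ ih =>
    rw [mul_smul]
    obtain ⟨i1, i2, i3⟩ := ih
    rw [Bool.not_not] at i2 i3
    have hne : u • T false ≠ T i := by
      intro h
      rw [h] at i2
      have := hP.diag (T (!i)) (T i) (hTn i).symm
      omega
    refine step i b hb _ hne ?_ i3
    intro W hW
    exact hP.ex (T (!i)) _ (T i) i1 (hTn i).symm hne (by rw [hP.symm]; omega) W hW

lemma alt_comm {A : Bool → Set G} {x y : G} (hx : x ∈ A false) (hx' : x⁻¹ ∈ A false)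
    (hy : y ∈ A true) (hy' : y⁻¹ ∈ A true) (hy2 : y ^ 2 ∈ A true) (hy2' : (y ^ 2)⁻¹ ∈ A true)
    (j : ℕ) : Alt A true
      ((y * x) ^ (j + 1) * (y ^ 2 * x) ^ (j + 1) * ((y * x) ^ (j + 1))⁻¹ *
        ((y ^ 2 * x) ^ (j + 1))⁻¹) := by
  have powers : ∀ (i : Bool) (c : G), (∀ u, Alt A i u → Alt A i (c * u)) →
      ∀ (k : ℕ) u, Alt A i u → Alt A i (c ^ k * u) := by
    intro i c hc k
    induction k with
    | zero => intro u hu; simpa using hu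
    | succ k ih => intro u hu; rw [pow_succ, mul_assoc]; exact ih _ (hc u hu)
  have two : ∀ (i : Bool) (b c : G), b ∈ A i → c ∈ A (!i) → ∀ u, Alt A i u →
      Alt A i (b * c * u) := by
    intro i b c hb hc u hu
    rw [mul_assoc]
    exact Alt.cons i _ _ hb (Alt.cons _ _ _ hc (by rw [Bool.not_not]; exact hu))
  have h1 : Alt A false ((x⁻¹ * (y ^ 2)⁻¹) ^ j * (x⁻¹ * (y ^ 2)⁻¹)) :=
    powers false _ (two false _ _ hx' hy2') j _ (Alt.cons false _ _ hx' (Alt.one _ hy2'))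
  have h2 := powers false _ (two false _ _ hx' hy') j _ h1
  have h3 := Alt.cons true y _ hy h2
  have h4 := powers true _ (two true _ _ hy2 hx) j _ h3
  have h5 := powers true _ (two true _ _ hy hx) (j + 1) _ h4
  convert h5 using 1
  have e1 : ((y * x) ^ (j + 1))⁻¹ = x⁻¹ * y⁻¹ * (x⁻¹ * y⁻¹) ^ j := by
    rw [← inv_pow, mul_inv_rev, pow_succ']
  have e2 : ((y ^ 2 * x) ^ (j + 1))⁻¹ = (x⁻¹ * (y ^ 2)⁻¹) ^ j * (x⁻¹ * (y ^ 2)⁻¹) := by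
    rw [← inv_pow, mul_inv_rev, pow_succ]
  have e3 : (y ^ 2 * x) ^ (j + 1) = (y ^ 2 * x) ^ j * (y ^ 2 * x) := pow_succ _ _
  rw [e1, e2, e3]
  have e4 : y ^ 2 * x * (x⁻¹ * y⁻¹) = y := by group
  calc (y * x) ^ (j + 1) * ((y ^ 2 * x) ^ j * (y ^ 2 * x)) * (x⁻¹ * y⁻¹ * (x⁻¹ * y⁻¹) ^ j) *
        ((x⁻¹ * (y ^ 2)⁻¹) ^ j * (x⁻¹ * (y ^ 2)⁻¹))
      = (y * x) ^ (j + 1) * ((y ^ 2 * x) ^ j * ((y ^ 2 * x * (x⁻¹ * y⁻¹)) * ((x⁻¹ * y⁻¹) ^ j *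
        ((x⁻¹ * (y ^ 2)⁻¹) ^ j * (x⁻¹ * (y ^ 2)⁻¹))))) := by
        simp only [mul_assoc]
    _ = _ := by rw [e4]

lemma nonelem_of_comm {Q : Type*} [Group Q] (a b : Q)
    (h : ∀ j : ℕ, a ^ (j + 1) * b ^ (j + 1) * (a ^ (j + 1))⁻¹ * (b ^ (j + 1))⁻¹ ≠ 1) :
    IsNonElementaryGroup Q := by
  intro g
  by_contra hi
  obtain ⟨n, hn, _, hna⟩ := Subgroup.exists_pow_mem_of_index_ne_zero hi a
  obtain ⟨m, hm, _, hmb⟩ := Subgroup.exists_pow_mem_of_index_ne_zero hi b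
  have h1 : a ^ (n * m) ∈ Subgroup.zpowers g := by
    rw [pow_mul]; exact Subgroup.pow_mem _ hna m
  have h2 : b ^ (n * m) ∈ Subgroup.zpowers g := by
    rw [mul_comm, pow_mul]; exact Subgroup.pow_mem _ hmb n
  have hpos : 0 < n * m := Nat.mul_pos hn hm
  obtain ⟨j, hj⟩ : ∃ j, n * m = j + 1 := ⟨n * m - 1, by omega⟩
  rw [hj] at h1 h2
  apply h j
  obtain ⟨s, hs⟩ := h1
  obtain ⟨t, ht⟩ := h2
  simp only at hs ht
  rw [← hs, ← ht, ← zpow_add, add_comm, zpow_add]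
  group

end AltWords
end HypQ

namespace HypQ
section Lox
variable {G : Type*} [Group G] {S : Set G} {δ : ℕ}

lemma wd_one (S : Set G) (x y : G) : wd S x y = wd S 1 (x⁻¹ * y) := by simp [wd]

lemma wd_inv (hg : GeoM (wd S)) (x : G) : wd S 1 x⁻¹ = wd S 1 x := by
  rw [hg.symm, wd_one]; simp

lemma exists_long (hfin : S.Finite) (hsym : ∀ s ∈ S, s⁻¹ ∈ S) (hgen : Subgroup.closure S = ⊤)
    (hne : IsNonElementaryGroup G) (n : ℕ) : ∃ g : G, wd S 1 g = n := by
  have h1 := hne 1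
  rw [Subgroup.zpowers_one_eq_bot, Subgroup.index_bot] at h1
  have hinf : Infinite G := by
    rcases Nat.card_eq_zero.1 h1 with h | h
    · exact (h.false 1).elim
    · exact h
  obtain ⟨g, hg⟩ := Set.Infinite.exists_notMem_finite (Set.infinite_univ (α := G))
    (ball_finite hfin hsym hgen n)
  have hg2 : ¬ wd S 1 g ≤ n := hg.2
  obtain ⟨p, hp, _⟩ := (wd_geo hsym hgen).interp 1 g n (by omega)
  exact ⟨p, hp⟩

lemma exists_w (hfin : S.Finite) (hsym : ∀ s ∈ S, s⁻¹ ∈ S) (hgen : Subgroup.closure S = ⊤)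
    (hh : Hyp (wd S) δ) (hne : IsNonElementaryGroup G) :
    ∃ w : G, wd S 1 w + (2 * δ + 1) ≤ wd S 1 (w ^ 2) := by
  have hg := wd_geo hsym hgen
  obtain ⟨n, hn⟩ : ∃ n, n = 10 * δ + 10 := ⟨_, rfl⟩
  obtain ⟨g, hgl⟩ := exists_long hfin hsym hgen hne (2 * n)
  obtain ⟨p, hp1, hp2⟩ := hg.interp 1 g n (by omega)
  obtain ⟨a, b, ha, hb, hab⟩ : ∃ a b : G, wd S 1 a = n ∧ wd S 1 b = n ∧ wd S a b = 2 * n := by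
    refine ⟨p⁻¹, p⁻¹ * g, ?_, ?_, ?_⟩
    · rw [wd_inv hg]; exact hp1
    · rw [← wd_one]; omega
    · rw [wd_one]; simp; exact hgl
  by_cases h1 : wd S 1 a + (2 * δ + 1) ≤ wd S 1 (a ^ 2)
  · exact ⟨a, h1⟩
  by_cases h2 : wd S 1 b + (2 * δ + 1) ≤ wd S 1 (b ^ 2)
  · exact ⟨b, h2⟩
  refine ⟨a * b, ?_⟩
  have ea : wd S a⁻¹ a = wd S 1 (a ^ 2) := by rw [wd_one]; simp [pow_two]
  have eb : wd S b⁻¹ b = wd S 1 (b ^ 2) := by rw [wd_one]; simp [pow_two]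
  have ia := wd_inv hg a
  have ib := wd_inv hg b
  have s0 := hg.symm a⁻¹ 1
  have s0' := hg.symm a 1
  have s1 := hg.symm b⁻¹ 1
  have s2 := hg.symm b 1
  have s3 := hg.symm a a⁻¹
  have s4 := hg.symm b b⁻¹
  -- d(a⁻¹,b)
  have k1 : 2 * n ≤ wd S a⁻¹ b + δ := by
    have := hh a a⁻¹ b 1
    omega
  have k2 : 2 * n ≤ wd S b⁻¹ a + δ := by
    have := hh a b⁻¹ b 1
    have := hg.symm b⁻¹ a
    omega
  have l1 : wd S 1 (a * b) = wd S a⁻¹ b := by rw [wd_one S a⁻¹ b]; simp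
  have l2 : wd S (b⁻¹ * a⁻¹) 1 = wd S a⁻¹ b := by rw [wd_one, wd_one S a⁻¹ b]; simp
  have l3 : wd S (b⁻¹ * a⁻¹) b⁻¹ = n := by rw [wd_one]; simpa using ha
  have l4 : wd S a (a * b) = n := by rw [wd_one]; simpa using hb
  have l5 : wd S (b⁻¹ * a⁻¹) (a * b) = wd S 1 ((a * b) ^ 2) := by
    rw [wd_one]; simp [pow_two, mul_assoc]
  have m1 : 3 * n ≤ wd S (b⁻¹ * a⁻¹) a + 3 * δ := by
    have := hh (b⁻¹ * a⁻¹) b⁻¹ 1 a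
    omega
  have m2 : 4 * n ≤ wd S (b⁻¹ * a⁻¹) (a * b) + 5 * δ := by
    have := hh (b⁻¹ * a⁻¹) 1 a (a * b)
    omega
  have m3 := hg.tri 1 a (a * b)
  omega

lemma lox_step (hg : GeoM (wd S)) (hh : Hyp (wd S) δ) {w : G}
    (hw : wd S 1 w + (2 * δ + 1) ≤ wd S 1 (w ^ 2)) (k : ℕ) :
    wd S 1 (w ^ (k + 1)) + (δ + 1) ≤ wd S 1 (w ^ (k + 2)) := by
  induction k with
  | zero => simp; omega
  | succ k ih =>
    have h := hh 1 (w ^ (k + 1)) (w ^ (k + 2)) (w ^ (k + 3))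
    have e1 : wd S (w ^ (k + 1)) (w ^ (k + 3)) = wd S 1 (w ^ 2) := by
      rw [wd_one]; congr 1; group
    have e2 : wd S (w ^ (k + 2)) (w ^ (k + 3)) = wd S 1 w := by
      rw [wd_one]; congr 1; group
    have e3 : wd S (w ^ (k + 1)) (w ^ (k + 2)) = wd S 1 w := by
      rw [wd_one]; congr 1; group
    have e4 : k + 1 + 1 = k + 2 := rfl
    have e5 : k + 1 + 2 = k + 3 := rfl
    rw [e4, e5]
    omega

lemma lox_mono (hg : GeoM (wd S)) (hh : Hyp (wd S) δ) {w : G}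
    (hw : wd S 1 w + (2 * δ + 1) ≤ wd S 1 (w ^ 2)) (k : ℕ) :
    wd S 1 (w ^ k) < wd S 1 (w ^ (k + 1)) := by
  cases k with
  | zero =>
    simp only [pow_zero, zero_add, pow_one]
    rw [hg.self]
    by_contra h0
    have : wd S 1 w = 0 := by omega
    have := hg.eq _ _ this
    rw [← this] at hw
    simp only [one_pow, hg.self] at hw
    omega
  | succ k =>
    have := lox_step hg hh hw k
    have e : k + 1 + 1 = k + 2 := rfl
    rw [e]; omega

lemma lox_add (hg : GeoM (wd S)) (hh : Hyp (wd S) δ) {w : G}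
    (hw : wd S 1 w + (2 * δ + 1) ≤ wd S 1 (w ^ 2)) (s t : ℕ) :
    wd S 1 (w ^ s) + wd S 1 (w ^ t) ≤ wd S 1 (w ^ (s + t)) + (wd S 1 w + δ) := by
  rcases s with _ | s
  · simp only [pow_zero, zero_add, hg.self]; omega
  rcases t with _ | t
  · simp only [pow_zero, add_zero, hg.self]; omega
  rcases t with _ | t
  · have := lox_mono hg hh hw (s + 1)
    simp only [zero_add, pow_one]; omega
  have h := hh 1 (w ^ (s + 1)) (w ^ (s + 2)) (w ^ (s + 1 + (t + 2)))
  have e1 : wd S (w ^ (s + 1)) (w ^ (s + 1 + (t + 2))) = wd S 1 (w ^ (t + 2)) := by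
    rw [wd_one]; congr 1; group
  have e2 : wd S (w ^ (s + 2)) (w ^ (s + 1 + (t + 2))) = wd S 1 (w ^ (t + 1)) := by
    rw [wd_one]; congr 1; group
  have e3 : wd S (w ^ (s + 1)) (w ^ (s + 2)) = wd S 1 w := by
    rw [wd_one]; congr 1; group
  have a := lox_step hg hh hw s
  have b := lox_step hg hh hw t
  have e4 : t + 1 + 1 = t + 2 := rfl
  rw [e4]
  omega

lemma wd_zpow (hg : GeoM (wd S)) (w : G) (k : ℤ) : wd S 1 (w ^ k) = wd S 1 (w ^ k.natAbs) := by
  rcases Int.natAbs_eq k with h | h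
  · conv_lhs => rw [h, zpow_natCast]
  · conv_lhs => rw [h, zpow_neg, zpow_natCast, wd_inv hg]

lemma wd_zpow_zpow (w : G) (i j : ℤ) : wd S (w ^ i) (w ^ j) = wd S 1 (w ^ (j - i)) := by
  rw [wd_one]; congr 1; group

lemma lox_le (hg : GeoM (wd S)) (hh : Hyp (wd S) δ) {w : G}
    (hw : wd S 1 w + (2 * δ + 1) ≤ wd S 1 (w ^ 2)) (k : ℕ) : k ≤ wd S 1 (w ^ k) := by
  induction k with
  | zero => omega
  | succ k ih => have := lox_mono hg hh hw k; omega

lemma pow_le_mul (hg : GeoM (wd S)) (w : G) (k : ℕ) : wd S 1 (w ^ k) ≤ k * wd S 1 w := by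
  induction k with
  | zero => simp [hg.self]
  | succ k ih =>
    have := hg.tri 1 (w ^ k) (w ^ (k + 1))
    rw [wd_one S (w ^ k)] at this
    rw [pow_succ, inv_mul_cancel_left] at this
    rw [pow_succ]
    have e : (k + 1) * wd S 1 w = k * wd S 1 w + wd S 1 w := by ring
    omega

lemma lox_fellow (hg : GeoM (wd S)) (hh : Hyp (wd S) δ) {w : G}
    (hw : wd S 1 w + (2 * δ + 1) ≤ wd S 1 (w ^ 2)) (k : ℕ) (p : G)
    (hp : wd S 1 p + wd S p (w ^ k) = wd S 1 (w ^ k)) :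
    ∃ j, j ≤ k ∧ wd S p (w ^ j) ≤ 2 * wd S 1 w + 2 * δ := by
  have hex : ∃ j, j ≤ k ∧ wd S 1 (w ^ j) ≤ wd S 1 p ∧ wd S 1 p ≤ wd S 1 (w ^ j) + wd S 1 w := by
    by_contra hcon
    push Not at hcon
    have : ∀ j, j ≤ k → wd S 1 (w ^ j) + wd S 1 w < wd S 1 p := by
      intro j
      induction j with
      | zero => intro h; exact hcon 0 h (by simp [hg.self])
      | succ j ih =>
        intro h
        have h1 := ih (by omega)
        have t := hg.tri 1 (w ^ j) (w ^ (j + 1))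
        rw [wd_one S (w ^ j), pow_succ, inv_mul_cancel_left] at t
        have e := pow_succ w j
        have t2 := hcon (j + 1) h (by rw [e]; omega)
        exact t2
    have := this k le_rfl
    omega
  obtain ⟨j, hj, h1, h2⟩ := hex
  refine ⟨j, hj, ?_⟩
  have a := lox_add hg hh hw j (k - j)
  rw [show j + (k - j) = k by omega] at a
  have e : wd S (w ^ j) (w ^ k) = wd S 1 (w ^ (k - j)) := by
    rw [wd_one]; congr 1
    rw [inv_mul_eq_iff_eq_mul, ← pow_add]; congr 1; omega
  have := fellow hg hh (x := 1) (y := w ^ k) (p := p) (q := w ^ j) (α := 0)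
    (β := wd S 1 w + δ) (γ := wd S 1 w) (by omega) (by omega) (by omega) (by omega)
  omega

lemma lox_qc (hg : GeoM (wd S)) (hh : Hyp (wd S) δ) {w : G}
    (hw : wd S 1 w + (2 * δ + 1) ≤ wd S 1 (w ^ 2)) (i j : ℤ) (p : G)
    (hp : wd S (w ^ i) p + wd S p (w ^ j) = wd S (w ^ i) (w ^ j)) :
    ∃ k : ℤ, wd S p (w ^ k) ≤ 2 * wd S 1 w + 2 * δ := by
  have main : ∀ i j : ℤ, i ≤ j → ∀ p : G,
      wd S (w ^ i) p + wd S p (w ^ j) = wd S (w ^ i) (w ^ j) →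
      ∃ k : ℤ, wd S p (w ^ k) ≤ 2 * wd S 1 w + 2 * δ := by
    intro i j hij p hp
    obtain ⟨n, hn⟩ := Int.eq_ofNat_of_zero_le (sub_nonneg.2 hij)
    have hj : j = i + n := by omega
    subst hj
    have e1 : wd S (w ^ i) p = wd S 1 ((w ^ i)⁻¹ * p) := wd_one _ _ _
    have e2 : wd S p (w ^ (i + n)) = wd S ((w ^ i)⁻¹ * p) (w ^ n) := by
      rw [← wd_left S (w ^ i) ((w ^ i)⁻¹ * p)]; congr 1; · group
      · rw [zpow_add, zpow_natCast]
    have e3 : wd S (w ^ i) (w ^ (i + n)) = wd S 1 (w ^ n) := by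
      rw [wd_one]; congr 1; rw [zpow_add, zpow_natCast, inv_mul_cancel_left]
    obtain ⟨k, _, hk⟩ := lox_fellow hg hh hw n ((w ^ i)⁻¹ * p) (by omega)
    refine ⟨i + k, ?_⟩
    rw [← wd_left S (w ^ i), mul_inv_cancel_left] at hk
    rw [zpow_add, zpow_natCast]; exact hk
  rcases le_total i j with h | h
  · exact main i j h p hp
  · apply main j i h p
    have := hg.symm (w ^ i) p
    have := hg.symm p (w ^ j)
    have := hg.symm (w ^ i) (w ^ j)
    omega

/-- Thin quadrilaterals. -/
lemma thin4 {X : Type*} {d : X → X → ℕ} (hg : GeoM d) (hh : Hyp d δ) {x y p : X} (z z' : X)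
    (hp : d x p + d p y = d x y) :
    ∃ q, ((d x q + d q z = d x z) ∨ (d z q + d q z' = d z z') ∨ (d z' q + d q y = d z' y)) ∧
      d p q ≤ 2 * (2 * δ + 1) := by
  obtain ⟨q, hq, hpq⟩ := thin hg hh z hp
  rcases hq with hq | hq
  · exact ⟨q, Or.inl hq, by omega⟩
  · obtain ⟨q', hq', hqq⟩ := thin hg hh z' hq
    have := hg.tri p q q'
    rcases hq' with h | h
    · exact ⟨q', Or.inr (Or.inl h), by omega⟩
    · exact ⟨q', Or.inr (Or.inr h), by omega⟩

/-- The elementary closure of `w`. -/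
def elemSub (w : G) : Subgroup G where
  carrier := {g | ∃ p q : ℤ, p ≠ 0 ∧ q ≠ 0 ∧ g * w ^ p * g⁻¹ = w ^ q}
  one_mem' := ⟨1, 1, by simp, by simp, by simp⟩
  mul_mem' := by
    rintro g h ⟨p, q, hp, hq, e⟩ ⟨r, s, hr, hs, f⟩
    refine ⟨r * p, q * s, mul_ne_zero hr hp, mul_ne_zero hq hs, ?_⟩
    have f' : h * w ^ (r * p) * h⁻¹ = w ^ (s * p) := by
      rw [zpow_mul, ← conj_zpow, f, ← zpow_mul]
    have e' : g * w ^ (s * p) * g⁻¹ = w ^ (q * s) := by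
      rw [mul_comm s p, zpow_mul, ← conj_zpow, e, ← zpow_mul]
    calc g * h * w ^ (r * p) * (g * h)⁻¹ = g * (h * w ^ (r * p) * h⁻¹) * g⁻¹ := by group
      _ = _ := by rw [f', e']
  inv_mem' := by
    rintro g ⟨p, q, hp, hq, e⟩
    refine ⟨q, p, hq, hp, ?_⟩
    rw [← e]; group

lemma elem_near (hg : GeoM (wd S)) (hh : Hyp (wd S) δ) {w : G}
    (hw : wd S 1 w + (2 * δ + 1) ≤ wd S 1 (w ^ 2)) {g : G} (hgE : g ∈ elemSub w) :
    ∃ k : ℤ, wd S g (w ^ k) ≤ 3 * wd S 1 w + 10 * δ + 10 := by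
  obtain ⟨p, q, hp, hq, e⟩ := hgE
  obtain ⟨c, hc⟩ : ∃ c, c = wd S 1 w + 2 * δ + 2 * (2 * δ + 1) + wd S 1 g + 1 := ⟨_, rfl⟩
  have hM : ∀ m : ℤ, g * w ^ (p * m) = w ^ (q * m) * g := by
    intro m
    rw [zpow_mul w q, ← e, conj_zpow, ← zpow_mul]; group
  obtain ⟨A, hA⟩ : ∃ A, A = g * w ^ (p * -(c : ℤ)) := ⟨_, rfl⟩
  obtain ⟨B, hB⟩ : ∃ B, B = g * w ^ (p * (c : ℤ)) := ⟨_, rfl⟩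
  obtain ⟨n, hn⟩ : ∃ n, n = (p * (c : ℤ)).natAbs := ⟨_, rfl⟩
  have hnc : c ≤ n := by
    rw [hn, Int.natAbs_mul, Int.natAbs_natCast]
    have : 1 ≤ p.natAbs := by omega
    nlinarith
  have dA : wd S A g = wd S 1 (w ^ n) := by
    rw [hg.symm, wd_one, hA, inv_mul_cancel_left, wd_zpow hg, hn]; congr 2
    rw [mul_neg, Int.natAbs_neg]
  have dB : wd S g B = wd S 1 (w ^ n) := by
    rw [wd_one, hB, inv_mul_cancel_left, wd_zpow hg, hn]
  have dAB : wd S A B = wd S 1 (w ^ (n + n)) := by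
    rw [hA, hB, wd_left, wd_zpow_zpow, wd_zpow hg, hn]; congr 2
    have e : p * (c : ℤ) - p * -(c : ℤ) = p * c + p * c := by ring
    rw [e]
    generalize p * (c : ℤ) = z
    omega
  have hadd := lox_add hg hh hw n n
  have hlen := lox_le hg hh hw n
  obtain ⟨u, hu1, hu2⟩ := hg.interp A B (wd S 1 (w ^ n)) (by
    rw [dAB]
    have : ∀ t, wd S 1 (w ^ n) ≤ wd S 1 (w ^ (n + t)) := by
      intro t
      induction t with
      | zero => exact le_rfl
      | succ t ih => have := lox_mono hg hh hw (n + t); rw [← add_assoc]; omega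
    exact this n)
  have hug : wd S u g ≤ wd S 1 w + 2 * δ := by
    have := fellow hg hh (x := A) (y := B) (p := u) (q := g) (α := 0) (β := wd S 1 w + δ) (γ := 0)
      (by omega) (by omega) (by omega) (by omega)
    omega
  have da : wd S A (w ^ (q * -(c : ℤ))) = wd S 1 g := by
    rw [hA, hM, hg.symm, wd_one, inv_mul_cancel_left]
  have db : wd S B (w ^ (q * (c : ℤ))) = wd S 1 g := by
    rw [hB, hM, hg.symm, wd_one, inv_mul_cancel_left]
  obtain ⟨v, hv, huv⟩ := thin4 hg hh (w ^ (q * -(c : ℤ))) (w ^ (q * (c : ℤ)))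
    (show wd S A u + wd S u B = wd S A B by omega)
  have s1 := hg.symm g u
  have t1 := hg.tri g u v
  rcases hv with hv | hv | hv
  · have := hg.tri g v A
    have := hg.symm v A
    have := hg.symm g A
    omega
  · obtain ⟨k, hk⟩ := lox_qc hg hh hw _ _ v hv
    refine ⟨k, ?_⟩
    have := hg.tri g v (w ^ k)
    omega
  · have := hg.tri g v B
    have := hg.symm B (w ^ (q * (c : ℤ)))
    omega

lemma elem_qc (hg : GeoM (wd S)) (hh : Hyp (wd S) δ) {w : G}
    (hw : wd S 1 w + (2 * δ + 1) ≤ wd S 1 (w ^ 2)) :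
    QC (wd S) (elemSub w : Set G) (5 * wd S 1 w + 16 * δ + 12) := by
  intro y hy y' hy' q hq
  obtain ⟨i, hi⟩ := elem_near hg hh hw hy
  obtain ⟨j, hj⟩ := elem_near hg hh hw hy'
  obtain ⟨v, hv, hqv⟩ := thin4 hg hh (w ^ i) (w ^ j) hq
  rcases hv with hv | hv | hv
  · refine ⟨y, hy, ?_⟩
    have := hg.tri q v y
    have := hg.symm v y
    omega
  · obtain ⟨k, hk⟩ := lox_qc hg hh hw _ _ v hv
    have := hg.tri q v (w ^ k)
    refine ⟨w ^ k, ⟨1, 1, by simp, by simp, by group⟩, by omega⟩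
  · refine ⟨y', hy', ?_⟩
    have := hg.tri q v y'
    have := hg.symm y' (w ^ j)
    omega

lemma zpow_inj (hg : GeoM (wd S)) (hh : Hyp (wd S) δ) {w : G}
    (hw : wd S 1 w + (2 * δ + 1) ≤ wd S 1 (w ^ 2)) {k : ℤ} (h : w ^ k = 1) : k = 0 := by
  have h1 := wd_zpow hg w k
  rw [h, hg.self] at h1
  have := lox_le hg hh hw k.natAbs
  omega

lemma elem_sep (hfin : S.Finite) (hsym : ∀ s ∈ S, s⁻¹ ∈ S) (hgen : Subgroup.closure S = ⊤)
    (hh : Hyp (wd S) δ) {w : G}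
    (hw : wd S 1 w + (2 * δ + 1) ≤ wd S 1 (w ^ 2)) (κ : ℕ) :
    ∃ C, ∀ a b a' b' : G, a⁻¹ * b ∈ elemSub w → a'⁻¹ * b' ∈ elemSub w → a⁻¹ * a' ∉ elemSub w →
      wd S a a' ≤ κ → wd S b b' ≤ κ → wd S a b ≤ C := by
  have hg := wd_geo hsym hgen
  obtain ⟨c1, hc1⟩ : ∃ c, c = 3 * wd S 1 w + 10 * δ + 10 := ⟨_, rfl⟩
  obtain ⟨c2, hc2⟩ : ∃ c, c = 10 * κ + 10 * c1 + 20 * δ + 20 := ⟨_, rfl⟩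
  have hball := ball_finite hfin hsym hgen c2
  refine ⟨hball.toFinset.card * wd S 1 w + c1, ?_⟩
  intro a0 b0 a' b' hb0 hb' ha' hκ1 hκ2
  -- normalise
  obtain ⟨b, hb⟩ : ∃ b, b = a0⁻¹ * b0 := ⟨_, rfl⟩
  obtain ⟨g, hgd⟩ : ∃ g, g = a0⁻¹ * a' := ⟨_, rfl⟩
  obtain ⟨c, hcd⟩ : ∃ c, c = a'⁻¹ * b' := ⟨_, rfl⟩
  rw [← hb] at hb0
  rw [← hgd] at ha'
  rw [← hcd] at hb'
  have k1 : wd S 1 g ≤ κ := by rw [hgd, ← wd_one]; exact hκ1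
  have k2 : wd S b (g * c) ≤ κ := by
    rw [hb, hgd, hcd, show a0⁻¹ * a' * (a'⁻¹ * b') = a0⁻¹ * b' by group, wd_left]; exact hκ2
  rw [wd_one, ← hb]
  obtain ⟨j, hj⟩ := elem_near hg hh hw hb0
  obtain ⟨j', hj'⟩ := elem_near hg hh hw hb'
  rw [← hc1] at hj hj'
  rw [← wd_left S g] at hj'
  have k3 : wd S (w ^ j) (g * w ^ j') ≤ κ + 2 * c1 := by
    have := hg.tri (w ^ j) b (g * w ^ j')
    have := hg.tri b (g * c) (g * w ^ j')
    have := hg.symm (w ^ j) b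
    omega
  suffices hjb : j.natAbs ≤ hball.toFinset.card by
    have h1 := hg.tri 1 (w ^ j) b
    have h2 := hg.symm (w ^ j) b
    have h3 := wd_zpow hg w j
    have h4 := pow_le_mul hg w j.natAbs
    have h5 : j.natAbs * wd S 1 w ≤ hball.toFinset.card * wd S 1 w := Nat.mul_le_mul_right _ hjb
    omega
  by_contra hcon
  push Not at hcon
  -- sign
  obtain ⟨ε, hε, hjε⟩ : ∃ ε : ℤ, ε ≠ 0 ∧ j = ε * j.natAbs := by
    rcases Int.natAbs_eq j with h | h
    · exact ⟨1, by simp, by omega⟩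
    · exact ⟨-1, by simp, by omega⟩
  have hε1 : ∀ t : ℕ, (ε * (t : ℤ)).natAbs = t := by
    intro t
    have : j.natAbs = ε.natAbs * j.natAbs := by
      conv_lhs => rw [hjε]
      rw [Int.natAbs_mul, Int.natAbs_natCast]
    have h2 : ε.natAbs = 1 := by
      have hpos : 0 < j.natAbs := by omega
      exact Nat.eq_of_mul_eq_mul_right hpos (by omega)
    rw [Int.natAbs_mul, h2, Int.natAbs_natCast, one_mul]
  have close : ∀ t : ℕ, t ≤ j.natAbs → ∃ τ : ℤ, wd S (w ^ (ε * t)) (g * w ^ τ) ≤ c2 := by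
    intro t ht
    obtain ⟨n, hn⟩ : ∃ n, j.natAbs = t + n := ⟨j.natAbs - t, by omega⟩
    have e1 : wd S 1 (w ^ (ε * t)) = wd S 1 (w ^ t) := by rw [wd_zpow hg, hε1]
    have e2 : wd S (w ^ (ε * t)) (w ^ j) = wd S 1 (w ^ n) := by
      rw [wd_zpow_zpow, wd_zpow hg]; congr 2
      have e : j - ε * t = ε * n := by
        have h1 : (j.natAbs : ℤ) = t + n := by exact_mod_cast hn
        rw [h1] at hjε
        rw [hjε]; ring
      rw [e, hε1]
    have e3 : wd S 1 (w ^ j) = wd S 1 (w ^ (t + n)) := by rw [wd_zpow hg, hn]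
    have hadd := lox_add hg hh hw t n
    have hmono : wd S 1 (w ^ t) ≤ wd S 1 (w ^ (t + n)) := by
      clear hn e2 e3 hadd
      induction n with
      | zero => exact le_rfl
      | succ n ih => have := lox_mono hg hh hw (t + n); rw [← add_assoc]; omega
    obtain ⟨u, hu1, hu2⟩ := hg.interp 1 (w ^ j) (wd S 1 (w ^ t)) (by omega)
    have hug : wd S (w ^ (ε * t)) u ≤ wd S 1 w + 2 * δ := by
      have := fellow hg hh (x := 1) (y := w ^ j) (p := w ^ (ε * t)) (q := u) (α := wd S 1 w + δ)
        (β := 0) (γ := 0) (by omega) (by omega) (by omega) (by omega)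
      omega
    obtain ⟨v, hv, huv⟩ := thin4 hg hh g (g * w ^ j')
      (show wd S 1 u + wd S u (w ^ j) = wd S 1 (w ^ j) by omega)
    have t1 := hg.tri (w ^ (ε * t)) u v
    rcases hv with hv | hv | hv
    · refine ⟨0, ?_⟩
      rw [zpow_zero, mul_one]
      have := hg.tri (w ^ (ε * t)) v g
      omega
    · have hv' : wd S (w ^ (0 : ℤ)) (g⁻¹ * v) + wd S (g⁻¹ * v) (w ^ j') =
          wd S (w ^ (0 : ℤ)) (w ^ j') := by
        rw [← wd_left S g, ← wd_left S g (g⁻¹ * v), ← wd_left S g _ (w ^ j')]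
        simpa using hv
      obtain ⟨k, hk⟩ := lox_qc hg hh hw _ _ _ hv'
      rw [← wd_left S g, mul_inv_cancel_left] at hk
      refine ⟨k, ?_⟩
      have := hg.tri (w ^ (ε * t)) v (g * w ^ k)
      omega
    · refine ⟨j', ?_⟩
      have := hg.tri (w ^ (ε * t)) v (g * w ^ j')
      have := hg.symm v (g * w ^ j')
      have := hg.symm (w ^ j) (g * w ^ j')
      omega
  choose! τ hτ using close
  have hmaps : ∀ t ∈ Finset.range (j.natAbs), (w ^ (ε * (t : ℤ)))⁻¹ * (g * w ^ τ t) ∈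
      hball.toFinset := by
    intro t ht
    rw [Finset.mem_range] at ht
    rw [Set.Finite.mem_toFinset]
    have := hτ t ht.le
    rw [wd_one] at this
    exact this
  obtain ⟨t, ht, t', ht', htt, heq⟩ := Finset.exists_ne_map_eq_of_card_lt_of_maps_to
    (by rw [Finset.card_range]; exact hcon) hmaps
  apply ha'
  refine ⟨τ t - τ t', ε * t - ε * t', ?_, ?_, ?_⟩
  · intro h0
    have h0' : τ t = τ t' := by omega
    simp only [h0'] at heq
    have h1 : (w ^ (ε * (t : ℤ))) = w ^ (ε * (t' : ℤ)) := by
      have := mul_right_cancel heq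
      exact inv_injective this
    have h2 : w ^ (ε * (t : ℤ) - ε * t') = 1 := by rw [zpow_sub, h1, mul_inv_cancel]
    have h3 := zpow_inj hg hh hw h2
    rw [← mul_sub] at h3
    rcases mul_eq_zero.1 h3 with h | h
    · exact hε h
    · apply htt; omega
  · rw [← mul_sub]
    apply mul_ne_zero hε
    intro h; apply htt; omega
  · rw [inv_mul_eq_iff_eq_mul] at heq
    have h5 : g * w ^ τ t = w ^ (ε * (t : ℤ)) * ((w ^ (ε * (t' : ℤ)))⁻¹ * (g * w ^ τ t')) := heq
    rw [zpow_sub, zpow_sub, ← mul_assoc, h5]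
    group

end Lox
end HypQ

namespace HypQ
section ConeOff
variable {G : Type*} [Group G] {S : Set G} {E : Subgroup G} {δ κ : ℕ}

/-- Basic data for coning off. -/
structure Cone (S : Set G) (E : Subgroup G) (δ κ : ℕ) : Prop where
  fin : S.Finite
  sym : ∀ s ∈ S, s⁻¹ ∈ S
  gen : Subgroup.closure S = ⊤
  hyp : Hyp (wd S) δ
  qc : QC (wd S) (E : Set G) κ
  sep : ∀ k : ℕ, ∃ C, ∀ a b a' b' : G, a⁻¹ * b ∈ E → a'⁻¹ * b' ∈ E → a⁻¹ * a' ∉ E →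
      wd S a a' ≤ k → wd S b b' ≤ k → wd S a b ≤ C

/-- A coset as a set. -/
def cs (Y : G ⧸ E) : Set G := {x | (x : G ⧸ E) = Y}

/-- Coned off word metric. -/
noncomputable def we (S : Set G) (E : Subgroup G) (x y : G) : ℕ := wd (S ∪ (E : Set G)) x y

lemma mem_cs {Y : G ⧸ E} {x : G} : x ∈ cs Y ↔ (x : G ⧸ E) = Y := Iff.rfl

lemma cs_nonempty (Y : G ⧸ E) : (cs Y).Nonempty := by
  obtain ⟨g, rfl⟩ := QuotientGroup.mk_surjective Y
  exact ⟨g, rfl⟩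

lemma cs_smul {Y : G ⧸ E} {x : G} (g : G) (hx : x ∈ cs Y) : g * x ∈ cs (g • Y) := by
  rw [mem_cs] at *
  rw [← hx]; rfl

lemma cs_div {Y : G ⧸ E} {x y : G} (hx : x ∈ cs Y) (hy : y ∈ cs Y) : x⁻¹ * y ∈ E := by
  rw [mem_cs] at *
  exact QuotientGroup.eq.1 (hx.trans hy.symm)

lemma cs_of_div {Y : G ⧸ E} {x y : G} (hx : x ∈ cs Y) (h : x⁻¹ * y ∈ E) : y ∈ cs Y := by
  rw [mem_cs] at *
  rw [← hx]; exact (QuotientGroup.eq.2 h).symm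

lemma we_left (g x y : G) : we S E (g * x) (g * y) = we S E x y := wd_left _ _ _ _

namespace Cone

lemma geo (h : Cone S E δ κ) : GeoM (wd S) := wd_geo h.sym h.gen

lemma symE (h : Cone S E δ κ) : ∀ s ∈ S ∪ (E : Set G), s⁻¹ ∈ S ∪ (E : Set G) := by
  rintro s (hs | hs)
  · exact Or.inl (h.sym s hs)
  · exact Or.inr (E.inv_mem hs)

lemma genE (h : Cone S E δ κ) : Subgroup.closure (S ∪ (E : Set G)) = ⊤ := by
  rw [eq_top_iff, ← h.gen]
  exact Subgroup.closure_mono Set.subset_union_left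

lemma geoE (h : Cone S E δ κ) : GeoM (we S E) := wd_geo h.symE h.genE

lemma e_le (h : Cone S E δ κ) (x y : G) : we S E x y ≤ wd S x y := by
  obtain ⟨l, hl, hn, hp⟩ := exists_geod h.sym h.gen (x⁻¹ * y)
  have := wordLength_le (S := S ∪ (E : Set G)) (l := l) (fun z hz => Or.inl (hl z hz))
  rw [hp, hn] at this
  exact this

lemma e_coset (h : Cone S E δ κ) {Y : G ⧸ E} {x y : G} (hx : x ∈ cs Y) (hy : y ∈ cs Y) : we S E x y ≤ 1 :=
  wd_le_of_mem (Or.inr (cs_div hx hy))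

lemma e_edge (h : Cone S E δ κ) {x y : G} (hxy : we S E x y ≤ 1) :
    wd S x y ≤ 1 ∨ ∃ Y : G ⧸ E, x ∈ cs Y ∧ y ∈ cs Y := by
  rcases wd_le_one h.symE h.genE hxy with h1 | h1 | h1
  · left; rw [h1, h.geo.self]; omega
  · left; exact wd_le_of_mem h1
  · right; exact ⟨x, rfl, cs_of_div (mem_cs.2 rfl) h1⟩

lemma qcY (h : Cone S E δ κ) (Y : G ⧸ E) : QC (wd S) (cs Y) κ := by
  obtain ⟨g, rfl⟩ := QuotientGroup.mk_surjective Y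
  intro y hy y' hy' q hq
  have m : g ∈ cs (g : G ⧸ E) := rfl
  obtain ⟨v, hv, hqv⟩ := h.qc (g⁻¹ * y) (cs_div m hy) (g⁻¹ * y') (cs_div m hy') (g⁻¹ * q)
    (by simpa only [wd_left] using hq)
  refine ⟨g * v, cs_of_div m (by simpa using hv), ?_⟩
  rw [← wd_left S g, mul_inv_cancel_left] at hqv
  exact hqv

lemma coset_proj (h : Cone S E δ κ) : ∃ C, ∀ (Y Z : G ⧸ E) (x z p q : G), Y ≠ Z → x ∈ cs Z → z ∈ cs Z →
    Near (wd S) (cs Y) x p → Near (wd S) (cs Y) z q → wd S p q ≤ C := by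
  obtain ⟨C, hC⟩ := h.sep (9 * κ + 11 * δ + 4)
  refine ⟨C + (2 * κ + 3 * δ + 1), ?_⟩
  intro Y Z x z p q hYZ hx hz hp hq
  by_cases hc : wd S p q ≤ 2 * κ + 3 * δ + 1
  · omega
  have sy := h.geo.symm p q
  obtain ⟨u, hu, hup⟩ := near_pass h.geo h.hyp (h.qcY Y) hp hq (by omega)
  obtain ⟨u', hu', hup'⟩ := near_pass h.geo h.hyp (h.qcY Y) hq hp (by omega)
  obtain ⟨v, hv, huv⟩ := h.qcY Z x hx z hz u hu
  obtain ⟨v', hv', huv'⟩ := h.qcY Z z hz x hx u' hu'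
  have := hC p q v v' (cs_div hp.1 hq.1) (cs_div hv hv') (fun hE => hYZ (by
      have h1 := cs_of_div hp.1 hE
      rw [mem_cs] at h1 hv
      exact h1.symm.trans hv))
    (by have := h.geo.tri p u v; have := h.geo.symm p u; omega)
    (by have := h.geo.tri q u' v'; have := h.geo.symm q u'; omega)
  omega

lemma edge_int (h : Cone S E δ κ) (x y p : G) (hxy : we S E x y ≤ 1) (hp : wd S x p + wd S p y = wd S x y) :
    we S E x p ≤ 1 + κ := by
  rcases h.e_edge hxy with h1 | ⟨Y, hx, hy⟩
  · have := h.e_le x p; omega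
  · obtain ⟨v, hv, hpv⟩ := h.qcY Y x hx y hy p hp
    have := h.e_coset hx hv
    have := h.geoE.tri x v p
    have := h.geoE.symm v p
    have := h.e_le p v
    omega

end Cone

/-- Consequences of the coned off geometry with a single constant. -/
structure BG (S : Set G) (E : Subgroup G) (c : ℕ) : Prop where
  fin : S.Finite
  sym : ∀ s ∈ S, s⁻¹ ∈ S
  gen : Subgroup.closure S = ⊤
  geo : GeoM (wd S)
  geoE : GeoM (we S E)
  hypE : Hyp (we S E) c
  cos : ∀ (Y : G ⧸ E) (x y : G), x ∈ cs Y → y ∈ cs Y → we S E x y ≤ 1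
  lip : ∀ (Y : G ⧸ E) (x z p q : G), Near (wd S) (cs Y) x p → Near (wd S) (cs Y) z q →
    wd S p q ≤ wd S x z + c
  two : ∀ (Y : G ⧸ E) (x z p q : G), Near (wd S) (cs Y) x p → Near (wd S) (cs Y) z q →
    c < wd S p q → wd S x p + wd S p q + wd S q z ≤ wd S x z + c
  proj : ∀ (Y Z : G ⧸ E) (x z p q : G), Y ≠ Z → x ∈ cs Z → z ∈ cs Z →
    Near (wd S) (cs Y) x p → Near (wd S) (cs Y) z q → wd S p q ≤ c
  bgi : ∀ (Y : G ⧸ E) (x z p q : G), Near (wd S) (cs Y) x p → Near (wd S) (cs Y) z q →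
    c < wd S p q → ∃ a ∈ cs Y, ∃ b ∈ cs Y, we S E x a + 1 + we S E b z = we S E x z

namespace Cone

lemma exists_BG (h : Cone S E δ κ) : ∃ c, BG S E c := by
  obtain ⟨C, hC⟩ := h.coset_proj
  obtain ⟨r, δ', _, hr, hE⟩ := guess_hyp h.geo h.hyp h.geoE h.e_le h.edge_int
  obtain ⟨C1, hC1⟩ : ∃ C1, C1 = C + (4 * κ + 5 * δ + 3) := ⟨_, rfl⟩
  obtain ⟨K, hK⟩ : ∃ K, K = r + (8 * κ + 11 * δ + 4) := ⟨_, rfl⟩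
  obtain ⟨c0, hc0⟩ : ∃ c0, c0 = 2 * κ + 3 * δ + 1 := ⟨_, rfl⟩
  have edge : ∀ (Y : G ⧸ E) (x y p q : G), we S E x y ≤ 1 → (x ∈ cs Y → y ∈ cs Y → x = y) →
      Near (wd S) (cs Y) x p → Near (wd S) (cs Y) y q → wd S p q ≤ C1 := by
    intro Y x y p q hxy hne hp hq
    rcases h.e_edge hxy with h1 | ⟨Z, hx, hy⟩
    · have := near_lip h.geo h.hyp (h.qcY Y) hp hq
      omega
    · by_cases hYZ : Y = Z
      · subst hYZ
        have e := hne hx hy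
        have := near_lip h.geo h.hyp (h.qcY Y) hp hq
        rw [e, h.geo.self] at this
        omega
      · have := hC Y Z x y p q hYZ hx hy hp hq
        omega
  -- far segments
  have far : ∀ (Y : G ⧸ E) (f : ℕ → G) (m : ℕ), Geod (we S E) f m →
      (∀ i ≤ m, ∀ y ∈ cs Y, K < we S E (f i) y) → ∀ p q, Near (wd S) (cs Y) (f 0) p →
      Near (wd S) (cs Y) (f m) q → wd S p q ≤ c0 := by
    intro Y f m hf hfar p q hp hq
    by_contra hcon
    obtain ⟨u, hu, hup⟩ := near_pass h.geo h.hyp (h.qcY Y) hp hq (by omega)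
    obtain ⟨i, hi, hui⟩ := hr f m hf u hu
    have := hfar i hi p hp.1
    have := h.geoE.tri (f i) u p
    have := h.geoE.symm (f i) u
    have := h.e_le u p
    omega
  obtain ⟨c1, hc1⟩ : ∃ c1, c1 = 2 * c0 + 2 * C1 + (2 * K + 1) * C1 := ⟨_, rfl⟩
  have bgi : ∀ (Y : G ⧸ E) (x z p q : G), Near (wd S) (cs Y) x p → Near (wd S) (cs Y) z q →
      c1 < wd S p q → ∃ a ∈ cs Y, ∃ b ∈ cs Y, we S E x a + 1 + we S E b z = we S E x z := by
    intro Y x z p q hp hq hpq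
    by_contra hcon
    obtain ⟨f, hf, f0, _, fm⟩ := exists_geodesic h.geoE x z x (by rw [h.geoE.self]; omega)
    obtain ⟨m, hm⟩ : ∃ m, m = we S E x z := ⟨_, rfl⟩
    rw [← hm] at hf fm
    have uniq : ∀ i j, i < j → j ≤ m → f i ∈ cs Y → f j ∉ cs Y := by
      intro i j hij hj hi hj'
      apply hcon
      refine ⟨f i, hi, f j, hj', ?_⟩
      have a1 := hf 0 i (by omega) (by omega)
      have a2 := hf i j (by omega) (by omega)
      have a3 := hf j m (by omega) (by omega)
      have a4 := h.e_coset hi hj'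
      rw [f0] at a1
      rw [fm] at a3
      omega
    have hpr : ∀ i, ∃ p, Near (wd S) (cs Y) (f i) p := fun i => exists_near _ (cs_nonempty Y) _
    choose π hπ using hpr
    have step : ∀ i, i + 1 ≤ m → ∀ p q, Near (wd S) (cs Y) (f i) p →
        Near (wd S) (cs Y) (f (i + 1)) q → wd S p q ≤ C1 := by
      intro i hi p q hp hq
      refine edge Y (f i) (f (i + 1)) p q ?_ ?_ hp hq
      · have := hf i (i + 1) (by omega) hi
        omega
      · intro h1 h2
        exact absurd h2 (uniq i (i + 1) (by omega) hi h1)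
    have steps : ∀ n i, i + n ≤ m → wd S (π i) (π (i + n)) ≤ n * C1 := by
      intro n
      induction n with
      | zero => intro i _; simp [h.geo.self]
      | succ n ih =>
        intro i hi
        have a := ih i (by omega)
        have b := step (i + n) (by omega) _ _ (hπ _) (hπ (i + n + 1))
        have t := h.geo.tri (π i) (π (i + n)) (π (i + n + 1))
        have e : (n + 1) * C1 = n * C1 + C1 := by ring
        rw [← add_assoc]
        omega
    rw [← f0] at hp
    rw [← fm] at hq
    by_cases hnone : ∃ i ≤ m, ∃ y ∈ cs Y, we S E (f i) y ≤ K
    · classical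
      let Pr : ℕ → Prop := fun i => i ≤ m ∧ ∃ y ∈ cs Y, we S E (f i) y ≤ K
      have hex : ∃ i, Pr i := hnone
      obtain ⟨i0, hi0, hmin⟩ : ∃ i0, Pr i0 ∧ ∀ i < i0, ¬ Pr i :=
        ⟨Nat.find hex, Nat.find_spec hex, fun i hi => Nat.find_min hex hi⟩
      obtain ⟨i1, hi1, hmax⟩ : ∃ i1, Pr i1 ∧ ∀ i, i1 < i → ¬ Pr i := by
        refine ⟨Nat.findGreatest Pr m, Nat.findGreatest_spec hi0.1 hi0, ?_⟩
        intro i hi hP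
        have := Nat.le_findGreatest hP.1 hP
        omega
      have h01 : i0 ≤ i1 := by
        by_contra hlt
        exact hmin i1 (by omega) hi1
      obtain ⟨hi0m, y0, hy0, hfy0⟩ := hi0
      obtain ⟨hi1m, y1, hy1, hfy1⟩ := hi1
      have hlen : i1 - i0 ≤ 2 * K + 1 := by
        have a := hf i0 i1 h01 hi1m
        have := h.geoE.tri (f i0) y0 (f i1)
        have := h.geoE.tri y0 y1 (f i1)
        have := h.geoE.symm y1 (f i1)
        have := h.e_coset hy0 hy1
        omega
      have mid : wd S (π i0) (π i1) ≤ (2 * K + 1) * C1 := by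
        have a := steps (i1 - i0) i0 (by omega)
        rw [show i0 + (i1 - i0) = i1 by omega] at a
        exact a.trans (Nat.mul_le_mul_right _ hlen)
      have left : wd S p (π i0) ≤ c0 + C1 := by
        rcases Nat.eq_zero_or_pos i0 with h0 | h0
        · rw [h0]
          have h1 := near_lip h.geo h.hyp (h.qcY Y) hp (hπ 0)
          rw [h.geo.self] at h1
          omega
        · obtain ⟨j, rfl⟩ : ∃ j, i0 = j + 1 := ⟨i0 - 1, by omega⟩
          have a := far Y f j (fun a b h1 h2 => hf a b h1 (by omega)) (fun i hi y hy => by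
            by_contra hle
            exact hmin i (by omega) ⟨by omega, y, hy, by omega⟩) p (π j) hp (hπ j)
          have b := step j (by omega) _ _ (hπ j) (hπ (j + 1))
          have := h.geo.tri p (π j) (π (j + 1))
          omega
      have right : wd S (π i1) q ≤ c0 + C1 := by
        rcases Nat.eq_or_lt_of_le hi1m with h0 | h0
        · have h1 := near_lip h.geo h.hyp (h.qcY Y) (hπ i1) hq
          rw [h0, h.geo.self] at h1
          rw [h0]
          omega
        · have a := far Y (fun t => f (i1 + 1 + t)) (m - (i1 + 1)) (fun a b h1 h2 => by
              have := hf (i1 + 1 + a) (i1 + 1 + b) (by omega) (by omega)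
              show a + we S E (f (i1 + 1 + a)) (f (i1 + 1 + b)) = b
              omega) (fun i hi y hy => by
            by_contra hle
            exact hmax (i1 + 1 + i) (by omega) ⟨by omega, y, hy, by simpa using hle⟩)
            (π (i1 + 1)) q (hπ (i1 + 1)) (by
              show Near (wd S) (cs Y) (f (i1 + 1 + (m - (i1 + 1)))) q
              rw [show i1 + 1 + (m - (i1 + 1)) = m by omega]; exact hq)
          have b := step i1 (by omega) _ _ (hπ i1) (hπ (i1 + 1))
          have := h.geo.tri (π i1) (π (i1 + 1)) q
          omega
      have := h.geo.tri p (π i0) q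
      have := h.geo.tri (π i0) (π i1) q
      omega
    · push Not at hnone
      have := far Y f m hf (fun i hi y hy => hnone i hi y hy) p q hp hq
      omega
  refine ⟨c1 + C + δ' + (4 * κ + 5 * δ + 2), h.fin, h.sym, h.gen, h.geo, h.geoE, ?_, ?_, ?_, ?_, ?_, ?_⟩
  · intro x y z w
    have := hE x y z w
    omega
  · intro Y x y hx hy; exact h.e_coset hx hy
  · intro Y x z p q hp hq
    have := near_lip h.geo h.hyp (h.qcY Y) hp hq
    omega
  · intro Y x z p q hp hq hc
    rcases near_two h.geo h.hyp (h.qcY Y) hp hq with h1 | h1 <;> omega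
  · intro Y Z x z p q hYZ hx hz hp hq
    have := hC Y Z x z p q hYZ hx hz hp hq
    omega
  · intro Y x z p q hp hq hc
    exact bgi Y x z p q hp hq (by omega)

end Cone
end ConeOff
end HypQ

namespace HypQ
section Inst
variable {G : Type*} [Group G] {S : Set G} {E : Subgroup G} {c : ℕ}

/-- Coned off distance between cosets. -/
noncomputable def rho (S : Set G) (E : Subgroup G) (X Z : G ⧸ E) : ℕ :=
  sInf {n | ∃ x ∈ cs X, ∃ z ∈ cs Z, we S E x z = n}

/-- Projection of a coset to another one. -/
def pr (S : Set G) (E : Subgroup G) (Y X : G ⧸ E) : Set G :=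
  {y | y ∈ cs Y ∧ ∃ x ∈ cs X, we S E x y = rho S E X Y}

/-- Projection distances. -/
noncomputable def DD (S : Set G) (E : Subgroup G) (Y X Z : G ⧸ E) : ℕ :=
  sSup {n | ∃ a ∈ pr S E Y X, ∃ b ∈ pr S E Y Z, wd S a b = n}

lemma rho_ex (S : Set G) (X Z : G ⧸ E) : ∃ x ∈ cs X, ∃ z ∈ cs Z, we S E x z = rho S E X Z := by
  obtain ⟨x, hx⟩ := cs_nonempty X
  obtain ⟨z, hz⟩ := cs_nonempty Z
  exact Nat.sInf_mem (s := {n | ∃ x ∈ cs X, ∃ z ∈ cs Z, we S E x z = n}) ⟨_, x, hx, z, hz, rfl⟩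

lemma rho_le (S : Set G) {X Z : G ⧸ E} {x z : G} (hx : x ∈ cs X) (hz : z ∈ cs Z) :
    rho S E X Z ≤ we S E x z := Nat.sInf_le ⟨x, hx, z, hz, rfl⟩

lemma pr_nonempty (S : Set G) (Y X : G ⧸ E) : ∃ a, a ∈ pr S E Y X := by
  obtain ⟨x, hx, y, hy, h⟩ := rho_ex S X Y
  exact ⟨y, hy, x, hx, h⟩

lemma cs_smul_iff {Y : G ⧸ E} {x : G} (g : G) : x ∈ cs (g • Y) ↔ g⁻¹ * x ∈ cs Y := by
  constructor
  · intro h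
    have := cs_smul g⁻¹ h
    rwa [inv_smul_smul] at this
  · intro h
    have := cs_smul g h
    rwa [mul_inv_cancel_left] at this

lemma rho_smul (g : G) (X Z : G ⧸ E) : rho S E (g • X) (g • Z) = rho S E X Z := by
  apply le_antisymm
  · obtain ⟨x, hx, z, hz, h⟩ := rho_ex S X Z
    rw [← h, ← we_left g]
    exact rho_le S (cs_smul g hx) (cs_smul g hz)
  · obtain ⟨x, hx, z, hz, h⟩ := rho_ex S (g • X) (g • Z)
    rw [← h, ← we_left g⁻¹]
    exact rho_le S ((cs_smul_iff g).1 hx) ((cs_smul_iff g).1 hz)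

lemma pr_smul {Y X : G ⧸ E} {a : G} (g : G) (ha : a ∈ pr S E Y X) :
    g * a ∈ pr S E (g • Y) (g • X) := by
  obtain ⟨hy, x, hx, h⟩ := ha
  refine ⟨cs_smul g hy, g * x, cs_smul g hx, ?_⟩
  rw [we_left, rho_smul, h]

namespace BG

lemma pr_near (h : BG S E c) {Y X : G ⧸ E} (hXY : X ≠ Y) {a x p : G} (ha : a ∈ pr S E Y X) (hx : x ∈ cs X)
    (hp : Near (wd S) (cs Y) x p) : wd S a p ≤ 2 * c := by
  obtain ⟨hy, x', hx', he⟩ := ha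
  obtain ⟨p', hp'⟩ := exists_near (wd S) (cs_nonempty Y) x'
  have h1 := h.proj Y X x' x p' p hXY.symm hx' hx hp' hp
  have h2 : wd S p' a ≤ c := by
    by_contra hcon
    obtain ⟨a', ha', b, _, hab⟩ := h.bgi Y x' a p' a hp' ⟨hy, fun y _ => by rw [h.geo.self]; omega⟩
      (by omega)
    have := rho_le S hx' ha'
    omega
  have := h.geo.tri a p' p
  have := h.geo.symm a p'
  omega

lemma pr_bdd (h : BG S E c) {Y X Z : G ⧸ E} (hXY : X ≠ Y) (hZY : Z ≠ Y) {x z p q a b : G} (hx : x ∈ cs X)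
    (hz : z ∈ cs Z) (hp : Near (wd S) (cs Y) x p) (hq : Near (wd S) (cs Y) z q)
    (ha : a ∈ pr S E Y X) (hb : b ∈ pr S E Y Z) :
    wd S a b ≤ wd S p q + 4 * c ∧ wd S p q ≤ wd S a b + 4 * c := by
  have h1 := h.pr_near hXY ha hx hp
  have h2 := h.pr_near hZY hb hz hq
  have := h.geo.tri a p b
  have := h.geo.tri p q b
  have := h.geo.tri p a q
  have := h.geo.tri a b q
  have := h.geo.symm p a
  have := h.geo.symm q b
  omega

lemma D_bddAbove (h : BG S E c) {Y X Z : G ⧸ E} (hXY : X ≠ Y) (hZY : Z ≠ Y) :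
    BddAbove {n | ∃ a ∈ pr S E Y X, ∃ b ∈ pr S E Y Z, wd S a b = n} := by
  obtain ⟨x, hx⟩ := cs_nonempty X
  obtain ⟨z, hz⟩ := cs_nonempty Z
  obtain ⟨p, hp⟩ := exists_near (wd S) (cs_nonempty Y) x
  obtain ⟨q, hq⟩ := exists_near (wd S) (cs_nonempty Y) z
  refine ⟨wd S p q + 4 * c, ?_⟩
  rintro n ⟨a, ha, b, hb, rfl⟩
  exact (h.pr_bdd hXY hZY hx hz hp hq ha hb).1

lemma D_ge (h : BG S E c) {Y X Z : G ⧸ E} (hXY : X ≠ Y) (hZY : Z ≠ Y) {a b : G} (ha : a ∈ pr S E Y X)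
    (hb : b ∈ pr S E Y Z) : wd S a b ≤ DD S E Y X Z :=
  le_csSup (h.D_bddAbove hXY hZY) ⟨a, ha, b, hb, rfl⟩

lemma D_att (h : BG S E c) {Y X Z : G ⧸ E} (hXY : X ≠ Y) (hZY : Z ≠ Y) :
    ∃ a ∈ pr S E Y X, ∃ b ∈ pr S E Y Z, wd S a b = DD S E Y X Z := by
  obtain ⟨a, ha⟩ := pr_nonempty S Y X
  obtain ⟨b, hb⟩ := pr_nonempty S Y Z
  exact Nat.sSup_mem (s := {n | ∃ a ∈ pr S E Y X, ∃ b ∈ pr S E Y Z, wd S a b = n})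
    ⟨_, a, ha, b, hb, rfl⟩ (h.D_bddAbove hXY hZY)

/-- Comparison of projection distances. -/
lemma D_near (h : BG S E c) {Y X Z : G ⧸ E} (hXY : X ≠ Y) (hZY : Z ≠ Y) {x z p q : G} (hx : x ∈ cs X)
    (hz : z ∈ cs Z) (hp : Near (wd S) (cs Y) x p) (hq : Near (wd S) (cs Y) z q) :
    DD S E Y X Z ≤ wd S p q + 4 * c := by
  obtain ⟨a, ha, b, hb, e⟩ := h.D_att hXY hZY
  rw [← e]
  exact (h.pr_bdd hXY hZY hx hz hp hq ha hb).1

lemma bgi_coset (h : BG S E c) {Y X Z : G ⧸ E} (hXY : X ≠ Y) (hZY : Z ≠ Y) (hD : 5 * c < DD S E Y X Z) {x z : G}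
    (hx : x ∈ cs X) (hz : z ∈ cs Z) :
    ∃ a ∈ cs Y, ∃ b ∈ cs Y, we S E x a + 1 + we S E b z = we S E x z := by
  obtain ⟨p, hp⟩ := exists_near (wd S) (cs_nonempty Y) x
  obtain ⟨q, hq⟩ := exists_near (wd S) (cs_nonempty Y) z
  have := h.D_near hXY hZY hx hz hp hq
  exact h.bgi Y x z p q hp hq (by omega)

lemma pr_eq (h : BG S E c) {Y X Z : G ⧸ E} (hXY : X ≠ Y) (hZY : Z ≠ Y) (hD : 5 * c < DD S E Y X Z) :
    pr S E Z X = pr S E Z Y := by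
  obtain ⟨x0, hx0, z0, hz0, h0⟩ := rho_ex S X Z
  obtain ⟨a0, ha0, b0, hb0, hab0⟩ := h.bgi_coset hXY hZY hD hx0 hz0
  ext z
  constructor
  · rintro ⟨hz, x, hx, he⟩
    obtain ⟨a, ha, b, hb, hab⟩ := h.bgi_coset hXY hZY hD hx hz
    refine ⟨hz, b, hb, le_antisymm ?_ (rho_le S hb hz)⟩
    obtain ⟨y, hy, z', hz', he'⟩ := rho_ex S Y Z
    have := rho_le S hx hz'
    have := h.geoE.tri x a z'
    have := h.geoE.tri a y z'
    have := h.cos Y a y ha hy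
    omega
  · rintro ⟨hz, y, hy, he⟩
    refine ⟨hz, x0, hx0, le_antisymm ?_ (rho_le S hx0 hz)⟩
    have := h.geoE.tri x0 a0 z
    have := h.geoE.tri a0 y z
    have := h.cos Y a0 y ha0 hy
    have := rho_le S hb0 hz0
    omega

lemma projSys (h : BG S E c) : ProjSys G (DD S E) (rho S E) (5 * c) where
  symm Y X Z := by
    unfold DD
    congr 1
    ext n
    constructor
    · rintro ⟨a, ha, b, hb, e⟩
      exact ⟨b, hb, a, ha, by rw [h.geo.symm]; exact e⟩
    · rintro ⟨a, ha, b, hb, e⟩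
      exact ⟨b, hb, a, ha, by rw [h.geo.symm]; exact e⟩
  tri Y X Z W hX hZ hW := by
    obtain ⟨a, ha, b, hb, e⟩ := h.D_att hX hZ
    obtain ⟨w, hw⟩ := pr_nonempty S Y W
    have := h.D_ge hX hW ha hw
    have := h.D_ge hW hZ hw hb
    have := h.geo.tri a w b
    omega
  diag Y X hX := by
    obtain ⟨x, hx⟩ := cs_nonempty X
    obtain ⟨p, hp⟩ := exists_near (wd S) (cs_nonempty Y) x
    have := h.D_near hX hX hx hx hp hp
    rw [h.geo.self] at this
    omega
  ex Y X Z hX hZ _ hD W _ := by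
    unfold DD
    rw [h.pr_eq hX hZ hD]
  rank Y X Z hX hZ hD := by
    obtain ⟨x, hx, z, hz, e⟩ := rho_ex S X Z
    obtain ⟨a, ha, b, hb, hab⟩ := h.bgi_coset hX hZ hD hx hz
    have := rho_le S hx ha
    have := rho_le S hb hz
    omega
  equiv g Y X Z := by
    unfold DD
    congr 1
    ext n
    constructor
    · rintro ⟨a, ha, b, hb, e⟩
      have ha' := pr_smul g⁻¹ ha
      have hb' := pr_smul g⁻¹ hb
      rw [inv_smul_smul, inv_smul_smul] at ha' hb'
      exact ⟨_, ha', _, hb', by rw [wd_left]; exact e⟩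
    · rintro ⟨a, ha, b, hb, e⟩
      exact ⟨_, pr_smul g ha, _, pr_smul g hb, by rw [wd_left]; exact e⟩

end BG

/-- Rotation groups. -/
def rotN (E R : Subgroup G) (Y : G ⧸ E) : Subgroup G where
  carrier := {x | ∀ g ∈ cs Y, g⁻¹ * x * g ∈ R}
  one_mem' := by intro g _; simp
  mul_mem' := by
    intro a b ha hb g hg
    have := R.mul_mem (ha g hg) (hb g hg)
    convert this using 1; group
  inv_mem' := by
    intro a ha g hg
    have := R.inv_mem (ha g hg)
    convert this using 1; group

/-- Admissible subgroups of `E`. -/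
structure RotSub (S : Set G) (E R : Subgroup G) (L : ℕ) : Prop where
  le : R ≤ E
  norm : ∀ g ∈ E, ∀ r ∈ R, g * r * g⁻¹ ∈ R
  len : ∀ r ∈ R, r ≠ 1 → L ≤ wd S 1 r

variable {R : Subgroup G} {L : ℕ}

lemma rotN_mk (hR : RotSub S E R L) {Y : G ⧸ E} {g r : G} (hg : g ∈ cs Y) (hr : r ∈ R) :
    g * r * g⁻¹ ∈ rotN E R Y := by
  intro g' hg'
  have := hR.norm _ (cs_div hg' hg) r hr
  convert this using 1; group

lemma rotN_conj (hR : RotSub S E R L) (g : G) {Y : G ⧸ E} {x : G} (hx : x ∈ rotN E R Y) :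
    g * x * g⁻¹ ∈ rotN E R (g • Y) := by
  intro g' hg'
  have := hx _ ((cs_smul_iff g).1 hg')
  convert this using 1; group

lemma rotN_fix (hR : RotSub S E R L) {Y : G ⧸ E} {x : G} (hx : x ∈ rotN E R Y) : x • Y = Y := by
  obtain ⟨g, rfl⟩ := QuotientGroup.mk_surjective Y
  have h1 := hR.le (hx g rfl)
  have h2 : g⁻¹ * (x * g) ∈ E := by rwa [← mul_assoc]
  exact (QuotientGroup.eq.2 h2).symm

lemma BG.rotFam (h : BG S E c) (hR : RotSub S E R L) : RotFam (DD S E) (rotN E R) L where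
  conj g Y x hx := rotN_conj hR g hx
  fix Y x hx := rotN_fix hR hx
  spin Y x X hx hx1 hX := by
    have hfix := rotN_fix hR hx
    obtain ⟨a, ha⟩ := pr_nonempty S Y X
    have hb := pr_smul x ha
    rw [hfix] at hb
    have hX' : x • X ≠ Y := by
      intro e
      apply hX
      rw [← hfix] at e
      exact smul_left_cancel x e
    refine le_trans ?_ (h.D_ge hX hX' ha hb)
    rw [wd_one, ← mul_assoc]
    apply hR.len _ (hx a ha.1)
    intro e
    apply hx1
    rw [mul_assoc, inv_mul_eq_one] at e
    exact mul_eq_right.1 e.symm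

/-- The normal closure. -/
def bigN (E R : Subgroup G) : Subgroup G := rotGrp (rotN E R) Set.univ

lemma bigN_normal (hR : RotSub S E R L) : (bigN E R).Normal := by
  constructor
  intro n hn g
  unfold bigN rotGrp at *
  induction hn using Subgroup.closure_induction with
  | mem x hx =>
    obtain ⟨Y, _, hx⟩ := hx
    exact Subgroup.subset_closure ⟨g • Y, trivial, rotN_conj hR g hx⟩
  | one => simpa using Subgroup.one_mem _
  | mul x y _ _ hx hy =>
    have := Subgroup.mul_mem _ hx hy
    convert this using 1; group
  | inv x _ hx =>
    have := Subgroup.inv_mem _ hx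
    convert this using 1; group

lemma R_le_bigN (hR : RotSub S E R L) {r : G} (hr : r ∈ R) : r ∈ bigN E R := by
  have := rotN_mk hR (Y := ((1 : G) : G ⧸ E)) (g := 1) rfl hr
  exact Subgroup.subset_closure ⟨_, trivial, by simpa using this⟩

lemma rotN_le_bigN {Y : G ⧸ E} {x : G} (hx : x ∈ rotN E R Y) : x ∈ bigN E R :=
  Subgroup.subset_closure ⟨Y, trivial, hx⟩

/-- Greendlinger type lemma. -/
lemma BG.green (h : BG S E c) (hR : RotSub S E R L) (hL : 79 * c + 1 ≤ L) (x0 : G) {n : G}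
    (hn : n ∈ bigN E R) (hn1 : n ≠ 1) :
    ∃ (Y : G ⧸ E) (p q : G), Near (wd S) (cs Y) x0 p ∧ Near (wd S) (cs Y) (n * x0) q ∧
      L ≤ wd S p q + 69 * c := by
  rcases windmill h.projSys (h.rotFam hR) (M := L - 65 * c) (by omega) (by omega)
    ((x0 : G) : G ⧸ E) hn with h1 | ⟨T, hT1, hT2, hT3⟩
  · have hfix := rotN_fix hR h1
    have hm : n * x0 ∈ cs ((x0 : G) : G ⧸ E) := by
      rw [← hfix]; exact cs_smul n rfl
    refine ⟨(x0 : G ⧸ E), x0, n * x0, ⟨rfl, fun y _ => by rw [h.geo.self]; omega⟩,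
      ⟨hm, fun y _ => by rw [h.geo.self]; omega⟩, ?_⟩
    have h2 := h1 x0 rfl
    have h3 := hR.len _ h2 (by
      intro e
      apply hn1
      rw [mul_assoc, inv_mul_eq_one] at e
      exact mul_eq_right.1 e.symm)
    rw [wd_one, ← mul_assoc]
    omega
  · obtain ⟨p, hp⟩ := exists_near (wd S) (cs_nonempty T) x0
    obtain ⟨q, hq⟩ := exists_near (wd S) (cs_nonempty T) (n * x0)
    refine ⟨T, p, q, hp, hq, ?_⟩
    have := h.D_near hT1.symm hT2.symm (x := x0) rfl (cs_smul n (mem_cs.2 rfl)) hp hq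
    omega

end Inst
end HypQ

namespace HypQ
section Quot
variable {G : Type*} [Group G] {S : Set G} {E R : Subgroup G} {c L : ℕ}

lemma BG.avoid (h : BG S E c) (hR : RotSub S E R L) (hL : 79 * c + 1 ≤ L) {n : G}
    (hn : n ∈ bigN E R) (hn1 : n ≠ 1) : L ≤ wd S 1 n + 70 * c := by
  obtain ⟨Y, p, q, hp, hq, hpq⟩ := h.green hR hL 1 hn hn1
  have := h.lip Y _ _ p q hp hq
  rw [mul_one] at this
  omega

lemma BG.cut (h : BG S E c) (hR : RotSub S E R L) {Y : G ⧸ E} {x z p q t : G}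
    (hp : Near (wd S) (cs Y) x p) (hq : Near (wd S) (cs Y) z q) (hpq : c < wd S p q)
    (ht : t ∈ rotN E R Y) : we S E x (t * z) ≤ we S E x z := by
  obtain ⟨a, ha, b, hb, hab⟩ := h.bgi Y x z p q hp hq hpq
  have hb' := cs_smul t hb
  rw [rotN_fix hR ht] at hb'
  have := h.geoE.tri x a (t * z)
  have := h.geoE.tri a (t * b) (t * z)
  have := h.cos Y a (t * b) ha hb'
  have := we_left (S := S) (E := E) t b z
  omega

/-- Lifting quadrilaterals. -/
lemma BG.lift4 (h : BG S E c) (hR : RotSub S E R L) (hL : 79 * c + 1 ≤ L)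
    (short : ∀ g ∈ E, L ≤ wd S 1 g + 69 * c → ∃ r ∈ R, wd S 1 (r * g) + c < wd S 1 g)
    (k : ℕ) : ∀ n x0 x1 x2 x3 : G, n ∈ bigN E R → wd S x0 (n * x0) < k →
      ∃ y1 y2 y3, y1 * x1⁻¹ ∈ bigN E R ∧ y2 * x2⁻¹ ∈ bigN E R ∧ y3 * x3⁻¹ ∈ bigN E R ∧
        we S E x0 y1 ≤ we S E x0 x1 ∧ we S E y1 y2 ≤ we S E x1 x2 ∧
        we S E y2 y3 ≤ we S E x2 x3 ∧ we S E y3 x0 ≤ we S E x3 (n * x0) := by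
  induction k with
  | zero => intro n x0 x1 x2 x3 _ hk; omega
  | succ k ih =>
    intro n x0 x1 x2 x3 hn hk
    by_cases hn1 : n = 1
    · subst hn1
      exact ⟨x1, x2, x3, by simp [Subgroup.one_mem], by simp [Subgroup.one_mem],
        by simp [Subgroup.one_mem], le_rfl, le_rfl, le_rfl, by simp⟩
    obtain ⟨Y, p, q, hp, hq, hpq⟩ := h.green hR hL x0 hn hn1
    obtain ⟨p1, hp1⟩ := exists_near (wd S) (cs_nonempty Y) x1
    obtain ⟨p2, hp2⟩ := exists_near (wd S) (cs_nonempty Y) x2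
    obtain ⟨p3, hp3⟩ := exists_near (wd S) (cs_nonempty Y) x3
    obtain ⟨r, hr, hrs⟩ := short _ (cs_div hp.1 hq.1) (by rw [← wd_one]; exact hpq)
    obtain ⟨t, ht⟩ : ∃ t, t = p * r * p⁻¹ := ⟨_, rfl⟩
    have htN : t ∈ rotN E R Y := by rw [ht]; exact rotN_mk hR hp.1 hr
    have htB := rotN_le_bigN htN
    have hdec : wd S x0 (t * n * x0) < k := by
      have a1 := h.two Y x0 (n * x0) p q hp hq (by omega)
      have a2 := h.geo.tri x0 p (t * n * x0)
      have a3 := h.geo.tri p (t * q) (t * n * x0)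
      have a4 : wd S (t * q) (t * n * x0) = wd S q (n * x0) := by rw [mul_assoc, wd_left]
      have a5 : wd S p (t * q) = wd S 1 (r * (p⁻¹ * q)) := by
        rw [wd_one, ht]; congr 1; group
      have a6 : wd S p q = wd S 1 (p⁻¹ * q) := wd_one _ _ _
      omega
    have htn : t * n ∈ bigN E R := Subgroup.mul_mem _ htB hn
    have key : ∀ y x : G, y * (t * x)⁻¹ ∈ bigN E R → y * x⁻¹ ∈ bigN E R := by
      intro y x hy
      have := Subgroup.mul_mem _ hy htB
      convert this using 1; group
    have t1 := h.geo.tri p p1 q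
    have t2 := h.geo.tri p1 p2 q
    have t3 := h.geo.tri p2 p3 q
    have hcases : c < wd S p p1 ∨ c < wd S p1 p2 ∨ c < wd S p2 p3 ∨ c < wd S p3 q := by omega
    have eL : ∀ x y : G, we S E (t * x) (t * y) = we S E x y := fun x y => we_left _ _ _
    rcases hcases with hc | hc | hc | hc
    · have hcut := h.cut hR hp hp1 hc htN
      obtain ⟨y1, y2, y3, b1, b2, b3, b4, b5, b6, b7⟩ :=
        ih (t * n) x0 (t * x1) (t * x2) (t * x3) htn hdec
      rw [mul_assoc, eL] at b7
      rw [eL] at b5 b6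
      exact ⟨y1, y2, y3, key _ _ b1, key _ _ b2, key _ _ b3, b4.trans hcut, b5, b6, b7⟩
    · have hcut := h.cut hR hp1 hp2 hc htN
      obtain ⟨y1, y2, y3, b1, b2, b3, b4, b5, b6, b7⟩ :=
        ih (t * n) x0 x1 (t * x2) (t * x3) htn hdec
      rw [mul_assoc, eL] at b7
      rw [eL] at b6
      exact ⟨y1, y2, y3, b1, key _ _ b2, key _ _ b3, b4, b5.trans hcut, b6, b7⟩
    · have hcut := h.cut hR hp2 hp3 hc htN
      obtain ⟨y1, y2, y3, b1, b2, b3, b4, b5, b6, b7⟩ :=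
        ih (t * n) x0 x1 x2 (t * x3) htn hdec
      rw [mul_assoc, eL] at b7
      exact ⟨y1, y2, y3, b1, b2, key _ _ b3, b4, b5, b6.trans hcut, b7⟩
    · have hcut := h.cut hR hp3 hq hc htN
      obtain ⟨y1, y2, y3, b1, b2, b3, b4, b5, b6, b7⟩ :=
        ih (t * n) x0 x1 x2 x3 htn hdec
      rw [mul_assoc] at b7
      exact ⟨y1, y2, y3, b1, b2, b3, b4, b5, b6, b7.trans hcut⟩

lemma quot_le {T : Set G} (hsym : ∀ s ∈ T, s⁻¹ ∈ T) (hgen : Subgroup.closure T = ⊤)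
    (N : Subgroup G) [N.Normal] (x y : G) :
    wd ((QuotientGroup.mk : G → G ⧸ N) '' T) (x : G ⧸ N) (y : G ⧸ N) ≤ wd T x y := by
  obtain ⟨l, hl, hn, hp⟩ := exists_geod hsym hgen (x⁻¹ * y)
  have := wordLength_le (S := (QuotientGroup.mk : G → G ⧸ N) '' T)
    (l := l.map (QuotientGroup.mk' N)) (by
      intro z hz
      obtain ⟨a, ha, rfl⟩ := List.mem_map.1 hz
      exact ⟨a, hl a ha, rfl⟩)
  rw [← map_list_prod, hp, List.length_map, hn] at this
  exact this

lemma quot_lift {T : Set G} (N : Subgroup G) [N.Normal]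
    (hsym : ∀ s ∈ ((QuotientGroup.mk : G → G ⧸ N) '' T), s⁻¹ ∈ ((QuotientGroup.mk : G → G ⧸ N) '' T))
    (hgen : Subgroup.closure ((QuotientGroup.mk : G → G ⧸ N) '' T) = ⊤)
    (x : G) (q : G ⧸ N) : ∃ y : G, (y : G ⧸ N) = q ∧
      wd T x y ≤ wd ((QuotientGroup.mk : G → G ⧸ N) '' T) (x : G ⧸ N) q := by
  obtain ⟨l, hl, hn, hp⟩ := exists_geod hsym hgen ((x : G ⧸ N)⁻¹ * q)
  have lift : ∀ l : List (G ⧸ N), (∀ z ∈ l, z ∈ ((QuotientGroup.mk : G → G ⧸ N) '' T)) →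
      ∃ l' : List G, (∀ z ∈ l', z ∈ T) ∧ l'.map (QuotientGroup.mk' N) = l := by
    intro l
    induction l with
    | nil => intro _; exact ⟨[], by simp, by simp⟩
    | cons a l ih =>
      intro hl
      obtain ⟨l', h1, h2⟩ := ih (fun z hz => hl z (List.mem_cons_of_mem _ hz))
      obtain ⟨b, hb, hba⟩ := hl a List.mem_cons_self
      refine ⟨b :: l', ?_, ?_⟩
      · intro z hz
        rcases List.mem_cons.1 hz with h | h
        · rw [h]; exact hb
        · exact h1 z h
      · rw [List.map_cons, h2, ← hba]; rfl
  obtain ⟨l', h1, h2⟩ := lift l hl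
  refine ⟨x * l'.prod, ?_, ?_⟩
  · have e : QuotientGroup.mk' N l'.prod = (x : G ⧸ N)⁻¹ * q := by
      rw [map_list_prod, h2, hp]
    have e2 : ((x * l'.prod : G) : G ⧸ N) = (x : G ⧸ N) * QuotientGroup.mk' N l'.prod := rfl
    rw [e2, e, mul_inv_cancel_left]
  · have e3 : l'.length = l.length := by rw [← h2, List.length_map]
    have := wordLength_le h1
    rw [wd_one]
    unfold wd
    simp only [inv_one, one_mul, inv_mul_cancel_left]
    rw [← hn]
    omega

lemma BG.quot_hyp (h : BG S E c) (hR : RotSub S E R L) (hL : 79 * c + 1 ≤ L)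
    (short : ∀ g ∈ E, L ≤ wd S 1 g + 69 * c → ∃ r ∈ R, wd S 1 (r * g) + c < wd S 1 g)
    [hN : (bigN E R).Normal] : IsHyperbolicGroup (G ⧸ bigN E R) := by
  obtain ⟨T, hT⟩ : ∃ T, T = S ∪ (E : Set G) := ⟨_, rfl⟩
  have hTs : ∀ s ∈ T, s⁻¹ ∈ T := by
    rw [hT]
    rintro s (hs | hs)
    · exact Or.inl (h.sym s hs)
    · exact Or.inr (E.inv_mem hs)
  have hTg : Subgroup.closure T = ⊤ := by
    rw [hT, eq_top_iff, ← h.gen]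
    exact Subgroup.closure_mono Set.subset_union_left
  obtain ⟨N, hNe⟩ : ∃ N, N = bigN E R := ⟨_, rfl⟩
  have red : ∀ k, ∀ g ∈ E, wd S 1 g < k → ∃ r ∈ R, wd S 1 (r * g) < L := by
    intro k
    induction k with
    | zero => intro g _ hk; omega
    | succ k ih =>
      intro g hg hk
      by_cases hc : L ≤ wd S 1 g
      · obtain ⟨r, hr, hrs⟩ := short g hg (by omega)
        obtain ⟨r', hr', hrs'⟩ := ih (r * g) (E.mul_mem (hR.le hr) hg) (by omega)
        exact ⟨r' * r, R.mul_mem hr' hr, by rw [mul_assoc]; exact hrs'⟩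
      · exact ⟨1, R.one_mem, by rw [one_mul]; omega⟩
  have hfin : ((QuotientGroup.mk : G → G ⧸ bigN E R) '' T).Finite := by
    have hb := ball_finite h.fin h.sym h.gen L
    refine ((h.fin.union hb).image (QuotientGroup.mk : G → G ⧸ bigN E R)).subset ?_
    rintro _ ⟨g, hg, rfl⟩
    rw [hT] at hg
    rcases hg with hg | hg
    · exact ⟨g, Or.inl hg, rfl⟩
    · obtain ⟨r, hr, hrs⟩ := red _ g hg (Nat.lt_succ_self _)
      refine ⟨r * g, Or.inr (le_of_lt hrs), ?_⟩
      have e : ((r * g : G) : G ⧸ bigN E R) = (r : G ⧸ bigN E R) * (g : G ⧸ bigN E R) := rfl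
      rw [e, (QuotientGroup.eq_one_iff r).2 (R_le_bigN hR hr), one_mul]
  have hQs : ∀ s ∈ ((QuotientGroup.mk : G → G ⧸ bigN E R) '' T),
      s⁻¹ ∈ ((QuotientGroup.mk : G → G ⧸ bigN E R) '' T) := by
    rintro _ ⟨s, hs, rfl⟩
    exact ⟨s⁻¹, hTs s hs, rfl⟩
  have hQg : Subgroup.closure ((QuotientGroup.mk : G → G ⧸ bigN E R) '' T) = ⊤ := by
    have := (QuotientGroup.mk' (bigN E R)).map_closure T
    rw [hTg, Subgroup.map_top_of_surjective _ (QuotientGroup.mk'_surjective _)] at this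
    exact this.symm
  have hgQ := wd_geo hQs hQg
  refine ⟨_, hfin, hQs, hQg, (c : ℝ), Nat.cast_nonneg _, gromov_of_hyp ?_⟩
  intro q0 q1 q2 q3
  obtain ⟨x0, rfl⟩ := QuotientGroup.mk_surjective q0
  obtain ⟨x1, rfl, l1⟩ := quot_lift _ hQs hQg x0 q1
  obtain ⟨x2, rfl, l2⟩ := quot_lift _ hQs hQg x1 q2
  obtain ⟨x3, rfl, l3⟩ := quot_lift _ hQs hQg x2 q3
  obtain ⟨x4, e4, l4⟩ := quot_lift _ hQs hQg x3 (x0 : G ⧸ bigN E R)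
  have hn : x4 * x0⁻¹ ∈ bigN E R := by
    have := QuotientGroup.eq.1 e4.symm
    have := hN.conj_mem _ this x0
    convert this using 1; group
  obtain ⟨y1, y2, y3, b1, b2, b3, b4, b5, b6, b7⟩ := h.lift4 hR hL short _ (x4 * x0⁻¹) x0 x1 x2 x3
    hn (Nat.lt_succ_self _)
  rw [inv_mul_cancel_right] at b7
  have same : ∀ y x : G, y * x⁻¹ ∈ bigN E R → (x : G ⧸ bigN E R) = (y : G ⧸ bigN E R) := by
    intro y x hy
    apply QuotientGroup.eq.2
    have := hN.conj_mem _ hy x⁻¹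
    convert this using 1; group
  have eT : ∀ x y : G, we S E x y = wd T x y := by intro x y; rw [hT]; rfl
  rw [eT, eT] at b4 b5 b6 b7
  have hh := h.hypE x0 y1 y2 y3
  have m1 := quot_le hTs hTg (bigN E R) x0 y2
  have m2 := quot_le hTs hTg (bigN E R) y1 y3
  rw [← same _ _ b2] at m1
  rw [← same _ _ b1, ← same _ _ b3] at m2
  have s1 := h.geoE.symm x0 y3
  have s2 := hgQ.symm (x0 : G ⧸ bigN E R) (x3 : G ⧸ bigN E R)
  rw [eT, eT] at s1
  rw [eT, eT, eT, eT, eT, eT] at hh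
  omega

lemma BG.quot_nonelem (h : BG S E c) {R1 : Subgroup G} (hR1 : RotSub S E R1 (10 * c + 1)) {r : G}
    (hr : r ∈ R1) (hr1 : r ≠ 1) (hr2 : r ^ 2 ≠ 1) (hE : E ≠ ⊤) :
    ∃ L0, ∀ (R : Subgroup G) (L : ℕ), RotSub S E R L → L0 ≤ L → ∀ [(bigN E R).Normal],
      IsNonElementaryGroup (G ⧸ bigN E R) := by
  obtain ⟨g, hg⟩ : ∃ g, g ∉ E := by
    by_contra hcon
    push Not at hcon
    exact hE ((Subgroup.eq_top_iff' E).2 hcon)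
  obtain ⟨y, hy⟩ : ∃ y, y = g * r * g⁻¹ := ⟨_, rfl⟩
  let T : Bool → G ⧸ E := fun i => if i then (g : G ⧸ E) else ((1 : G) : G ⧸ E)
  have hT : T false ≠ T true := by
    intro e
    have : ((1 : G) : G ⧸ E) = (g : G ⧸ E) := e
    apply hg
    simpa using QuotientGroup.eq.1 this
  have hTn : ∀ i, T (!i) ≠ T i := by
    intro i; cases i
    · exact hT.symm
    · exact hT
  let A : Bool → Set G := fun i => if i then {y, y⁻¹, y ^ 2, (y ^ 2)⁻¹} else {r, r⁻¹}
  have hy1 : y ≠ 1 := by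
    intro e; apply hr1
    rw [hy] at e
    simpa using e
  have hy2 : y ^ 2 ≠ 1 := by
    intro e; apply hr2
    rw [hy, conj_pow] at e
    simpa using e
  have hrN : r ∈ rotN E R1 (T false) := by
    have := rotN_mk hR1 (Y := T false) (g := 1) rfl hr
    simpa using this
  have hyN : y ∈ rotN E R1 (T true) := by rw [hy]; exact rotN_mk hR1 (Y := T true) rfl hr
  have hA : ∀ i, ∀ b ∈ A i, b ∈ rotN E R1 (T i) ∧ b ≠ 1 := by
    intro i b hb
    cases i
    · have hb' : b = r ∨ b = r⁻¹ := hb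
      rcases hb' with rfl | rfl
      · exact ⟨hrN, hr1⟩
      · exact ⟨Subgroup.inv_mem _ hrN, inv_ne_one.2 hr1⟩
    · have hb' : b = y ∨ b = y⁻¹ ∨ b = y ^ 2 ∨ b = (y ^ 2)⁻¹ := hb
      rcases hb' with rfl | rfl | rfl | rfl
      · exact ⟨hyN, hy1⟩
      · exact ⟨Subgroup.inv_mem _ hyN, inv_ne_one.2 hy1⟩
      · exact ⟨Subgroup.pow_mem _ hyN 2, hy2⟩
      · exact ⟨Subgroup.inv_mem _ (Subgroup.pow_mem _ hyN 2), inv_ne_one.2 hy2⟩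
  have hAfin : ∀ i, (A i).Finite := by
    intro i; cases i
    · exact Set.toFinite ({r, r⁻¹} : Set G)
    · exact Set.toFinite ({y, y⁻¹, y ^ 2, (y ^ 2)⁻¹} : Set G)
  have hBi : ∀ i, ∃ B, ∀ b ∈ A i, DD S E (T i) (T (!i)) (b • T (!i)) ≤ B := by
    intro i
    obtain ⟨B, hB⟩ := ((hAfin i).image (fun b => DD S E (T i) (T (!i)) (b • T (!i)))).bddAbove
    exact ⟨B, fun b hb => hB ⟨b, hb, rfl⟩⟩
  obtain ⟨B1, hB1⟩ := hBi true
  obtain ⟨B2, hB2⟩ := hBi false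
  obtain ⟨B, hBd⟩ : ∃ B, B = B1 + B2 + (wd S 1 g + 5 * c) := ⟨_, rfl⟩
  have hB0 : ∀ Y, Y ≠ T false → Y ≠ T true → DD S E Y (T false) (T true) ≤ B := by
    intro Y h1 h2
    obtain ⟨p, hp⟩ := exists_near (wd S) (cs_nonempty Y) 1
    obtain ⟨q, hq⟩ := exists_near (wd S) (cs_nonempty Y) g
    have a := h.D_near h1.symm h2.symm (x := 1) (z := g) rfl rfl hp hq
    have := h.lip Y _ _ p q hp hq
    omega
  refine ⟨75 * c + B + 1, ?_⟩
  intro R L hR hL hN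
  have hbounds : ∀ u, Alt A true u → u ∉ bigN E R := by
    intro u hu hun
    obtain ⟨h1, h2, h3⟩ := alt_bounds h.projSys (B := B) hT
      (fun i b hb => rotN_fix hR1 (hA i b hb).1)
      (fun i b hb => by
        have := (h.rotFam hR1).spin (T i) b (T (!i)) (hA i b hb).1 (hA i b hb).2 (hTn i)
        omega)
      (fun i b hb => by
        cases i
        · have := hB2 b hb; omega
        · have := hB1 b hb; omega) hB0 hu
    rcases windmill h.projSys (h.rotFam hR) (M := L - 65 * c) (by omega) (by omega) (T false) hun with
      h4 | ⟨Z, hZ1, hZ2, hZ3⟩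
    · rw [rotN_fix hR h4] at h2
      have := h.projSys.diag (T true) (T false) hT
      have e : T (!true) = T false := rfl
      rw [e] at h2
      omega
    · have := h3 Z hZ1 hZ2
      have e : T (!true) = T false := rfl
      rw [e] at this
      omega
  apply nonelem_of_comm (((y * r : G)) : G ⧸ bigN E R) ((y ^ 2 * r : G) : G ⧸ bigN E R)
  intro j e
  refine hbounds _ (alt_comm (A := A) (x := r) (y := y) ?_ ?_ ?_ ?_ ?_ ?_ j)
    ((QuotientGroup.eq_one_iff _).1 e)
  · exact Or.inl rfl
  · exact Or.inr rfl
  · exact Or.inl rfl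
  · exact Or.inr (Or.inl rfl)
  · exact Or.inr (Or.inr (Or.inl rfl))
  · exact Or.inr (Or.inr (Or.inr rfl))

end Quot
end HypQ

namespace HypQ
section StepLemma
variable {G : Type*} [Group G] {S : Set G} {δ : ℕ}

lemma mem_elemSub (w : G) : w ∈ elemSub w := ⟨1, 1, by simp, by simp, by group⟩

lemma exists_n0 (hfin : S.Finite) (hsym : ∀ s ∈ S, s⁻¹ ∈ S) (hgen : Subgroup.closure S = ⊤)
    (hh : Hyp (wd S) δ) {w : G} (hw : wd S 1 w + (2 * δ + 1) ≤ wd S 1 (w ^ 2)) :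
    ∃ n : ℕ, 1 ≤ n ∧ ∀ g ∈ elemSub w, ∃ k : ℤ, g * w ^ n * g⁻¹ = (w ^ n) ^ k := by
  classical
  have hg := wd_geo hsym hgen
  have hball := ball_finite hfin hsym hgen (3 * wd S 1 w + 10 * δ + 10)
  obtain ⟨P, hP⟩ : ∃ P : ℕ → Prop, P = fun n =>
    ∀ g ∈ elemSub w, ∃ k : ℤ, g * w ^ n * g⁻¹ = w ^ k := ⟨_, rfl⟩
  have hex : ∃ n, 0 < n ∧ P n := by
    have hpt : ∀ t : G, ∃ p : ℤ, p ≠ 0 ∧ (t ∈ elemSub w → ∃ q : ℤ, t⁻¹ * w ^ p * t = w ^ q) := by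
      intro t
      by_cases ht : t ∈ elemSub w
      · obtain ⟨p, q, hp, _, e⟩ := (elemSub w).inv_mem ht
        exact ⟨p, hp, fun _ => ⟨q, by simpa using e⟩⟩
      · exact ⟨1, by simp, fun h => absurd h ht⟩
    choose p hp0 hp using hpt
    refine ⟨∏ t ∈ hball.toFinset, (p t).natAbs, ?_, ?_⟩
    · exact Finset.prod_pos (fun t _ => Int.natAbs_pos.2 (hp0 t))
    · rw [hP]
      intro g hgE
      obtain ⟨k, hk⟩ := elem_near hg hh hw hgE
      obtain ⟨t, ht⟩ : ∃ t, t = g⁻¹ * w ^ k := ⟨_, rfl⟩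
      have htE : t ∈ elemSub w := by
        rw [ht]
        exact Subgroup.mul_mem _ (Subgroup.inv_mem _ hgE) (Subgroup.zpow_mem _ (mem_elemSub w) k)
      rw [wd_one, ← ht] at hk
      obtain ⟨q, hq⟩ := hp t htE
      obtain ⟨u, hu⟩ : (p t) ∣ ((∏ t ∈ hball.toFinset, (p t).natAbs : ℕ) : ℤ) := by
        rw [← Int.natAbs_dvd]
        exact Int.natCast_dvd_natCast.2
          (Finset.dvd_prod_of_mem (fun t => (p t).natAbs) (hball.mem_toFinset.2 hk))
      refine ⟨q * u, ?_⟩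
      rw [← zpow_natCast, hu]
      have e1 : t⁻¹ * w ^ (p t * u) * t = w ^ (q * u) := by
        have := conj_zpow (a := t⁻¹) (b := w ^ (p t)) (i := u)
        rw [inv_inv, hq, ← zpow_mul, ← zpow_mul] at this
        exact this.symm
      have e2 : g = w ^ k * t⁻¹ := by rw [ht]; group
      rw [e2]
      calc w ^ k * t⁻¹ * w ^ (p t * u) * (w ^ k * t⁻¹)⁻¹
          = w ^ k * (t⁻¹ * w ^ (p t * u) * t) * (w ^ k)⁻¹ := by group
        _ = w ^ (q * u) := by rw [e1]; group
  obtain ⟨n, ⟨hn0, hn⟩, hmin⟩ : ∃ n, (0 < n ∧ P n) ∧ ∀ m < n, ¬ (0 < m ∧ P m) :=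
    ⟨Nat.find hex, Nat.find_spec hex, fun m hm => Nat.find_min hex hm⟩
  rw [hP] at hn
  refine ⟨n, hn0, fun g hgE => ?_⟩
  obtain ⟨k, hk⟩ := hn g hgE
  have hkI : ∀ g' ∈ elemSub w, ∃ l : ℤ, g' * w ^ k * g'⁻¹ = w ^ l := by
    intro g' hg'
    obtain ⟨l, hl⟩ := hn (g' * g) (Subgroup.mul_mem _ hg' hgE)
    exact ⟨l, by rw [← hl, ← hk]; group⟩
  have hn' : (n : ℤ) ≠ 0 := by omega
  have hz : k % n = 0 := by
    by_contra hne
    have h1 := Int.emod_nonneg k hn'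
    have h2 := Int.emod_lt_of_pos k (show (0 : ℤ) < n by omega)
    obtain ⟨m, hm⟩ := Int.eq_ofNat_of_zero_le h1
    refine hmin m (by omega) ⟨by omega, ?_⟩
    rw [hP]
    intro g' hg'
    obtain ⟨l, hl⟩ := hkI g' hg'
    obtain ⟨l', hl'⟩ := hn g' hg'
    refine ⟨l - l' * (k / n), ?_⟩
    have e : (m : ℤ) = k - n * (k / n) := by
      have := Int.mul_ediv_add_emod k n
      have : (m : ℤ) = k % n := hm.symm
      omega
    have e3 : g' * w ^ ((n : ℤ) * (k / n)) * g'⁻¹ = w ^ (l' * (k / n)) := by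
      rw [zpow_mul w (n : ℤ), ← conj_zpow, zpow_natCast, hl', ← zpow_mul]
    rw [← zpow_natCast, e, zpow_sub, zpow_sub, ← hl, ← e3]
    group
  refine ⟨k / n, ?_⟩
  rw [hk, ← zpow_natCast, ← zpow_mul, Int.mul_ediv_cancel' (Int.dvd_of_emod_eq_zero hz)]

lemma elem_ne_top (hfin : S.Finite) (hsym : ∀ s ∈ S, s⁻¹ ∈ S) (hgen : Subgroup.closure S = ⊤)
    (hh : Hyp (wd S) δ) {w : G} (hw : wd S 1 w + (2 * δ + 1) ≤ wd S 1 (w ^ 2))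
    (hne : IsNonElementaryGroup G) : elemSub w ≠ ⊤ := by
  intro htop
  have hg := wd_geo hsym hgen
  have hball := ball_finite hfin hsym hgen (3 * wd S 1 w + 10 * δ + 10)
  have hf : Finite (G ⧸ Subgroup.zpowers w) := by
    refine Set.finite_univ_iff.1 ((hball.image
      (QuotientGroup.mk : G → G ⧸ Subgroup.zpowers w)).subset ?_)
    intro q _
    obtain ⟨g, rfl⟩ := QuotientGroup.mk_surjective q
    obtain ⟨k, hk⟩ := elem_near hg hh hw (g := g⁻¹) (by rw [htop]; trivial)
    rw [wd_one, inv_inv] at hk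
    refine ⟨g * w ^ k, hk, ?_⟩
    apply QuotientGroup.eq.2
    rw [mul_inv_rev, mul_assoc, inv_mul_cancel, mul_one, ← zpow_neg]
    exact Subgroup.zpow_mem_zpowers w _
  exact Subgroup.index_ne_zero_of_finite (hne w)

lemma lox_mono' (hg : GeoM (wd S)) (hh : Hyp (wd S) δ) {w : G}
    (hw : wd S 1 w + (2 * δ + 1) ≤ wd S 1 (w ^ 2)) {a b : ℕ} (hab : a ≤ b) :
    wd S 1 (w ^ a) + (b - a) ≤ wd S 1 (w ^ b) := by
  obtain ⟨t, rfl⟩ := Nat.exists_eq_add_of_le hab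
  clear hab
  induction t with
  | zero => simp
  | succ t ih =>
    have := lox_mono hg hh hw (a + t)
    rw [← add_assoc]
    omega

lemma main_step (hG : IsHyperbolicGroup G) (hne : IsNonElementaryGroup G) :
    ∃ g0 : G, (∀ k : ℕ, 1 ≤ k → g0 ^ k ≠ 1) ∧ ∀ F : Set G, F.Finite → (1 : G) ∉ F →
      ∃ K : ℕ, ∀ m, K ≤ m → ∃ (M : Subgroup G) (hM : M.Normal), g0 ^ m ∈ M ∧ (∀ f ∈ F, f ∉ M) ∧
        QuotientIsNonElementaryHyperbolic M hM := by
  obtain ⟨S, hfin, hsym, hgen, δr, _, hδr⟩ := hG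
  obtain ⟨δ, hh⟩ := hyp_of_gromov hsym hgen hδr
  have hg := wd_geo hsym hgen
  obtain ⟨w, hw⟩ := exists_w hfin hsym hgen hh hne
  obtain ⟨E, hE⟩ : ∃ E, E = elemSub w := ⟨_, rfl⟩
  have hwE : w ∈ E := by rw [hE]; exact mem_elemSub w
  have hEtop : E ≠ ⊤ := by rw [hE]; exact elem_ne_top hfin hsym hgen hh hw hne
  obtain ⟨n0, hn0, hnorm⟩ := exists_n0 hfin hsym hgen hh hw
  rw [← hE] at hnorm
  have hcone : Cone S E δ (5 * wd S 1 w + 16 * δ + 12) := by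
    rw [hE]
    exact ⟨hfin, hsym, hgen, hh, elem_qc hg hh hw, elem_sep hfin hsym hgen hh hw⟩
  obtain ⟨c, h⟩ := hcone.exists_BG
  obtain ⟨c1, hc1⟩ : ∃ c1, c1 = 3 * wd S 1 w + 10 * δ + 10 := ⟨_, rfl⟩
  have hnear : ∀ g ∈ E, ∃ k : ℤ, wd S g (w ^ k) ≤ c1 := by
    rw [hE, hc1]; intro g hgE; exact elem_near hg hh hw hgE
  have hRot : ∀ m, RotSub S E (Subgroup.zpowers ((w ^ n0) ^ m)) (wd S 1 (w ^ (n0 * m))) := by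
    intro m
    refine ⟨?_, ?_, ?_⟩
    · rw [Subgroup.zpowers_le]
      exact E.pow_mem (E.pow_mem hwE _) _
    · rintro g hgE r ⟨j, rfl⟩
      obtain ⟨k, hk⟩ := hnorm g hgE
      refine ⟨k * j, ?_⟩
      show ((w ^ n0) ^ m) ^ (k * j) = g * ((w ^ n0) ^ m) ^ j * g⁻¹
      rw [← conj_zpow, ← conj_pow, hk, zpow_mul]
      congr 1
      generalize w ^ n0 = a
      rw [← zpow_natCast a m, ← zpow_natCast (a ^ k) m, ← zpow_mul, ← zpow_mul, mul_comm]
    · rintro r ⟨j, rfl⟩ hr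
      have hr' : ((w ^ n0) ^ m) ^ j ≠ 1 := hr
      show _ ≤ wd S 1 (((w ^ n0) ^ m) ^ j)
      have hj : j ≠ 0 := by rintro rfl; exact hr' (zpow_zero _)
      have e : ((w ^ n0) ^ m) ^ j = w ^ (((n0 * m : ℕ) : ℤ) * j) := by
        rw [← pow_mul, ← zpow_natCast, ← zpow_mul]
      rw [e, wd_zpow hg w (((n0 * m : ℕ) : ℤ) * j), Int.natAbs_mul, Int.natAbs_natCast]
      have : n0 * m ≤ n0 * m * j.natAbs := Nat.le_mul_of_pos_right _ (Int.natAbs_pos.2 hj)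
      have := lox_mono' hg hh hw this
      omega
  have hlen : ∀ m, m ≤ wd S 1 (w ^ (n0 * m)) := by
    intro m
    have h1 := lox_le hg hh hw (n0 * m)
    have h2 : m ≤ n0 * m := Nat.le_mul_of_pos_left _ hn0
    omega
  have hinf : ∀ k : ℕ, 1 ≤ k → (w ^ n0) ^ k ≠ 1 := by
    intro k hk e
    have := hlen k
    rw [pow_mul, e, hg.self] at this
    omega
  have hR1 : RotSub S E (Subgroup.zpowers ((w ^ n0) ^ (10 * c + 1))) (10 * c + 1) := by
    have a := hRot (10 * c + 1)
    exact ⟨a.le, a.norm, fun r hr hr1 => (hlen _).trans (a.len r hr hr1)⟩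
  obtain ⟨L0, hL0⟩ := h.quot_nonelem hR1 (Subgroup.mem_zpowers _) (hinf _ (by omega))
    (by rw [← pow_mul]; exact hinf _ (by omega)) hEtop
  refine ⟨w ^ n0, hinf, ?_⟩
  intro F hF h1F
  obtain ⟨B, hB⟩ := (hF.image (wd S 1)).bddAbove
  refine ⟨L0 + B + 79 * c + 1 + 2 * (c1 + 70 * c + 1), ?_⟩
  intro m hm
  have hmL := hlen m
  have hR := hRot m
  have hL : 79 * c + 1 ≤ wd S 1 (w ^ (n0 * m)) := by omega
  have hN := bigN_normal hR
  refine ⟨bigN E (Subgroup.zpowers ((w ^ n0) ^ m)), hN, R_le_bigN hR (Subgroup.mem_zpowers _), ?_, ?_, ?_⟩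
  · intro f hf hfM
    have := h.avoid hR hL hfM (fun e => h1F (e ▸ hf))
    have : wd S 1 f ≤ B := hB ⟨f, hf, rfl⟩
    omega
  · refine h.quot_hyp hR hL ?_
    intro g hgE hgL
    obtain ⟨k, hk⟩ := hnear g hgE
    obtain ⟨ν, hν⟩ : ∃ ν, ν = n0 * m := ⟨_, rfl⟩
    have hνm : m ≤ ν := by rw [hν]; exact Nat.le_mul_of_pos_left _ hn0
    have hνp : 0 < ν := by omega
    have hb : (k.bmod ν).natAbs ≤ ν / 2 := by
      have h1 := Int.bmod_lt (x := k) hνp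
      have h2 := Int.le_bmod (x := k) hνp
      omega
    have hb2 := Int.bmod_add_bdiv k ν
    refine ⟨((w ^ n0) ^ m) ^ (-(k.bdiv ν)), ⟨_, rfl⟩, ?_⟩
    have e : ((w ^ n0) ^ m) ^ (-(k.bdiv ν)) = w ^ (k.bmod ν - k) := by
      rw [← pow_mul, ← hν, ← zpow_natCast, ← zpow_mul]
      congr 1
      rw [mul_neg]
      omega
    rw [e]
    have e2 : wd S (w ^ (k.bmod ν - k) * g) (w ^ (k.bmod ν)) = wd S g (w ^ k) := by
      rw [← wd_left S (w ^ (k.bmod ν - k)) g, ← zpow_add]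
      congr 2; omega
    have t := hg.tri 1 (w ^ (k.bmod ν)) (w ^ (k.bmod ν - k) * g)
    have s := hg.symm (w ^ (k.bmod ν)) (w ^ (k.bmod ν - k) * g)
    have z := wd_zpow hg w (k.bmod ν)
    have mo := lox_mono' hg hh hw (show (k.bmod ν).natAbs ≤ ν by omega)
    rw [← hν] at hgL
    omega
  · exact hL0 _ _ hR (by omega)

end StepLemma
end HypQ

namespace HypQ

section Transport
variable {G H : Type*} [Group G] [Group H]

lemma wordLength_equiv (e : G ≃* H) (S : Set G) (g : G) :
    wordLength (e '' S) (e g) = wordLength S g := by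
  unfold wordLength
  congr 1
  ext k
  constructor
  · rintro ⟨l, hl, hk, hp⟩
    refine ⟨l.map e.symm, ?_, by simpa using hk, ?_⟩
    · intro x hx
      obtain ⟨y, hy, rfl⟩ := List.mem_map.1 hx
      obtain ⟨z, hz, rfl⟩ := hl y hy
      simpa using hz
    · rw [← map_list_prod e.symm, hp]; simp
  · rintro ⟨l, hl, hk, hp⟩
    refine ⟨l.map e, ?_, by simpa using hk, ?_⟩
    · intro x hx
      obtain ⟨y, hy, rfl⟩ := List.mem_map.1 hx
      exact ⟨y, hl y hy, rfl⟩
    · rw [← map_list_prod e, hp]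

lemma gromov_equiv (e : G ≃* H) (S : Set G) (w x y : H) :
    wordGromovProduct (e '' S) w x y = wordGromovProduct S (e.symm w) (e.symm x) (e.symm y) := by
  unfold wordGromovProduct
  rw [← wordLength_equiv e, ← wordLength_equiv e, ← wordLength_equiv e]
  simp

lemma hyperbolic_equiv (e : G ≃* H) (h : IsHyperbolicGroup G) : IsHyperbolicGroup H := by
  obtain ⟨S, hf, hs, hc, δ, hδ, hh⟩ := h
  refine ⟨e '' S, hf.image _, ?_, ?_, δ, hδ, ?_⟩
  · rintro _ ⟨s, hs', rfl⟩
    exact ⟨s⁻¹, hs s hs', map_inv e s⟩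
  · have := MonoidHom.map_closure e.toMonoidHom S
    rw [hc] at this
    have h2 : Subgroup.map e.toMonoidHom ⊤ = ⊤ :=
      Subgroup.map_top_of_surjective _ e.surjective
    rw [h2] at this
    exact this.symm
  · intro x y z w
    simp only [gromov_equiv]
    exact hh _ _ _ _

lemma nonelem_equiv (e : G ≃* H) (h : IsNonElementaryGroup G) : IsNonElementaryGroup H := by
  intro x
  have h1 := h (e.symm x)
  have h2 : (Subgroup.zpowers x).comap e.toMonoidHom = Subgroup.zpowers (e.symm x) := by
    ext y
    constructor
    · rintro ⟨k, hk⟩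
      refine ⟨k, ?_⟩
      have hk' : x ^ k = e y := hk
      show (e.symm x) ^ k = y
      rw [← map_zpow, hk']; simp
    · rintro ⟨k, rfl⟩
      refine ⟨k, ?_⟩
      show x ^ k = e ((e.symm x) ^ k)
      simp
  rw [← h2, Subgroup.index_comap_of_surjective _ e.surjective] at h1
  exact h1

end Transport

section Tree
variable {Γ : Type*} [Group Γ]

/-- A node of the tree: a normal subgroup with non-elementary hyperbolic quotient, together with
a finite set of elements which is to be kept outside all further subgroups. -/
structure Node (Γ : Type*) [Group Γ] where
  N : Subgroup Γ
  nor : N.Normal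
  F : Set Γ
  fin : F.Finite
  disj : ∀ f ∈ F, f ∉ N
  q : QuotientIsNonElementaryHyperbolic N nor

lemma quot_comap (N : Subgroup Γ) [hN : N.Normal] (M : Subgroup (Γ ⧸ N)) (hM : M.Normal)
    (h : QuotientIsNonElementaryHyperbolic M hM) :
    QuotientIsNonElementaryHyperbolic (M.comap (QuotientGroup.mk' N)) (hM.comap _) := by
  haveI := hM
  haveI : (M.comap (QuotientGroup.mk' N)).Normal := hM.comap _
  let φ : Γ →* (Γ ⧸ N) ⧸ M := (QuotientGroup.mk' M).comp (QuotientGroup.mk' N)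
  have hφ : Function.Surjective φ :=
    (QuotientGroup.mk'_surjective M).comp (QuotientGroup.mk'_surjective N)
  have hk : φ.ker = M.comap (QuotientGroup.mk' N) := by
    rw [← MonoidHom.comap_ker, QuotientGroup.ker_mk']
  let e : (Γ ⧸ N) ⧸ M ≃* Γ ⧸ M.comap (QuotientGroup.mk' N) :=
    (QuotientGroup.quotientKerEquivOfSurjective φ hφ).symm.trans
      (QuotientGroup.quotientMulEquivOfEq hk)
  exact ⟨hyperbolic_equiv e h.1, nonelem_equiv e h.2⟩

lemma node_step (ν : Node Γ) : ∃ (g : Γ) (ch : ℕ → Node Γ) (p : ℕ → ℕ),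
    (∀ k : ℕ, 1 ≤ k → g ^ k ∉ ν.N) ∧ (∀ i, ν.N ≤ (ch i).N) ∧ (∀ i, ν.F ⊆ (ch i).F) ∧
    (∀ i, g ∈ (ch i).F) ∧ (∀ i, g ^ p i ∈ (ch i).N) ∧ (∀ i, 1 ≤ p i) ∧
    (∀ i j, i ≠ j → Nat.Coprime (p i) (p j)) := by
  haveI := ν.nor
  obtain ⟨gb, hgb, hstep⟩ := main_step ν.q.1 ν.q.2
  obtain ⟨g, rfl⟩ := QuotientGroup.mk'_surjective ν.N gb
  have hg : ∀ k : ℕ, 1 ≤ k → g ^ k ∉ ν.N := by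
    intro k hk hm
    apply hgb k hk
    rw [← map_pow]
    exact (QuotientGroup.eq_one_iff _).2 hm
  obtain ⟨K, hK⟩ := hstep ((QuotientGroup.mk' ν.N) '' (insert g ν.F))
    ((ν.fin.insert g).image _) (by
      rintro ⟨f, hf, hf1⟩
      have hfN : f ∈ ν.N := (QuotientGroup.eq_one_iff _).1 hf1
      rcases hf with rfl | hf
      · exact hg 1 le_rfl (by simpa using hfN)
      · exact ν.disj f hf hfN)
  let p : ℕ → ℕ := fun i => Nat.nth Nat.Prime (K + i)
  have hpp : ∀ i, (p i).Prime := fun i => Nat.prime_nth_prime _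
  have hpK : ∀ i, K ≤ p i := fun i =>
    (Nat.le_add_right K i).trans (Nat.nth_strictMono Nat.infinite_setOf_prime).le_apply
  choose M hM h1 h2 h3 using fun i => hK (p i) (hpK i)
  refine ⟨g, fun i => ⟨(M i).comap (QuotientGroup.mk' ν.N), (hM i).comap _, insert g ν.F,
    ν.fin.insert g, fun f hf hfM => h2 i _ ⟨f, hf, rfl⟩ hfM, quot_comap _ _ _ (h3 i)⟩, p, hg,
    ?_, ?_, ?_, ?_, ?_, ?_⟩
  · intro i x hx
    show QuotientGroup.mk' ν.N x ∈ M i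
    rw [show QuotientGroup.mk' ν.N x = 1 from (QuotientGroup.eq_one_iff _).2 hx]
    exact one_mem _
  · intro i; exact Set.subset_insert _ _
  · intro i; exact Set.mem_insert _ _
  · intro i
    show QuotientGroup.mk' ν.N (g ^ p i) ∈ M i
    rw [map_pow]; exact h1 i
  · intro i; exact (hpp i).one_le
  · intro i j hij
    refine (Nat.coprime_primes (hpp i) (hpp j)).2 ?_
    intro e
    have := (Nat.nth_strictMono Nat.infinite_setOf_prime).injective e
    omega

/-- Descend in the tree along a finite sequence. -/
def descend (ch : Node Γ → ℕ → Node Γ) : Node Γ → List ℕ → Node Γ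
  | ν, [] => ν
  | ν, i :: l => descend ch (ch ν i) l

lemma tree_exists (hΓ : IsHyperbolicGroup Γ) (hne : IsNonElementaryGroup Γ) :
    ∃ (N : List ℕ → Subgroup Γ) (hN : ∀ α, (N α).Normal),
      Function.Injective N ∧
      (∀ α β : List ℕ, α <+: β → N α ≤ N β) ∧
      ∀ α : List ℕ, QuotientIsNonElementaryHyperbolic (N α) (hN α) := by
  choose g ch p hg hN hF hgF hp hp1 hco using node_step (Γ := Γ)
  have dN : ∀ (l : List ℕ) (ν : Node Γ), ν.N ≤ (descend ch ν l).N := by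
    intro l
    induction l with
    | nil => intro ν; exact le_rfl
    | cons i l ih => intro ν; exact (hN ν i).trans (ih _)
  have dF : ∀ (l : List ℕ) (ν : Node Γ), ν.F ⊆ (descend ch ν l).F := by
    intro l
    induction l with
    | nil => intro ν; exact subset_rfl
    | cons i l ih => intro ν; exact (hF ν i).trans (ih _)
  have dapp : ∀ (l l' : List ℕ) (ν : Node Γ),
      descend ch ν (l ++ l') = descend ch (descend ch ν l) l' := by
    intro l l'
    induction l with
    | nil => intro ν; rfl
    | cons i l ih => intro ν; exact ih _
  have key : ∀ (i : ℕ) (l : List ℕ) (ν : Node Γ), (descend ch ν (i :: l)).N ≠ ν.N := by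
    intro i l ν e
    have h1 : g ν ^ p ν i ∈ (descend ch ν (i :: l)).N := dN l (ch ν i) (hp ν i)
    rw [e] at h1
    exact hg ν _ (hp1 ν i) h1
  have inj : ∀ (α β : List ℕ) (ν : Node Γ),
      (descend ch ν α).N = (descend ch ν β).N → α = β := by
    intro α
    induction α with
    | nil =>
      intro β ν e
      cases β with
      | nil => rfl
      | cons j β => exact absurd e.symm (key j β ν)
    | cons i α ih =>
      intro β ν e
      cases β with
      | nil => exact absurd e (key i α ν)
      | cons j β =>
        by_cases hij : i = j
        · subst hij
          rw [ih β (ch ν i) e]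
        · exfalso
          have h1 : g ν ^ p ν i ∈ (descend ch ν (i :: α)).N := dN α (ch ν i) (hp ν i)
          have h2 : g ν ^ p ν j ∈ (descend ch ν (j :: β)).N := dN β (ch ν j) (hp ν j)
          rw [← e] at h2
          have h3 : g ν ∈ (descend ch ν (i :: α)).F := dF α (ch ν i) (hgF ν i)
          apply (descend ch ν (i :: α)).disj _ h3
          have hb := Nat.gcd_eq_gcd_ab (p ν i) (p ν j)
          rw [(hco ν i j hij).gcd_eq_one] at hb
          have h4 : g ν = (g ν ^ p ν i) ^ ((p ν i).gcdA (p ν j)) *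
              (g ν ^ p ν j) ^ ((p ν i).gcdB (p ν j)) := by
            rw [← zpow_natCast, ← zpow_natCast, ← zpow_mul, ← zpow_mul, ← zpow_add, ← hb]
            simp
          rw [h4]
          exact mul_mem (Subgroup.zpow_mem _ h1 _) (Subgroup.zpow_mem _ h2 _)
  let root : Node Γ := ⟨⊥, inferInstance, ∅, Set.finite_empty, by simp,
    ⟨hyperbolic_equiv QuotientGroup.quotientBot.symm hΓ,
      nonelem_equiv QuotientGroup.quotientBot.symm hne⟩⟩
  refine ⟨fun α => (descend ch root α).N, fun α => (descend ch root α).nor, ?_, ?_,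
    fun α => (descend ch root α).q⟩
  · intro α β e; exact inj α β root e
  · rintro α _ ⟨γ, rfl⟩
    show (descend ch root α).N ≤ (descend ch root (α ++ γ)).N
    rw [dapp]
    exact dN _ _

end Tree
end HypQ

/-- Every non-elementary hyperbolic group `Γ` has a family `{N_α : α ∈ ℕ^{<∞}}` of
normal subgroups, indexed by finite sequences of natural numbers, such that: (i) the
`N_α` are pairwise distinct; (ii) if `α` is a prefix of `β` then `N_α ⊆ N_β` (so
`Q_α = Γ/N_α` surjects `Γ`-equivariantly onto `Q_β`); (iii) every quotient `Γ/N_α` is a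
non-elementary hyperbolic group. -/
theorem tree_of_nonelementary_hyperbolic_quotients
    {Γ : Type*} [Group Γ] (hΓ : IsHyperbolicGroup Γ) (hne : IsNonElementaryGroup Γ) :
    ∃ (N : List ℕ → Subgroup Γ) (hN : ∀ α, (N α).Normal),
      Function.Injective N ∧
      (∀ α β : List ℕ, α <+: β → N α ≤ N β) ∧
      ∀ α : List ℕ, QuotientIsNonElementaryHyperbolic (N α) (hN α) := by
  exact HypQ.tree_exists hΓ hne
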